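/- Suppose the delayed mass-action system is a DeCBMAS and the network is a combination of ℓ subnetworks each of which is a 2d sub-DeCBMAS. Let W be a semilocking set of the combined network in Case I (some W^(p) is a facet-type semilocking set of subnetwork p) with S_c ∩ W = ∅. Then no ω-limit point of any bounded solution with positive initial condition lies on the boundary L_W. -/

import Mathlib

open Finset Filter

variable {n r : ℕ}

/-- Mass-action monomial `x^y = ∏ j, x j ^ y j`. -/
def mono (x : Fin n → ℝ) (y : Fin n → ℕ) : ℝ := ∏ j, x j ^ y j

/-- A (bounded-domain) solution of the delayed mass-action system whose reactions are
those in the index set `R` (with reactant complexes `y`, product complexes `y'`,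
rate constants `k`, delays `τ`, and maximal delay `τm`):
nonnegative, continuous on `[-τm, ∞)`, and satisfying the delay differential equation
`x'(t) = ∑ i ∈ R, k i (x(t-τ i)^{y i} • y' i - x(t)^{y i} • y i)` for `t > 0`. -/
def IsSolutionOn (y y' : Fin r → Fin n → ℕ) (k τ : Fin r → ℝ) (τm : ℝ)
    (R : Finset (Fin r)) (x : ℝ → Fin n → ℝ) : Prop :=
  (∀ t ∈ Set.Ici (-τm), ∀ j, 0 ≤ x t j) ∧
  ContinuousOn x (Set.Ici (-τm)) ∧
  ∀ t > (0 : ℝ), HasDerivAt x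
    (fun j => ∑ i ∈ R, k i * (mono (x (t - τ i)) (y i) * (y' i j : ℝ)
      - mono (x t) (y i) * (y i j : ℝ))) t

/-- A solution of the full delayed mass-action system. -/
def IsSolution (y y' : Fin r → Fin n → ℕ) (k τ : Fin r → ℝ) (τm : ℝ)
    (x : ℝ → Fin n → ℝ) : Prop :=
  IsSolutionOn y y' k τ τm Finset.univ x

/-- Positive initial condition: `x` is strictly positive on `[-τm, 0]`. -/
def PosInit (τm : ℝ) (x : ℝ → Fin n → ℝ) : Prop :=
  ∀ t ∈ Set.Icc (-τm) 0, ∀ j, 0 < x t j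

/-- The solution is bounded on `[-τm, ∞)`. -/
def BoundedSol (τm : ℝ) (x : ℝ → Fin n → ℝ) : Prop :=
  ∃ M : ℝ, ∀ t ∈ Set.Ici (-τm), ‖x t‖ ≤ M

/-- The (sub)system consisting of the reactions in `R` is complex balanced:
there is a positive state `xb` at which, for every complex `η`, the inflow and
outflow rates of `η` coincide. -/
def ComplexBalancedOn (y y' : Fin r → Fin n → ℕ) (k : Fin r → ℝ)
    (R : Finset (Fin r)) : Prop :=
  ∃ xb : Fin n → ℝ, (∀ j, 0 < xb j) ∧ ∀ η : Fin n → ℕ,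
    ∑ i ∈ R.filter (fun i => y i = η), k i * mono xb (y i)
      = ∑ i ∈ R.filter (fun i => y' i = η), k i * mono xb (y i)

/-- `W` is a semilocking set for the reactions in `R`. -/
def Semilocking (y y' : Fin r → Fin n → ℕ) (R : Finset (Fin r)) (W : Set (Fin n)) : Prop :=
  W.Nonempty ∧ ∀ i ∈ R, (∃ j ∈ W, y' i j ≠ 0) → ∃ j ∈ W, y i j ≠ 0

/-- Stoichiometric subspace spanned by the reaction vectors of the reactions in `R`. -/
def stoichOn (y y' : Fin r → Fin n → ℕ) (R : Finset (Fin r)) : Submodule ℝ (Fin n → ℝ) :=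
  Submodule.span ℝ {v | ∃ i ∈ R, v = fun j => (y' i j : ℝ) - (y i j : ℝ)}

/-- `W` is vertex-type w.r.t. the subspace `V`: the only `v ∈ V` vanishing on `W` is `0`. -/
def VertexType (V : Submodule ℝ (Fin n → ℝ)) (W : Set (Fin n)) : Prop :=
  ∀ v ∈ V, (∀ j ∈ W, v j = 0) → v = 0

/-- `W` is facet-type w.r.t. the subspace `V`: the projection of `V` onto the
coordinates outside `W` has dimension `dim V - 1`. -/
def FacetType (V : Submodule ℝ (Fin n → ℝ)) (W : Set (Fin n)) : Prop :=
  Module.finrank ℝ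
      (V.map (LinearMap.funLeft ℝ ℝ (Subtype.val : {j : Fin n // j ∉ W} → Fin n)))
    = Module.finrank ℝ V - 1

/-- The network is a combination of subnetworks with species sets `Sp p` and with
reaction `i` assigned to subnetwork `grp i`. -/
def IsCombination {l : ℕ} (y y' : Fin r → Fin n → ℕ) (Sp : Fin l → Set (Fin n))
    (grp : Fin r → Fin l) : Prop :=
  (∀ j, ∃ p, j ∈ Sp p) ∧ ∀ i j, (y i j ≠ 0 ∨ y' i j ≠ 0) → j ∈ Sp (grp i)

/-- The reaction index set of subnetwork `p`. -/
def Rgrp {l : ℕ} (grp : Fin r → Fin l) (p : Fin l) : Finset (Fin r) :=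
  Finset.univ.filter (fun i => grp i = p)

/-- The set `S_c` of intersecting species. -/
def interSpecies {l : ℕ} (Sp : Fin l → Set (Fin n)) : Set (Fin n) :=
  {j | ∃ p q, p ≠ q ∧ j ∈ Sp p ∧ j ∈ Sp q}

/-- `W^{cn}`: species outside `W` lying in some subnetwork `p'` with `W ∩ S^(p') = ∅`. -/
def Wcn {l : ℕ} (Sp : Fin l → Set (Fin n)) (W : Set (Fin n)) : Set (Fin n) :=
  {j | j ∉ W ∧ ∃ p, W ∩ Sp p = ∅ ∧ j ∈ Sp p}

/-- `W^{tf}`: completely unrestricted species outside `W`: they occur in some reaction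
all of whose species lie outside `W`. -/
def Wtf (y y' : Fin r → Fin n → ℕ) (W : Set (Fin n)) : Set (Fin n) :=
  {j | j ∉ W ∧ ∃ i, (y i j ≠ 0 ∨ y' i j ≠ 0) ∧
    ∀ j', (y i j' ≠ 0 ∨ y' i j' ≠ 0) → j' ∉ W}

/-- `W^{tr}`: totally restricted species outside `W`: every stoichiometric vector
vanishing on `W` also vanishes at `j`. -/
def Wtr (y y' : Fin r → Fin n → ℕ) (W : Set (Fin n)) : Set (Fin n) :=
  {j | j ∉ W ∧ ∀ v ∈ stoichOn y y' Finset.univ, (∀ j' ∈ W, v j' = 0) → v j = 0}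

/-- `θ` (a function on `[-τm,0]`) is an ω-limit point of the solution `x`. -/
def OmegaLimitPt (τm : ℝ) (x θ : ℝ → Fin n → ℝ) : Prop :=
  ContinuousOn θ (Set.Icc (-τm) 0) ∧ (∀ s ∈ Set.Icc (-τm) 0, ∀ j, 0 ≤ θ s j) ∧
  ∃ tN : ℕ → ℝ, Tendsto tN atTop atTop ∧
    ∀ ε > (0 : ℝ), ∃ N₀, ∀ N ≥ N₀, ∀ s ∈ Set.Icc (-τm) 0, ‖x (tN N + s) - θ s‖ < ε

/-- `θ` lies on the boundary `L_W`: it vanishes identically on the coordinates of `W`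
and is nowhere zero on the coordinates outside `W`. -/
def OnBoundary (τm : ℝ) (W : Set (Fin n)) (θ : ℝ → Fin n → ℝ) : Prop :=
  (∀ s ∈ Set.Icc (-τm) 0, ∀ j ∈ W, θ s j = 0) ∧
  ∀ s ∈ Set.Icc (-τm) 0, ∀ j ∉ W, θ s j ≠ 0

/-- Persistence of the delayed mass-action system: every bounded solution with
positive initial condition has `liminf_{t→∞} x_j(t) > 0` for every species `j`. -/
def Persistent (y y' : Fin r → Fin n → ℕ) (k τ : Fin r → ℝ) (τm : ℝ) : Prop :=
  ∀ x : ℝ → Fin n → ℝ, IsSolution y y' k τ τm x → PosInit τm x → BoundedSol τm x →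
    ∀ j, 0 < liminf (fun t => x t j) atTop




lemma gr_low {f f' : ℝ → ℝ} {s t C : ℝ} (hst : s ≤ t)
    (hf : ContinuousOn f (Set.Icc s t))
    (hd : ∀ u ∈ Set.Ioo s t, HasDerivAt f (f' u) u)
    (hb : ∀ u ∈ Set.Ioo s t, -C * f u ≤ f' u) :
    f s ≤ Real.exp (C * (t - s)) * f t := by
  have hmono : MonotoneOn (fun u => Real.exp (C * (u - s)) * f u) (Set.Icc s t) := by
    apply monotoneOn_of_hasDerivWithinAt_nonneg (convex_Icc s t)
      (f' := fun u => Real.exp (C * (u - s)) * (C * 1) * f u + Real.exp (C * (u - s)) * f' u)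
    · apply ContinuousOn.mul _ hf
      fun_prop
    · intro u hu
      rw [interior_Icc] at hu
      apply HasDerivAt.hasDerivWithinAt
      have h1 : HasDerivAt (fun u => Real.exp (C * (u - s))) (Real.exp (C * (u - s)) * (C * 1)) u :=
        HasDerivAt.exp (((hasDerivAt_id u).sub_const s).const_mul C)
      exact h1.mul (hd u hu)
    · intro u hu
      rw [interior_Icc] at hu
      have := hb u hu
      have he := Real.exp_pos (C * (u - s))
      nlinarith
  have := hmono (Set.left_mem_Icc.2 hst) (Set.right_mem_Icc.2 hst) hst
  simpa using this

lemma gr_inflow {f f' : ℝ → ℝ} {s t C ρ : ℝ} (hst : s ≤ t) (hC : 0 ≤ C) (hρ : 0 ≤ ρ)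
    (hf : ContinuousOn f (Set.Icc s t))
    (hd : ∀ u ∈ Set.Ioo s t, HasDerivAt f (f' u) u)
    (hb : ∀ u ∈ Set.Ioo s t, -C * f u + ρ ≤ f' u) :
    f s + ρ * (t - s) ≤ Real.exp (C * (t - s)) * f t := by
  have hmono : MonotoneOn (fun u => Real.exp (C * (u - s)) * f u - ρ * (u - s)) (Set.Icc s t) := by
    apply monotoneOn_of_hasDerivWithinAt_nonneg (convex_Icc s t)
      (f' := fun u => (Real.exp (C * (u - s)) * (C * 1) * f u + Real.exp (C * (u - s)) * f' u)
        - ρ * 1)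
    · apply ContinuousOn.sub
      · apply ContinuousOn.mul _ hf
        fun_prop
      · fun_prop
    · intro u hu
      rw [interior_Icc] at hu
      apply HasDerivAt.hasDerivWithinAt
      have h1 : HasDerivAt (fun u => Real.exp (C * (u - s))) (Real.exp (C * (u - s)) * (C * 1)) u :=
        HasDerivAt.exp (((hasDerivAt_id u).sub_const s).const_mul C)
      exact (h1.mul (hd u hu)).sub (((hasDerivAt_id u).sub_const s).const_mul ρ)
    · intro u hu
      rw [interior_Icc] at hu
      have := hb u hu
      have he : 1 ≤ Real.exp (C * (u - s)) :=
        Real.one_le_exp (mul_nonneg hC (by linarith [hu.1]))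
      nlinarith
  have := hmono (Set.left_mem_Icc.2 hst) (Set.right_mem_Icc.2 hst) hst
  simp at this
  linarith

lemma gr_up {f f' : ℝ → ℝ} {s t C : ℝ} (hst : s ≤ t)
    (hf : ContinuousOn f (Set.Icc s t))
    (hd : ∀ u ∈ Set.Ioo s t, HasDerivAt f (f' u) u)
    (hb : ∀ u ∈ Set.Ioo s t, f' u ≤ C * f u) :
    f t ≤ Real.exp (C * (t - s)) * f s := by
  have h := gr_low (f := fun u => - f u) (f' := fun u => - f' u) (C := -C) hst hf.neg
    (fun u hu => (hd u hu).neg) (fun u hu => by have := hb u hu; linarith)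
  have he : Real.exp (C * (t - s)) * Real.exp (-C * (t - s)) = 1 := by
    rw [← Real.exp_add]; simp
  have hp := Real.exp_pos (C * (t - s))
  have := mul_le_mul_of_nonneg_left h hp.le
  have h2 : Real.exp (C * (t - s)) * (Real.exp (-C * (t - s)) * -f t) = - f t := by
    rw [← mul_assoc, he, one_mul]
  rw [h2] at this
  linarith

lemma mono_pos' {n : ℕ} {x : Fin n → ℝ} (hx : ∀ j, 0 < x j) (y : Fin n → ℕ) : 0 < mono x y :=
  Finset.prod_pos fun j _ => pow_pos (hx j) _

lemma mono_nonneg' {n : ℕ} {x : Fin n → ℝ} (hx : ∀ j, 0 ≤ x j) (y : Fin n → ℕ) : 0 ≤ mono x y :=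
  Finset.prod_nonneg fun j _ => pow_nonneg (hx j) _

lemma mono_le_mul {n : ℕ} {x : Fin n → ℝ} {M : ℝ} (hM : 1 ≤ M) (hx : ∀ j, 0 ≤ x j)
    (hxM : ∀ j, x j ≤ M) (y : Fin n → ℕ) (j : Fin n) (hj : y j ≠ 0) :
    mono x y ≤ M ^ (∑ l, y l) * x j := by
  classical
  unfold mono
  rw [← Finset.mul_prod_erase _ _ (Finset.mem_univ j), ← Finset.prod_pow_eq_pow_sum,
    ← Finset.mul_prod_erase Finset.univ (fun l => M ^ y l) (Finset.mem_univ j)]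
  have h1 : x j ^ y j ≤ M ^ y j * x j := by
    obtain ⟨m, hm⟩ := Nat.exists_eq_succ_of_ne_zero hj
    rw [hm, pow_succ]
    apply mul_le_mul_of_nonneg_right _ (hx j)
    calc x j ^ m ≤ M ^ m := pow_le_pow_left₀ (hx j) (hxM j) m
      _ ≤ M ^ (m+1) := pow_le_pow_right₀ hM (by omega)
  have h2 : ∏ l ∈ Finset.univ.erase j, x l ^ y l ≤ ∏ l ∈ Finset.univ.erase j, M ^ y l :=
    Finset.prod_le_prod (fun l _ => pow_nonneg (hx l) _)
      (fun l _ => pow_le_pow_left₀ (hx l) (hxM l) _)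
  have h3 : 0 ≤ ∏ l ∈ Finset.univ.erase j, x l ^ y l :=
    Finset.prod_nonneg fun l _ => pow_nonneg (hx l) _
  calc _ ≤ (M ^ y j * x j) * ∏ l ∈ Finset.univ.erase j, M ^ y l :=
        mul_le_mul h1 h2 h3 (mul_nonneg (by positivity) (hx j))
    _ = _ := by ring

lemma mono_le_pow {n : ℕ} {x : Fin n → ℝ} {M : ℝ} (hx : ∀ j, 0 ≤ x j)
    (hxM : ∀ j, x j ≤ M) (y : Fin n → ℕ) :
    mono x y ≤ M ^ (∑ l, y l) := by
  unfold mono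
  rw [← Finset.prod_pow_eq_pow_sum]
  exact Finset.prod_le_prod (fun l _ => pow_nonneg (hx l) _)
      (fun l _ => pow_le_pow_left₀ (hx l) (hxM l) _)

lemma mono_div {n : ℕ} (x z : Fin n → ℝ) (y : Fin n → ℕ) :
    mono (fun j => x j / z j) y = mono x y / mono z y := by
  unfold mono
  rw [← Finset.prod_div_distrib]
  exact Finset.prod_congr rfl fun j _ => div_pow _ _ _

lemma log_mono {n : ℕ} {x : Fin n → ℝ} (hx : ∀ j, 0 < x j) (y : Fin n → ℕ) :
    Real.log (mono x y) = ∑ j, (y j : ℝ) * Real.log (x j) := by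
  unfold mono
  rw [Real.log_prod (fun j _ => (pow_pos (hx j) _).ne')]
  exact Finset.sum_congr rfl fun j _ => Real.log_pow _ _

lemma continuous_mono {n : ℕ} {x : ℝ → Fin n → ℝ} (hx : ∀ j, Continuous fun t => x t j)
    (y : Fin n → ℕ) : Continuous fun t => mono (x t) y := by
  unfold mono
  exact continuous_finsetProd _ fun j _ => (hx j).pow _

/-- Bundle of working hypotheses. -/
structure Ctx {n r : ℕ} (y y' : Fin r → Fin n → ℕ) (k τ : Fin r → ℝ) (τm M : ℝ)
    (x : ℝ → Fin n → ℝ) : Prop where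
  hk : ∀ i, 0 < k i
  hτ : ∀ i, 0 ≤ τ i
  hτm : ∀ i, τ i ≤ τm
  hτm0 : 0 ≤ τm
  hM : 1 ≤ M
  cont : ∀ j, Continuous fun t => x t j
  pos : ∀ t j, 0 < x t j
  le : ∀ t j, x t j ≤ M
  der : ∀ t > 0, ∀ j, HasDerivAt (fun u => x u j)
    (∑ i, (k i * mono (x (t - τ i)) (y i) * (y' i j : ℝ) - k i * mono (x t) (y i) * (y i j : ℝ))) t

/-- The rate of reaction `i` at time `t`. -/
noncomputable def Rt {n r : ℕ} (y : Fin r → Fin n → ℕ) (k : Fin r → ℝ)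
    (x : ℝ → Fin n → ℝ) (i : Fin r) (t : ℝ) : ℝ := k i * mono (x t) (y i)

/-- Cumulative progress. -/
noncomputable def nn {n r : ℕ} (y : Fin r → Fin n → ℕ) (k τ : Fin r → ℝ)
    (x : ℝ → Fin n → ℝ) (i : Fin r) (t : ℝ) : ℝ := ∫ s in (0:ℝ)..t, Rt y k x i (s - τ i)

/-- Delay-corrected state. -/
noncomputable def YY {n r : ℕ} (y : Fin r → Fin n → ℕ) (k τ : Fin r → ℝ)
    (x : ℝ → Fin n → ℝ) (j : Fin n) (t : ℝ) : ℝ :=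
  x t j + ∑ i, (y i j : ℝ) * ∫ s in (t - τ i)..t, Rt y k x i s

lemma pos_of_solution {n r : ℕ} (y y' : Fin r → Fin n → ℕ)
    (k τ : Fin r → ℝ) (τm : ℝ)
    (hk : ∀ i, 0 < k i) (hτ : ∀ i, 0 ≤ τ i) (hτm : ∀ i, τ i ≤ τm) (hτm0 : 0 ≤ τm)
    (x : ℝ → Fin n → ℝ) (hx : IsSolution y y' k τ τm x)
    (hxpos : PosInit τm x) (hxbdd : BoundedSol τm x) :
    ∃ M, Ctx y y' k τ τm M (fun t => x (max t (-τm))) := by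
  obtain ⟨hnn, hc, hd⟩ := hx
  obtain ⟨M0, hM0⟩ := hxbdd
  set M := max 1 M0 with hMdef
  have hM1 : 1 ≤ M := le_max_left _ _
  have hle : ∀ t ∈ Set.Ici (-τm), ∀ j, x t j ≤ M := by
    intro t ht j
    have h1 : ‖x t j‖ ≤ ‖x t‖ := norm_le_pi_norm (x t) j
    have h2 := hM0 t ht
    have h3 : x t j ≤ ‖x t j‖ := le_abs_self _
    exact le_trans (by linarith) (le_max_right 1 M0)
  have hcj : ∀ j, ContinuousOn (fun t => x t j) (Set.Ici (-τm)) := fun j =>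
    (continuous_apply j).comp_continuousOn hc
  have hdj : ∀ t > 0, ∀ j, HasDerivAt (fun u => x u j) (∑ i, k i * (mono (x (t - τ i)) (y i) * (y' i j : ℝ)
      - mono (x t) (y i) * (y i j : ℝ))) t := fun t ht j => (hasDerivAt_pi.1 (hd t ht)) j
  have hpos : ∀ t ∈ Set.Ici (-τm), ∀ j, 0 < x t j := by
    intro t ht j
    rcases le_or_gt t 0 with h0 | h0
    · exact hxpos t ⟨ht, h0⟩ j
    · have hx0 : 0 < x 0 j := hxpos 0 ⟨by linarith, le_rfl⟩ j
      have h := gr_low (f := fun u => x u j) (s := 0) (t := t)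
        (C := ∑ i, k i * (y i j : ℝ) * M ^ (∑ l, y i l)) h0.le
        ((hcj j).mono (fun u hu => by simp only [Set.mem_Ici]; linarith [hu.1]))
        (fun u hu => hdj u hu.1 j) ?_
      · have hx0' : 0 < Real.exp ((∑ i, k i * (y i j : ℝ) * M ^ (∑ l, y i l)) * (t - 0)) * x t j :=
          lt_of_lt_of_le hx0 h
        exact pos_of_mul_pos_right hx0' (Real.exp_pos _).le
      · intro u hu
        rw [← Finset.sum_neg_distrib, Finset.sum_mul]
        apply Finset.sum_le_sum
        intro i _
        have hu' : u ∈ Set.Ici (-τm) := by simp only [Set.mem_Ici]; linarith [hu.1]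
        have hu2 : u - τ i ∈ Set.Ici (-τm) := by
          simp only [Set.mem_Ici]; linarith [hu.1, hτm i]
        have h1 : 0 ≤ mono (x (u - τ i)) (y i) * (y' i j : ℝ) :=
          mul_nonneg (mono_nonneg' (hnn _ hu2) _) (Nat.cast_nonneg _)
        have h2 : mono (x u) (y i) * (y i j : ℝ) ≤ (y i j : ℝ) * M ^ (∑ l, y i l) * x u j := by
          by_cases hy : y i j = 0
          · simp [hy]
          · have := mono_le_mul hM1 (hnn _ hu') (hle _ hu') (y i) j hy
            have h3 : (0:ℝ) ≤ y i j := Nat.cast_nonneg _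
            nlinarith
        have := hk i
        nlinarith
  refine ⟨M, hk, hτ, hτm, hτm0, hM1, ?_, ?_, ?_, ?_⟩
  · intro j
    exact (hcj j).comp_continuous (by fun_prop) (fun t => Set.mem_Ici.2 (le_max_right _ _))
  · exact fun t j => hpos _ (Set.mem_Ici.2 (le_max_right _ _)) j
  · exact fun t j => hle _ (Set.mem_Ici.2 (le_max_right _ _)) j
  · intro t ht j
    have h := hdj t ht j
    have e1 : ∀ i, max (t - τ i) (-τm) = t - τ i := fun i => max_eq_left (by linarith [hτm i])
    have e2 : max t (-τm) = t := max_eq_left (by linarith)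
    simp only [e1, e2]
    have : (fun u => x (max u (-τm)) j) =ᶠ[nhds t] fun u => x u j := by
      filter_upwards [lt_mem_nhds ht] with u hu
      rw [max_eq_left (by linarith)]
    refine (h.congr_of_eventuallyEq this).congr_deriv ?_
    exact Finset.sum_congr rfl fun i _ => by ring


lemma hasDerivAt_int {f : ℝ → ℝ} (hf : Continuous f) (a t : ℝ) :
    HasDerivAt (fun t => ∫ s in a..t, f s) (f t) t :=
  intervalIntegral.integral_hasDerivAt_right (hf.intervalIntegrable _ _)
    hf.stronglyMeasurable.stronglyMeasurableAtFilter hf.continuousAt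

lemma hasDerivAt_window {f : ℝ → ℝ} (hf : Continuous f) (τ t : ℝ) :
    HasDerivAt (fun t => ∫ s in (t - τ)..t, f s) (f t - f (t - τ)) t := by
  have h1 := hasDerivAt_int hf 0 t
  have h2 : HasDerivAt (fun t => ∫ s in (0:ℝ)..(t - τ), f s) (f (t - τ) * 1) t :=
    HasDerivAt.comp (h₂ := fun t => ∫ s in (0:ℝ)..t, f s) t (hasDerivAt_int hf 0 (t - τ))
      ((hasDerivAt_id t).sub_const τ)
  have h3 := h1.sub h2
  rw [mul_one] at h3
  refine h3.congr_of_eventuallyEq (Eventually.of_forall fun u => ?_)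
  exact (intervalIntegral.integral_interval_sub_left (hf.intervalIntegrable _ _)
    (hf.intervalIntegrable _ _)).symm

section
variable {n r : ℕ} {y y' : Fin r → Fin n → ℕ} {k τ : Fin r → ℝ} {τm M : ℝ} {x : ℝ → Fin n → ℝ}

lemma Ctx.Rcont (h : Ctx y y' k τ τm M x) (i : Fin r) : Continuous (Rt y k x i) := by
  unfold Rt
  exact continuous_const.mul (continuous_mono h.cont (y i))

lemma Ctx.Rpos (h : Ctx y y' k τ τm M x) (i : Fin r) (t : ℝ) : 0 < Rt y k x i t :=
  mul_pos (h.hk i) (mono_pos' (h.pos t) _)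

lemma Ctx.Rbd (h : Ctx y y' k τ τm M x) : ∃ C, 1 ≤ C ∧
    ∀ i t, Rt y k x i t ≤ C ∧ ∀ j, y i j ≠ 0 → Rt y k x i t ≤ C * x t j := by
  have hM0 : 0 ≤ M := le_trans zero_le_one h.hM
  have h0 : ∀ i, 0 ≤ k i * M ^ (∑ l, y i l) := fun i => mul_nonneg (h.hk i).le (by positivity)
  refine ⟨1 + ∑ i, k i * M ^ (∑ l, y i l), ?_, ?_⟩
  · linarith [Finset.sum_nonneg (fun i (_ : i ∈ Finset.univ) => h0 i)]
  · intro i t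
    have h1 : k i * M ^ (∑ l, y i l) ≤ ∑ i, k i * M ^ (∑ l, y i l) :=
      Finset.single_le_sum (f := fun i => k i * M ^ (∑ l, y i l)) (fun i _ => h0 i)
        (Finset.mem_univ i)
    constructor
    · have := mul_le_mul_of_nonneg_left (mono_le_pow (fun j => (h.pos t j).le) (h.le t) (y i))
        (h.hk i).le
      unfold Rt
      linarith
    · intro j hj
      have := mul_le_mul_of_nonneg_left
        (mono_le_mul h.hM (fun j => (h.pos t j).le) (h.le t) (y i) j hj) (h.hk i).le
      unfold Rt
      have hp := h.pos t j
      nlinarith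

lemma Ctx.der' (h : Ctx y y' k τ τm M x) {t : ℝ} (ht : 0 < t) (j : Fin n) :
    HasDerivAt (fun u => x u j)
      (∑ i, (Rt y k x i (t - τ i) * (y' i j : ℝ) - Rt y k x i t * (y i j : ℝ))) t := h.der t ht j

lemma Ctx.growth (h : Ctx y y' k τ τm M x) : ∃ C, 1 ≤ C ∧ ∀ j s t, 0 ≤ s → s ≤ t →
    x s j ≤ Real.exp (C * (t - s)) * x t j := by
  obtain ⟨C, hC, hR⟩ := h.Rbd
  refine ⟨1 + ∑ i, ∑ j, C * (y i j : ℝ), ?_, ?_⟩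
  · have : 0 ≤ ∑ i, ∑ j, C * (y i j : ℝ) := by positivity
    linarith
  · intro j s t hs hst
    apply gr_low (f := fun u => x u j) hst (h.cont j).continuousOn
      (fun u hu => h.der' (lt_of_le_of_lt hs hu.1) j)
    intro u hu
    have h1 : ∑ i, (Rt y k x i (u - τ i) * (y' i j : ℝ) - Rt y k x i u * (y i j : ℝ))
        ≥ ∑ i, (-(C * (y i j : ℝ)) * x u j) := by
      apply Finset.sum_le_sum
      intro i _
      have h2 : 0 ≤ Rt y k x i (u - τ i) * (y' i j : ℝ) :=
        mul_nonneg (h.Rpos i _).le (Nat.cast_nonneg _)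
      have h3 : Rt y k x i u * (y i j : ℝ) ≤ C * (y i j : ℝ) * x u j := by
        by_cases hy : y i j = 0
        · simp [hy]
        · have := (hR i u).2 j hy
          have h3 : (0:ℝ) ≤ y i j := Nat.cast_nonneg _
          nlinarith
      linarith
    have h4 : ∑ i, C * (y i j : ℝ) ≤ ∑ i, ∑ j, C * (y i j : ℝ) :=
      Finset.sum_le_sum fun i _ => Finset.single_le_sum (f := fun j => C * (y i j : ℝ))
        (fun j _ => by positivity) (Finset.mem_univ j)
    rw [← Finset.sum_mul, Finset.sum_neg_distrib] at h1
    have hp := h.pos u j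
    nlinarith

lemma Ctx.YYder (h : Ctx y y' k τ τm M x) {t : ℝ} (ht : 0 < t) (j : Fin n) :
    HasDerivAt (YY y k τ x j)
      (∑ i, Rt y k x i (t - τ i) * ((y' i j : ℝ) - y i j)) t := by
  have h1 := (h.der' ht j).add (HasDerivAt.fun_sum (u := Finset.univ) fun i _ =>
    (hasDerivAt_window (h.Rcont i) (τ i) t).const_mul (y i j : ℝ))
  refine (h1.congr_deriv ?_)
  rw [← Finset.sum_add_distrib]
  exact Finset.sum_congr rfl fun i _ => by ring

lemma Ctx.YYcont (h : Ctx y y' k τ τm M x) (j : Fin n) : Continuous (YY y k τ x j) := by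
  unfold YY
  refine (h.cont j).add (continuous_finsetSum _ fun i _ => continuous_const.mul ?_)
  exact continuous_iff_continuousAt.2 fun t =>
    (hasDerivAt_window (h.Rcont i) (τ i) t).continuousAt

lemma Ctx.nnder (h : Ctx y y' k τ τm M x) (i : Fin r) (t : ℝ) :
    HasDerivAt (nn y k τ x i) (Rt y k x i (t - τ i)) t :=
  hasDerivAt_int (f := fun s => Rt y k x i (s - τ i))
    ((h.Rcont i).comp (continuous_id.sub continuous_const)) 0 t

lemma Ctx.YYdiff (h : Ctx y y' k τ τm M x) (j : Fin n) {s t : ℝ} (hs : 0 < s) (hst : s ≤ t) :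
    YY y k τ x j t - YY y k τ x j s =
      ∑ i, ((y' i j : ℝ) - y i j) * (nn y k τ x i t - nn y k τ x i s) := by
  have hd : ∀ u, 0 < u → HasDerivAt (fun u => YY y k τ x j u -
      ∑ i, ((y' i j : ℝ) - y i j) * nn y k τ x i u) 0 u := by
    intro u hu
    have h1 := (h.YYder hu j).sub (HasDerivAt.fun_sum (u := Finset.univ) fun i _ =>
      (h.nnder i u).const_mul ((y' i j : ℝ) - y i j))
    refine h1.congr_deriv ?_
    rw [sub_eq_zero]
    exact Finset.sum_congr rfl fun i _ => by ring
  have h2 := constant_of_has_deriv_right_zero (a := s) (b := t)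
    (fun u hu => (hd u (lt_of_lt_of_le hs hu.1)).continuousAt.continuousWithinAt)
    (fun u hu => (hd u (lt_of_lt_of_le hs hu.1)).hasDerivWithinAt) t (Set.right_mem_Icc.2 hst)
  have h3 : ∑ i, ((y' i j : ℝ) - y i j) * (nn y k τ x i t - nn y k τ x i s)
      = ∑ i, ((y' i j : ℝ) - y i j) * nn y k τ x i t
        - ∑ i, ((y' i j : ℝ) - y i j) * nn y k τ x i s := by
    rw [← Finset.sum_sub_distrib]
    exact Finset.sum_congr rfl fun i _ => by ring
  rw [h3]
  linarith

lemma Ctx.YYge (h : Ctx y y' k τ τm M x) (j : Fin n) (t : ℝ) : x t j ≤ YY y k τ x j t := by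
  unfold YY
  have : 0 ≤ ∑ i, (y i j : ℝ) * ∫ s in (t - τ i)..t, Rt y k x i s := by
    refine Finset.sum_nonneg fun i _ => mul_nonneg (Nat.cast_nonneg _) ?_
    exact intervalIntegral.integral_nonneg (by linarith [h.hτ i]) fun u _ => (h.Rpos i u).le
  linarith

lemma Ctx.YYpos (h : Ctx y y' k τ τm M x) (j : Fin n) (t : ℝ) : 0 < YY y k τ x j t :=
  lt_of_lt_of_le (h.pos t j) (h.YYge j t)

/-- Basic constants. -/
lemma Ctx.basic (h : Ctx y y' k τ τm M x) (h0 : ℝ) (hh0 : 0 ≤ h0) : ∃ C, 1 ≤ C ∧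
    (∀ i t, Rt y k x i t ≤ C) ∧
    (∀ i t j, y i j ≠ 0 → Rt y k x i t ≤ C * x t j) ∧
    (∀ j s t, 0 ≤ s → s ≤ t → t ≤ s + h0 → x s j ≤ C * x t j) ∧
    (∀ j t, τm ≤ t → YY y k τ x j t ≤ C * x t j) ∧
    (∀ j t, 0 < t → -C * YY y k τ x j t ≤ ∑ i, -(Rt y k x i (t - τ i) * (y i j : ℝ)) ∨ t < τm) := by
  obtain ⟨C1, hC1, hR⟩ := h.Rbd
  obtain ⟨C2, hC2, hG⟩ := h.growth
  set C3 := Real.exp (C2 * h0) with hC3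
  set C4 := Real.exp (C2 * τm) with hC4
  have hC31 : 1 ≤ C3 := Real.one_le_exp (by positivity)
  have hC41 : 1 ≤ C4 := Real.one_le_exp (mul_nonneg (by linarith) h.hτm0)
  have hgr : ∀ j s t, 0 ≤ s → s ≤ t → t ≤ s + h0 → x s j ≤ C3 * x t j := by
    intro j s t hs hst hth
    refine (hG j s t hs hst).trans (mul_le_mul_of_nonneg_right ?_ (h.pos t j).le)
    exact Real.exp_le_exp.2 (mul_le_mul_of_nonneg_left (by linarith) (by linarith))
  have hgr4 : ∀ j s t, 0 ≤ s → s ≤ t → t ≤ s + τm → x s j ≤ C4 * x t j := by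
    intro j s t hs hst hth
    refine (hG j s t hs hst).trans (mul_le_mul_of_nonneg_right ?_ (h.pos t j).le)
    exact Real.exp_le_exp.2 (mul_le_mul_of_nonneg_left (by linarith) (by linarith))
  set N := ∑ i, ∑ j, (y i j : ℝ) with hN
  have hN0 : 0 ≤ N := by positivity
  have hNj : ∀ j, ∑ i, (y i j : ℝ) ≤ N := fun j =>
    Finset.sum_le_sum fun i _ => Finset.single_le_sum (f := fun j => (y i j : ℝ))
      (fun j _ => by positivity) (Finset.mem_univ j)
  have hτ0 := h.hτm0
  -- delayed rates
  have hdel : ∀ i j t s, τm ≤ t → t - τm ≤ s → s ≤ t →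
      (y i j : ℝ) * Rt y k x i s ≤ (y i j : ℝ) * (C1 * C4 * x t j) := by
    intro i j t s ht hs1 hs2
    by_cases hy : y i j = 0
    · simp [hy]
    · apply mul_le_mul_of_nonneg_left _ (Nat.cast_nonneg _)
      have h1 := (hR i s).2 j hy
      have h2 := hgr4 j s t (by linarith) hs2 (by linarith)
      have := mul_le_mul_of_nonneg_left h2 (show 0 ≤ C1 by linarith)
      linarith
  have hYup : ∀ j t, τm ≤ t → YY y k τ x j t ≤ (1 + N * (τm * (C1 * C4))) * x t j := by
    intro j t ht
    unfold YY
    have hp := h.pos t j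
    have h1 : ∑ i, (y i j : ℝ) * ∫ s in (t - τ i)..t, Rt y k x i s
        ≤ ∑ i, (y i j : ℝ) * (τm * (C1 * C4) * x t j) := by
      apply Finset.sum_le_sum
      intro i _
      have hint : (y i j : ℝ) * ∫ s in (t - τ i)..t, Rt y k x i s
          ≤ ∫ s in (t - τ i)..t, (y i j : ℝ) * (C1 * C4 * x t j) := by
        rw [← intervalIntegral.integral_const_mul]
        apply intervalIntegral.integral_mono_on (by linarith [h.hτ i])
          ((continuous_const.mul (h.Rcont i)).intervalIntegrable _ _)
          (continuous_const.intervalIntegrable _ _)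
        intro s hs
        exact hdel i j t s ht (by linarith [hs.1, h.hτm i]) hs.2
      rw [intervalIntegral.integral_const, smul_eq_mul] at hint
      have h2 : (t - (t - τ i)) * ((y i j : ℝ) * (C1 * C4 * x t j))
          ≤ τm * ((y i j : ℝ) * (C1 * C4 * x t j)) := by
        apply mul_le_mul_of_nonneg_right (by linarith [h.hτm i])
        have : 0 ≤ C1 * C4 := by nlinarith
        positivity
      nlinarith
    rw [← Finset.sum_mul] at h1
    have h2 : (∑ i, (y i j : ℝ)) * (τm * (C1 * C4) * x t j) ≤ N * (τm * (C1 * C4) * x t j) := by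
      apply mul_le_mul_of_nonneg_right (hNj j)
      have : 0 ≤ C1 * C4 := by nlinarith
      positivity
    nlinarith
  have hC14 : 0 ≤ C1 * C4 := by nlinarith
  have ha : 0 ≤ N * (τm * (C1 * C4)) := by positivity
  have hb : 0 ≤ N * (C1 * C4) := by positivity
  refine ⟨C1 + C3 + (1 + N * (τm * (C1 * C4))) + N * (C1 * C4), by linarith, ?_, ?_, ?_, ?_, ?_⟩
  · intro i t; linarith [(hR i t).1]
  · intro i t j hj
    have := (hR i t).2 j hj
    have hp := h.pos t j
    nlinarith
  · intro j s t hs hst hth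
    have := hgr j s t hs hst hth
    have hp := h.pos t j
    nlinarith
  · intro j t ht
    have := hYup j t ht
    have hp := h.pos t j
    nlinarith
  · intro j t ht
    rcases lt_or_ge t τm with h1 | h1
    · exact Or.inr h1
    · left
      have h2 : ∑ i, (y i j : ℝ) * Rt y k x i (t - τ i) ≤ ∑ i, (y i j : ℝ) * (C1 * C4 * x t j) :=
        Finset.sum_le_sum fun i _ => hdel i j t (t - τ i) h1 (by linarith [h.hτm i])
          (by linarith [h.hτ i])
      rw [← Finset.sum_mul] at h2
      have hp := h.pos t j
      have h3 : (∑ i, (y i j : ℝ)) * (C1 * C4 * x t j) ≤ N * (C1 * C4 * x t j) :=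
        mul_le_mul_of_nonneg_right (hNj j) (by positivity)
      have h4 := h.YYge j t
      rw [Finset.sum_neg_distrib]
      have h5 : ∑ i, Rt y k x i (t - τ i) * (y i j : ℝ) = ∑ i, (y i j : ℝ) * Rt y k x i (t - τ i) :=
        Finset.sum_congr rfl fun i _ => mul_comm _ _
      rw [h5]
      have h6 : N * (C1 * C4) * x t j ≤ N * (C1 * C4) * YY y k τ x j t :=
        mul_le_mul_of_nonneg_left h4 hb
      nlinarith [h.YYpos j t]

end

lemma cb_sum {n r : ℕ} {y y' : Fin r → Fin n → ℕ} {k : Fin r → ℝ} {R : Finset (Fin r)}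
    {xb : Fin n → ℝ}
    (hcb : ∀ η : Fin n → ℕ, ∑ i ∈ R.filter (fun i => y i = η), k i * mono xb (y i)
      = ∑ i ∈ R.filter (fun i => y' i = η), k i * mono xb (y i))
    (F : (Fin n → ℕ) → ℝ) :
    ∑ i ∈ R, k i * mono xb (y i) * F (y' i) = ∑ i ∈ R, k i * mono xb (y i) * F (y i) := by
  classical
  have h1 : ∀ z : Fin r → Fin n → ℕ, (∀ i ∈ R, z i ∈ R.image y ∪ R.image y') →
      ∑ i ∈ R, k i * mono xb (y i) * F (z i) = ∑ η ∈ R.image y ∪ R.image y',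
        (∑ i ∈ R.filter (fun i => z i = η), k i * mono xb (y i)) * F η := by
    intro z hz
    rw [← Finset.sum_fiberwise_of_maps_to hz]
    refine Finset.sum_congr rfl fun η _ => ?_
    rw [Finset.sum_mul]
    refine Finset.sum_congr rfl fun i hi => ?_
    rw [(Finset.mem_filter.1 hi).2]
  rw [h1 y' (fun i hi => Finset.mem_union_right _ (Finset.mem_image_of_mem _ hi)),
    h1 y (fun i hi => Finset.mem_union_left _ (Finset.mem_image_of_mem _ hi))]
  refine Finset.sum_congr rfl fun η _ => ?_
  rw [← hcb η]


/-- The entropy function. -/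
noncomputable def FF (z : ℝ) : ℝ := z * Real.log z - z + 1

lemma FF_cont : Continuous FF := by
  unfold FF
  exact (Real.continuous_mul_log.sub continuous_id).add continuous_const

lemma FF_conv {z w : ℝ} (hz : 0 < z) (hw : 0 ≤ w) :
    Real.log z * (w - z) + (Real.sqrt w - Real.sqrt z) ^ 2 ≤ FF w - FF z := by
  unfold FF
  rcases hw.eq_or_lt with h0 | hw
  · subst h0
    simp
    rw [Real.sq_sqrt hz.le]
    linarith
  · have h1 : Real.log (Real.sqrt (z / w)) ≤ Real.sqrt (z / w) - 1 :=
      Real.log_le_sub_one_of_pos (Real.sqrt_pos.2 (div_pos hz hw))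
    rw [Real.log_sqrt (div_pos hz hw).le, Real.log_div hz.ne' hw.ne', Real.sqrt_div hz.le] at h1
    have h2 : w * (Real.sqrt z / Real.sqrt w) = Real.sqrt w * Real.sqrt z := by
      have hs := Real.sqrt_pos.2 hw
      have : w = Real.sqrt w * Real.sqrt w := (Real.mul_self_sqrt hw.le).symm
      field_simp
      nlinarith
    have h3 := mul_le_mul_of_nonneg_left h1 hw.le
    have h4 := Real.sq_sqrt hw.le
    have h5 := Real.sq_sqrt hz.le
    nlinarith

lemma FF_nonneg {z : ℝ} (hz : 0 ≤ z) : 0 ≤ FF z := by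
  have h := FF_conv one_pos hz
  have h1 : FF 1 = 0 := by simp [FF]
  rw [h1] at h
  simp at h
  nlinarith [sq_nonneg (Real.sqrt z - 1)]

lemma FF_der {z : ℝ} (hz : 0 < z) : HasDerivAt FF (Real.log z) z := by
  unfold FF
  have h1 := ((Real.hasDerivAt_mul_log hz.ne').sub (hasDerivAt_id z)).add_const 1
  refine h1.congr_deriv (by ring)

section
variable {n r : ℕ} (y y' : Fin r → Fin n → ℕ) (k τ : Fin r → ℝ) (xb : Fin n → ℝ)
  (x : ℝ → Fin n → ℝ)

/-- Normalised reactant monomial. -/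
noncomputable def XX (z : Fin r → Fin n → ℕ) (xb : Fin n → ℝ)
  (x : ℝ → Fin n → ℝ) (i : Fin r) (t : ℝ) : ℝ := mono (fun j => x t j / xb j) (z i)

/-- Equilibrium flux. -/
noncomputable def KK (i : Fin r) : ℝ := k i * mono xb (y i)

/-- Dissipation. -/
noncomputable def DD (t : ℝ) : ℝ :=
  ∑ i, KK y k xb i * (Real.sqrt (XX y xb x i (t - τ i)) - Real.sqrt (XX y' xb x i t)) ^ 2

/-- Accumulated dissipation. -/
noncomputable def EE (t : ℝ) : ℝ := ∫ s in (0:ℝ)..t, DD y y' k τ xb x s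

/-- Lyapunov functional. -/
noncomputable def VV (t : ℝ) : ℝ :=
  ∑ j, xb j * FF (x t j / xb j) + ∑ i, KK y k xb i * ∫ s in (t - τ i)..t, FF (XX y xb x i s)
end

section
variable {n r : ℕ} {y y' : Fin r → Fin n → ℕ} {k τ : Fin r → ℝ} {τm M : ℝ} {x : ℝ → Fin n → ℝ}
  {xb : Fin n → ℝ}

lemma Ctx.KKpos (h : Ctx y y' k τ τm M x) (hxb : ∀ j, 0 < xb j) (i : Fin r) : 0 < KK y k xb i :=
  mul_pos (h.hk i) (mono_pos' hxb _)

lemma Ctx.XXpos (h : Ctx y y' k τ τm M x) (hxb : ∀ j, 0 < xb j) (z : Fin r → Fin n → ℕ)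
    (i : Fin r) (t : ℝ) : 0 < XX z xb x i t :=
  mono_pos' (fun j => div_pos (h.pos t j) (hxb j)) _

lemma Ctx.XXcont (h : Ctx y y' k τ τm M x) (z : Fin r → Fin n → ℕ)
    (i : Fin r) : Continuous (XX z xb x i) :=
  continuous_mono (x := fun t j => x t j / xb j) (fun j => (h.cont j).div_const _) _

lemma KK_XX (hxb : ∀ j, 0 < xb j) (i : Fin r) (t : ℝ) :
    KK y k xb i * XX y xb x i t = Rt y k x i t := by
  unfold KK XX Rt
  rw [mono_div]
  have := (mono_pos' hxb (y i)).ne'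
  field_simp

lemma Ctx.DDcont (h : Ctx y y' k τ τm M x) : Continuous (DD y y' k τ xb x) := by
  unfold DD
  refine continuous_finsetSum _ fun i _ => continuous_const.mul (Continuous.pow (Continuous.sub ?_ ?_) 2)
  · exact Real.continuous_sqrt.comp ((h.XXcont y i).comp (continuous_id.sub continuous_const))
  · exact Real.continuous_sqrt.comp (h.XXcont y' i)

lemma Ctx.DDnonneg (h : Ctx y y' k τ τm M x) (hxb : ∀ j, 0 < xb j) (t : ℝ) :
    0 ≤ DD y y' k τ xb x t :=
  Finset.sum_nonneg fun i _ => mul_nonneg (h.KKpos hxb i).le (sq_nonneg _)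

lemma Ctx.EEder (h : Ctx y y' k τ τm M x) (t : ℝ) :
    HasDerivAt (EE y y' k τ xb x) (DD y y' k τ xb x t) t := hasDerivAt_int h.DDcont 0 t

lemma Ctx.EEmono (h : Ctx y y' k τ τm M x) (hxb : ∀ j, 0 < xb j) :
    Monotone (EE y y' k τ xb x) :=
  monotone_of_hasDerivAt_nonneg (fun t => h.EEder t) (fun t => h.DDnonneg hxb t)

lemma Ctx.VVnonneg (h : Ctx y y' k τ τm M x) (hxb : ∀ j, 0 < xb j) (t : ℝ) :
    0 ≤ VV y k τ xb x t := by
  unfold VV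
  refine add_nonneg (Finset.sum_nonneg fun j _ => mul_nonneg (hxb j).le
    (FF_nonneg (div_pos (h.pos t j) (hxb j)).le)) (Finset.sum_nonneg fun i _ =>
    mul_nonneg (h.KKpos hxb i).le ?_)
  exact intervalIntegral.integral_nonneg (by linarith [h.hτ i])
    fun u _ => FF_nonneg (h.XXpos hxb y i u).le

lemma Ctx.logXX (h : Ctx y y' k τ τm M x) (hxb : ∀ j, 0 < xb j) (z : Fin r → Fin n → ℕ)
    (i : Fin r) (t : ℝ) :
    Real.log (XX z xb x i t) = ∑ j, (z i j : ℝ) * Real.log (x t j / xb j) :=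
  log_mono (fun j => div_pos (h.pos t j) (hxb j)) _

lemma Ctx.VVcont (h : Ctx y y' k τ τm M x) : Continuous (VV y k τ xb x) := by
  unfold VV
  refine (continuous_finsetSum _ fun j _ => continuous_const.mul
    (FF_cont.comp ((h.cont j).div_const _))).add
    (continuous_finsetSum _ fun i _ => continuous_const.mul ?_)
  exact continuous_iff_continuousAt.2 fun t =>
    (hasDerivAt_window (FF_cont.comp (h.XXcont y i)) (τ i) t).continuousAt

lemma Ctx.VVder (h : Ctx y y' k τ τm M x) (hxb : ∀ j, 0 < xb j)
    (hcb : ∀ η : Fin n → ℕ, ∑ i ∈ Finset.univ.filter (fun i => y i = η), k i * mono xb (y i)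
      = ∑ i ∈ Finset.univ.filter (fun i => y' i = η), k i * mono xb (y i)) {t : ℝ} (ht : 0 < t) :
    ∃ d, HasDerivAt (VV y k τ xb x) d t ∧ d ≤ - DD y y' k τ xb x t := by
  have h1 : HasDerivAt (fun t => ∑ j, xb j * FF (x t j / xb j))
      (∑ j, xb j * (Real.log (x t j / xb j) *
        ((∑ i, (Rt y k x i (t - τ i) * (y' i j : ℝ) - Rt y k x i t * (y i j : ℝ))) / xb j))) t := by
    apply HasDerivAt.fun_sum
    intro j _
    apply HasDerivAt.const_mul
    exact HasDerivAt.comp (h₂ := FF) (h := fun u => x u j / xb j) t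
      (FF_der (div_pos (h.pos t j) (hxb j))) ((h.der' ht j).div_const _)
  have h2 : HasDerivAt (fun t => ∑ i, KK y k xb i * ∫ s in (t - τ i)..t, FF (XX y xb x i s))
      (∑ i, KK y k xb i * (FF (XX y xb x i t) - FF (XX y xb x i (t - τ i)))) t := by
    apply HasDerivAt.fun_sum
    intro i _
    apply HasDerivAt.const_mul
    exact hasDerivAt_window (FF_cont.comp (h.XXcont y i)) (τ i) t
  refine ⟨_, h1.add h2, ?_⟩
  have e1 : ∑ j, xb j * (Real.log (x t j / xb j) *
        ((∑ i, (Rt y k x i (t - τ i) * (y' i j : ℝ) - Rt y k x i t * (y i j : ℝ))) / xb j))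
      = ∑ i, KK y k xb i * (XX y xb x i (t - τ i) * Real.log (XX y' xb x i t)
        - XX y xb x i t * Real.log (XX y xb x i t)) := by
    have : ∀ j, xb j * (Real.log (x t j / xb j) *
        ((∑ i, (Rt y k x i (t - τ i) * (y' i j : ℝ) - Rt y k x i t * (y i j : ℝ))) / xb j))
        = ∑ i, Real.log (x t j / xb j) *
          (Rt y k x i (t - τ i) * (y' i j : ℝ) - Rt y k x i t * (y i j : ℝ)) := by
      intro j
      rw [← Finset.mul_sum]
      have := (hxb j).ne'
      field_simp
    simp_rw [this]
    rw [Finset.sum_comm]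
    refine Finset.sum_congr rfl fun i _ => ?_
    rw [h.logXX hxb, h.logXX hxb, mul_sub, ← mul_assoc, ← mul_assoc, KK_XX hxb, KK_XX hxb,
      Finset.mul_sum, Finset.mul_sum, ← Finset.sum_sub_distrib]
    exact Finset.sum_congr rfl fun j _ => by ring
  have e2 : ∑ i, KK y k xb i * XX y' xb x i t = ∑ i, KK y k xb i * XX y xb x i t :=
    cb_sum (R := Finset.univ) hcb (fun η => mono (fun j => x t j / xb j) η)
  rw [e1, ← Finset.sum_add_distrib]
  have e3 : DD y y' k τ xb x t ≤ ∑ i, KK y k xb i * (XX y' xb x i t - XX y xb x i (t - τ i)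
      - XX y xb x i (t - τ i) * Real.log (XX y' xb x i t) + XX y xb x i (t - τ i) * Real.log (XX y xb x i (t - τ i))) := by
    unfold DD
    apply Finset.sum_le_sum
    intro i _
    apply mul_le_mul_of_nonneg_left _ (h.KKpos hxb i).le
    have hc := FF_conv (h.XXpos hxb y' i t) (h.XXpos hxb y i (t - τ i)).le
    unfold FF at hc
    nlinarith
  have e4 : ∑ i, (KK y k xb i * (XX y xb x i (t - τ i) * Real.log (XX y' xb x i t)
        - XX y xb x i t * Real.log (XX y xb x i t)) + KK y k xb i * (FF (XX y xb x i t) - FF (XX y xb x i (t - τ i))))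
      + ∑ i, KK y k xb i * (XX y' xb x i t - XX y xb x i (t - τ i)
      - XX y xb x i (t - τ i) * Real.log (XX y' xb x i t) + XX y xb x i (t - τ i) * Real.log (XX y xb x i (t - τ i)))
      = ∑ i, KK y k xb i * XX y' xb x i t - ∑ i, KK y k xb i * XX y xb x i t := by
    rw [← Finset.sum_add_distrib, ← Finset.sum_sub_distrib]
    refine Finset.sum_congr rfl fun i _ => ?_
    unfold FF
    ring
  rw [e2, sub_self] at e4
  linarith

lemma Ctx.VVanti (h : Ctx y y' k τ τm M x) (hxb : ∀ j, 0 < xb j)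
    (hcb : ∀ η : Fin n → ℕ, ∑ i ∈ Finset.univ.filter (fun i => y i = η), k i * mono xb (y i)
      = ∑ i ∈ Finset.univ.filter (fun i => y' i = η), k i * mono xb (y i)) {s t : ℝ} (hs : 0 ≤ s)
    (hst : s ≤ t) :
    VV y k τ xb x t + EE y y' k τ xb x t ≤ VV y k τ xb x s + EE y y' k τ xb x s := by
  have hder : ∀ u, ∃ d, 0 < u → HasDerivAt (VV y k τ xb x) d u ∧ d ≤ - DD y y' k τ xb x u := by
    intro u
    by_cases hu : 0 < u
    · obtain ⟨d, hd⟩ := h.VVder hxb hcb hu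
      exact ⟨d, fun _ => hd⟩
    · exact ⟨0, fun h => absurd h hu⟩
  choose d hd using hder
  have hanti : AntitoneOn (fun u => VV y k τ xb x u + EE y y' k τ xb x u) (Set.Icc s t) := by
    apply antitoneOn_of_hasDerivWithinAt_nonpos (convex_Icc s t)
      (f' := fun u => d u + DD y y' k τ xb x u)
    · refine (h.VVcont.add ?_).continuousOn
      exact continuous_iff_continuousAt.2 fun t => (h.EEder t).continuousAt
    · intro u hu
      rw [interior_Icc] at hu
      exact ((hd u (lt_of_le_of_lt hs hu.1)).1.add (h.EEder u)).hasDerivWithinAt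
    · intro u hu
      rw [interior_Icc] at hu
      linarith [(hd u (lt_of_le_of_lt hs hu.1)).2]
  exact hanti (Set.left_mem_Icc.2 hst) (Set.right_mem_Icc.2 hst) hst

end


lemma exp_lt_one_of_neg {a : ℝ} (ha : a < 0) : Real.exp a < 1 := by
  rw [← Real.exp_zero]; exact Real.exp_lt_exp.2 ha

lemma sub_sqrt_bd {a b η : ℝ} (ha : 0 ≤ a) (hb : 0 ≤ b) (hη : 0 < η) (hη1 : η ≤ 1) :
    |a - b| ≤ η * b + 2 / η * (Real.sqrt a - Real.sqrt b) ^ 2 := by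
  have h1 := Real.sq_sqrt ha
  have h2 := Real.sq_sqrt hb
  set p := Real.sqrt a
  set q := Real.sqrt b
  have hp : 0 ≤ p := Real.sqrt_nonneg _
  have hq : 0 ≤ q := Real.sqrt_nonneg _
  have h3 : 2 * |p - q| * q ≤ η * q ^ 2 + 1 / η * |p - q| ^ 2 := by
    have h5 : 0 ≤ (η * q - |p - q|) ^ 2 := sq_nonneg _
    have h6 : 1 / η * (η * q - |p - q|) ^ 2 = η * q ^ 2 + 1 / η * |p - q| ^ 2 - 2 * |p - q| * q := by
      field_simp
      ring
    have h7 : 0 ≤ 1 / η * (η * q - |p - q|) ^ 2 := by positivity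
    linarith
  have h4 : 1 ≤ 1 / η := by rw [le_div_iff₀ hη]; linarith
  have h5 : a - b = (p - q) * (p - q + 2 * q) := by rw [← h1, ← h2]; ring
  have h8 : |p - q + 2 * q| ≤ |p - q| + 2 * q := by
    refine (abs_add_le _ _).trans ?_
    rw [abs_of_nonneg (by positivity : 0 ≤ 2 * q)]
  rw [h5, abs_mul, ← h2]
  have h9 := mul_le_mul_of_nonneg_left h8 (abs_nonneg (p - q))
  have h10 : 2 / η * (p - q) ^ 2 = 1 / η * |p - q| ^ 2 + 1 / η * |p - q| ^ 2 := by
    rw [sq_abs]; ring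
  have h11 : |p - q| ^ 2 ≤ 1 / η * |p - q| ^ 2 := by nlinarith [sq_nonneg (|p - q|)]
  rw [h10]
  nlinarith

lemma log_gap_sq {a b η : ℝ} (ha : 0 < a) (hb : 0 < b) (hη : 0 < η)
    (h : η ≤ |Real.log b - Real.log a|) :
    (1 - Real.exp (-(η / 2))) ^ 2 * a ≤ (Real.sqrt a - Real.sqrt b) ^ 2 := by
  have hpa := Real.sqrt_pos.2 ha
  have hpb := Real.sqrt_pos.2 hb
  have h1 := Real.sq_sqrt ha.le
  have hla := Real.log_sqrt ha.le
  have hlb := Real.log_sqrt hb.le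
  set p := Real.sqrt a
  set q := Real.sqrt b
  rw [← h1, ← mul_pow]
  set e := Real.exp (-(η / 2)) with he
  have hep : 0 < e := Real.exp_pos _
  have hel : e < 1 := by rw [he]; exact exp_lt_one_of_neg (by linarith)
  have hle : Real.log e = -(η / 2) := Real.log_exp _
  rcases le_abs'.1 h with h2 | h2
  · have : q ≤ e * p := by
      rw [← Real.log_le_log_iff hpb (by positivity), Real.log_mul hep.ne' hpa.ne']
      linarith
    apply pow_le_pow_left₀ (by nlinarith)
    nlinarith
  · have : p ≤ e * q := by
      rw [← Real.log_le_log_iff hpa (by positivity), Real.log_mul hep.ne' hpb.ne']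
      linarith
    have hpq : p ≤ q := by nlinarith
    rw [show (p - q) ^ 2 = (q - p) ^ 2 by ring]
    apply pow_le_pow_left₀ (by nlinarith)
    nlinarith

lemma log_gap_abs {a b η : ℝ} (ha : 0 < a) (hb : 0 < b) (hη : 0 < η)
    (h : η ≤ |Real.log b - Real.log a|) :
    (1 - Real.exp (-η)) * a ≤ |b - a| := by
  set e := Real.exp (-η) with he
  have hep : 0 < e := Real.exp_pos _
  have hel : e < 1 := by rw [he]; exact exp_lt_one_of_neg (by linarith)
  have hle : Real.log e = -η := Real.log_exp _
  rcases le_abs'.1 h with h2 | h2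
  · have : b ≤ e * a := by
      rw [← Real.log_le_log_iff hb (by positivity), Real.log_mul hep.ne' ha.ne']
      linarith
    rw [abs_sub_comm]
    refine le_trans ?_ (le_abs_self _)
    linarith
  · have : a ≤ e * b := by
      rw [← Real.log_le_log_iff ha (by positivity), Real.log_mul hep.ne' hb.ne']
      linarith
    have hpq : a ≤ b := by nlinarith
    refine le_trans ?_ (le_abs_self _)
    nlinarith

section
variable {n r : ℕ} {y y' : Fin r → Fin n → ℕ} {k τ : Fin r → ℝ} {τm M : ℝ} {x : ℝ → Fin n → ℝ}
  {xb : Fin n → ℝ}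

lemma Ctx.slow (h : Ctx y y' k τ τm M x) (hxb : ∀ j, 0 < xb j)
    (hcb : ∀ η : Fin n → ℕ, ∑ i ∈ Finset.univ.filter (fun i => y i = η), k i * mono xb (y i)
      = ∑ i ∈ Finset.univ.filter (fun i => y' i = η), k i * mono xb (y i)) :
    ∃ C, 1 ≤ C ∧ ∀ η, 0 < η → η ≤ 1 → ∀ j s t, 0 ≤ s → s ≤ t → t ≤ s + τm →
      |x t j - x s j| ≤ C * (η * x t j + 1 / η * (EE y y' k τ xb x t - EE y y' k τ xb x s)) := by
  obtain ⟨C0, hC0, -, -, hgr, -⟩ := h.basic τm h.hτm0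
  set CB := ∑ i, KK y k xb i * (M ^ (∑ l, y' i l) / mono xb (y' i)) * ∑ j, (y' i j : ℝ) with hCB
  have hM0 : 0 < M := lt_of_lt_of_le zero_lt_one h.hM
  have hKp := fun i => h.KKpos hxb i
  have hmp := fun i => mono_pos' hxb (y' i)
  have hCB0 : 0 ≤ CB := Finset.sum_nonneg fun i _ => by
    have := hKp i; have := hmp i; positivity
  set CY := ∑ i, ∑ j, (y' i j : ℝ) with hCY
  have hCY0 : 0 ≤ CY := by positivity
  have hyj : ∀ i j, (y' i j : ℝ) ≤ ∑ j, (y' i j : ℝ) := fun i j =>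
    Finset.single_le_sum (f := fun j => (y' i j : ℝ)) (fun j _ => by positivity) (Finset.mem_univ j)
  have hyi : ∀ i j, (y' i j : ℝ) ≤ CY := fun i j => (hyj i j).trans
    (Finset.single_le_sum (f := fun i => ∑ j, (y' i j : ℝ)) (fun j _ => by positivity)
      (Finset.mem_univ i))
  -- derivative bound
  have hdb : ∀ η, 0 < η → η ≤ 1 → ∀ j u, 0 < u →
      |∑ i, (Rt y k x i (u - τ i) * (y' i j : ℝ) - Rt y k x i u * (y i j : ℝ))|
        ≤ CB * η * x u j + 2 * CY / η * DD y y' k τ xb x u := by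
    intro η hη hη1 j u hu
    have e1 : ∑ i, KK y k xb i * (XX y' xb x i u * (y' i j : ℝ))
        = ∑ i, KK y k xb i * (XX y xb x i u * (y i j : ℝ)) :=
      cb_sum (R := Finset.univ) hcb (fun η => mono (fun j => x u j / xb j) η * (η j : ℝ))
    have e2 : ∑ i, (Rt y k x i (u - τ i) * (y' i j : ℝ) - Rt y k x i u * (y i j : ℝ))
        = ∑ i, KK y k xb i * ((XX y xb x i (u - τ i) - XX y' xb x i u) * (y' i j : ℝ)) := by
      have e3 : ∑ i, KK y k xb i * ((XX y xb x i (u - τ i) - XX y' xb x i u) * (y' i j : ℝ))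
        = ∑ i, KK y k xb i * XX y xb x i (u - τ i) * (y' i j : ℝ)
          - ∑ i, KK y k xb i * (XX y' xb x i u * (y' i j : ℝ)) := by
        rw [← Finset.sum_sub_distrib]
        exact Finset.sum_congr rfl fun i _ => by ring
      rw [e3, e1, Finset.sum_sub_distrib]
      congr 1
      · exact Finset.sum_congr rfl fun i _ => by rw [KK_XX hxb]
      · exact Finset.sum_congr rfl fun i _ => by rw [← KK_XX hxb (y := y) (k := k)]; ring
    rw [e2]
    refine (Finset.abs_sum_le_sum_abs _ _).trans ?_
    have e4 : CB * η * x u j + 2 * CY / η * DD y y' k τ xb x u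
        = ∑ i, (KK y k xb i * (M ^ (∑ l, y' i l) / mono xb (y' i)) * (∑ j, (y' i j : ℝ)) * η * x u j
          + 2 * CY / η * (KK y k xb i * (Real.sqrt (XX y xb x i (u - τ i))
            - Real.sqrt (XX y' xb x i u)) ^ 2)) := by
      rw [Finset.sum_add_distrib, hCB, Finset.sum_mul, Finset.sum_mul, DD, Finset.mul_sum]
    rw [e4]
    apply Finset.sum_le_sum
    intro i _
    have hK := hKp i
    have hxu := h.pos u j
    rw [abs_mul, abs_of_pos hK, abs_mul, abs_of_nonneg (Nat.cast_nonneg (α := ℝ) (y' i j))]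
    have b1 := sub_sqrt_bd (h.XXpos hxb y i (u - τ i)).le (h.XXpos hxb y' i u).le hη hη1
    have b2 : XX y' xb x i u * (y' i j : ℝ)
        ≤ M ^ (∑ l, y' i l) / mono xb (y' i) * (∑ j, (y' i j : ℝ)) * x u j := by
      by_cases hy : y' i j = 0
      · have := hmp i
        simp only [hy, Nat.cast_zero, mul_zero]
        positivity
      · have b3 := mono_le_mul h.hM (fun j => (h.pos u j).le) (h.le u) (y' i) j hy
        have b4 : XX y' xb x i u ≤ M ^ (∑ l, y' i l) / mono xb (y' i) * x u j := by
          unfold XX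
          rw [mono_div, div_mul_eq_mul_div]
          exact div_le_div_of_nonneg_right b3 (hmp i).le
        have b5 := mul_le_mul b4 (hyj i j) (Nat.cast_nonneg _)
          (by have := hmp i; positivity)
        linarith
    have b6 : |XX y xb x i (u - τ i) - XX y' xb x i u| * (y' i j : ℝ)
        ≤ η * (XX y' xb x i u * (y' i j : ℝ)) + 2 / η * (Real.sqrt (XX y xb x i (u - τ i))
            - Real.sqrt (XX y' xb x i u)) ^ 2 * CY := by
      have c1 := mul_le_mul_of_nonneg_right b1 (Nat.cast_nonneg (α := ℝ) (y' i j))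
      have c2 : 2 / η * (Real.sqrt (XX y xb x i (u - τ i))
            - Real.sqrt (XX y' xb x i u)) ^ 2 * (y' i j : ℝ) ≤ 2 / η * (Real.sqrt (XX y xb x i (u - τ i))
            - Real.sqrt (XX y' xb x i u)) ^ 2 * CY :=
        mul_le_mul_of_nonneg_left (hyi i j) (by positivity)
      linarith
    have b7 := mul_le_mul_of_nonneg_left b2 hη.le
    have b8 := mul_le_mul_of_nonneg_left (b6.trans (add_le_add_left b7 _)) hK.le
    refine b8.trans (le_of_eq ?_)
    ring
  refine ⟨1 + CB * C0 * τm + 2 * CY, ?_, ?_⟩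
  · have : 0 ≤ CB * C0 * τm := mul_nonneg (mul_nonneg hCB0 (by linarith)) h.hτm0
    linarith
  intro η hη hη1 j s t hs hst hts
  have hxt := h.pos t j
  set α := CB * η * (C0 * x t j) with hα
  set β := 2 * CY / η with hβ
  have hEc : Continuous (EE y y' k τ xb x) :=
    continuous_iff_continuousAt.2 fun t => (h.EEder t).continuousAt
  have hb : ∀ u ∈ Set.Ioo s t,
      |∑ i, (Rt y k x i (u - τ i) * (y' i j : ℝ) - Rt y k x i u * (y i j : ℝ))|
        ≤ α + β * DD y y' k τ xb x u := by
    intro u hu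
    refine (hdb η hη hη1 j u (lt_of_le_of_lt hs hu.1)).trans ?_
    have := hgr j u t (by linarith [hu.1]) hu.2.le (by linarith [hu.1])
    have := mul_le_mul_of_nonneg_left this (mul_nonneg hCB0 hη.le)
    linarith
  have hm1 : MonotoneOn (fun u => (α * u + β * EE y y' k τ xb x u) - x u j) (Set.Icc s t) := by
    apply monotoneOn_of_hasDerivWithinAt_nonneg (convex_Icc s t)
      (f' := fun u => (α * 1 + β * DD y y' k τ xb x u) -
        (∑ i, (Rt y k x i (u - τ i) * (y' i j : ℝ) - Rt y k x i u * (y i j : ℝ))))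
    · exact (((continuous_const.mul continuous_id).add (continuous_const.mul hEc)).sub
        (h.cont j)).continuousOn
    · intro u hu
      rw [interior_Icc] at hu
      exact ((((hasDerivAt_id u).const_mul α).add ((h.EEder u).const_mul β)).sub
        (h.der' (lt_of_le_of_lt hs hu.1) j)).hasDerivWithinAt
    · intro u hu
      rw [interior_Icc] at hu
      linarith [(abs_le.1 (hb u hu)).2]
  have hm2 : MonotoneOn (fun u => (α * u + β * EE y y' k τ xb x u) + x u j) (Set.Icc s t) := by
    apply monotoneOn_of_hasDerivWithinAt_nonneg (convex_Icc s t)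
      (f' := fun u => (α * 1 + β * DD y y' k τ xb x u) +
        (∑ i, (Rt y k x i (u - τ i) * (y' i j : ℝ) - Rt y k x i u * (y i j : ℝ))))
    · exact (((continuous_const.mul continuous_id).add (continuous_const.mul hEc)).add
        (h.cont j)).continuousOn
    · intro u hu
      rw [interior_Icc] at hu
      exact ((((hasDerivAt_id u).const_mul α).add ((h.EEder u).const_mul β)).add
        (h.der' (lt_of_le_of_lt hs hu.1) j)).hasDerivWithinAt
    · intro u hu
      rw [interior_Icc] at hu
      linarith [(abs_le.1 (hb u hu)).1]
  have q1 := hm1 (Set.left_mem_Icc.2 hst) (Set.right_mem_Icc.2 hst) hst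
  have q2 := hm2 (Set.left_mem_Icc.2 hst) (Set.right_mem_Icc.2 hst) hst
  simp only at q1 q2
  have hE := sub_nonneg.2 (h.EEmono hxb hst)
  set dE := EE y y' k τ xb x t - EE y y' k τ xb x s with hdE
  have q3 : |x t j - x s j| ≤ α * (t - s) + β * dE := by
    rw [abs_le]
    constructor
    · rw [hdE]; nlinarith
    · rw [hdE]; nlinarith
  refine q3.trans ?_
  have hα0 : 0 ≤ α := by positivity
  have q4 : α * (t - s) ≤ α * τm := mul_le_mul_of_nonneg_left (by linarith) hα0
  have q5 : α * τm = (CB * C0 * τm) * (η * x t j) := by rw [hα]; ring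
  have q6 : β * dE = 2 * CY * (1 / η * dE) := by rw [hβ]; ring
  have q7 : 0 ≤ η * x t j := by positivity
  have q8 : 0 ≤ 1 / η * dE := by positivity
  have q9 : 0 ≤ CB * C0 * τm := mul_nonneg (mul_nonneg hCB0 (by linarith)) h.hτm0
  nlinarith

/-- The affinity of reaction `i`. -/
lemma Ctx.rate_bd (h : Ctx y y' k τ τm M x) (hxb : ∀ j, 0 < xb j)
    (hcb : ∀ η : Fin n → ℕ, ∑ i ∈ Finset.univ.filter (fun i => y i = η), k i * mono xb (y i)
      = ∑ i ∈ Finset.univ.filter (fun i => y' i = η), k i * mono xb (y i)) (η : ℝ) (hη : 0 < η) :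
    ∃ C, 0 ≤ C ∧ ∀ i t, τm ≤ t →
      η ≤ |∑ j, ((y' i j : ℝ) - y i j) * Real.log (x t j / xb j)| →
      Rt y k x i (t - τ i) ≤ C * (DD y y' k τ xb x t +
        (EE y y' k τ xb x t - EE y y' k τ xb x (t - τm))) := by
  obtain ⟨C0, hC0, -, hR, hgr, -⟩ := h.basic τm h.hτm0
  obtain ⟨C1, hC1, hsl⟩ := h.slow hxb hcb
  set N : ℝ := 1 + ∑ i, ∑ j, (y i j : ℝ) with hN
  have hN1 : 1 ≤ N := by
    have : 0 ≤ ∑ i, ∑ j, (y i j : ℝ) := by positivity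
    linarith
  set e1 := (1 - Real.exp (-(η / 2 / 2))) ^ 2 with he1
  have he1p : 0 < e1 := by
    have : Real.exp (-(η / 2 / 2)) < 1 := exp_lt_one_of_neg (by linarith)
    exact pow_pos (by linarith) 2
  set η2 := η / 2 / N with hη2
  have hη2p : 0 < η2 := by positivity
  set e2 := 1 - Real.exp (-η2) with he2
  have he2p : 0 < e2 := by
    have : Real.exp (-η2) < 1 := exp_lt_one_of_neg (by linarith)
    linarith
  have he2l : e2 ≤ 1 := by linarith [Real.exp_pos (-η2)]
  set η3 := e2 / (2 * C1) with hη3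
  have hη3p : 0 < η3 := by positivity
  have hη3l : η3 ≤ 1 := by rw [hη3, div_le_one (by positivity)]; linarith
  refine ⟨1 / e1 + C0 * (C0 * (2 / e2 * (C1 * (1 / η3)))), by positivity, ?_⟩
  intro i t ht hg
  have hD := h.DDnonneg (y := y) (y' := y') (k := k) (τ := τ) hxb t
  have hEm := sub_nonneg.2 (h.EEmono hxb (show t - τm ≤ t by linarith [h.hτm0]))
  set dE := EE y y' k τ xb x t - EE y y' k τ xb x (t - τm) with hdE
  have hτi := h.hτ i
  have hτi' := h.hτm i
  have hg2 : ∑ j, ((y' i j : ℝ) - y i j) * Real.log (x t j / xb j)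
      = Real.log (XX y' xb x i t) - Real.log (XX y xb x i t) := by
    rw [h.logXX hxb, h.logXX hxb, ← Finset.sum_sub_distrib]
    exact Finset.sum_congr rfl fun j _ => by ring
  rw [hg2] at hg
  by_cases hc : η / 2 ≤ |Real.log (XX y' xb x i t) - Real.log (XX y xb x i (t - τ i))|
  · have h1 := log_gap_sq (h.XXpos hxb y i (t - τ i)) (h.XXpos hxb y' i t) (half_pos hη) hc
    have hK := h.KKpos hxb i
    have h2 : KK y k xb i * (Real.sqrt (XX y xb x i (t - τ i)) - Real.sqrt (XX y' xb x i t)) ^ 2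
        ≤ DD y y' k τ xb x t := by
      unfold DD
      exact Finset.single_le_sum (f := fun i => KK y k xb i *
        (Real.sqrt (XX y xb x i (t - τ i)) - Real.sqrt (XX y' xb x i t)) ^ 2)
        (fun i _ => mul_nonneg (h.KKpos hxb i).le (sq_nonneg _)) (Finset.mem_univ i)
    have h3 : e1 * Rt y k x i (t - τ i) ≤ DD y y' k τ xb x t := by
      rw [← KK_XX hxb]
      have := mul_le_mul_of_nonneg_left h1 hK.le
      linarith
    have h4 : Rt y k x i (t - τ i) ≤ 1 / e1 * DD y y' k τ xb x t := by
      rw [div_mul_eq_mul_div, one_mul, le_div_iff₀ he1p]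
      linarith
    have p1 : 0 ≤ 1 / e1 := by positivity
    have p2 : 0 ≤ C0 * (C0 * (2 / e2 * (C1 * (1 / η3)))) := by positivity
    nlinarith [mul_nonneg p1 hEm, mul_nonneg p2 hD, mul_nonneg p2 hEm]
  · have hc2 : η / 2 ≤ |Real.log (XX y xb x i (t - τ i)) - Real.log (XX y xb x i t)| := by
      have := abs_sub_le (Real.log (XX y' xb x i t)) (Real.log (XX y xb x i (t - τ i)))
        (Real.log (XX y xb x i t))
      push Not at hc
      linarith
    have hex : ∃ j, y i j ≠ 0 ∧ η2 ≤ |Real.log (x (t - τ i) j) - Real.log (x t j)| := by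
      by_contra hcon
      push Not at hcon
      have h5 : |Real.log (XX y xb x i (t - τ i)) - Real.log (XX y xb x i t)|
          ≤ ∑ j, (y i j : ℝ) * η2 := by
        rw [h.logXX hxb, h.logXX hxb, ← Finset.sum_sub_distrib]
        refine (Finset.abs_sum_le_sum_abs _ _).trans (Finset.sum_le_sum fun j _ => ?_)
        rw [← mul_sub, abs_mul, abs_of_nonneg (Nat.cast_nonneg (α := ℝ) (y i j))]
        by_cases hy : y i j = 0
        · simp [hy]
        · apply mul_le_mul_of_nonneg_left _ (Nat.cast_nonneg _)
          rw [Real.log_div (h.pos _ j).ne' (hxb j).ne', Real.log_div (h.pos _ j).ne' (hxb j).ne']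
          have := (hcon j hy).le
          rw [show Real.log (x (t - τ i) j) - Real.log (xb j) - (Real.log (x t j) - Real.log (xb j))
            = Real.log (x (t - τ i) j) - Real.log (x t j) by ring]
          exact this
      rw [← Finset.sum_mul] at h5
      have h6 : ∑ j, (y i j : ℝ) < N := by
        have := Finset.single_le_sum (f := fun i => ∑ j, (y i j : ℝ))
          (fun j _ => by positivity) (Finset.mem_univ i)
        linarith
      have h7 : (∑ j, (y i j : ℝ)) * η2 < N * η2 := mul_lt_mul_of_pos_right h6 hη2p
      have h8 : N * η2 = η / 2 := by rw [hη2]; field_simp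
      linarith
    obtain ⟨j, hy, hj⟩ := hex
    have h9 := log_gap_abs (h.pos t j) (h.pos (t - τ i) j) hη2p hj
    have h10 := hsl η3 hη3p hη3l j (t - τ i) t (by linarith) (by linarith) (by linarith)
    rw [abs_sub_comm] at h10
    have hE2 : EE y y' k τ xb x t - EE y y' k τ xb x (t - τ i) ≤ dE := by
      have := h.EEmono (y := y) (y' := y') (k := k) (τ := τ) hxb (show t - τm ≤ t - τ i by linarith)
      linarith
    have h11 : e2 / 2 * x t j ≤ C1 * (1 / η3) * dE := by
      have h12 : C1 * (1 / η3) * (EE y y' k τ xb x t - EE y y' k τ xb x (t - τ i))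
          ≤ C1 * (1 / η3) * dE := mul_le_mul_of_nonneg_left hE2 (by positivity)
      have h13 : C1 * (η3 * x t j) = e2 / 2 * x t j := by rw [hη3]; field_simp
      nlinarith
    have h14 : x t j ≤ 2 / e2 * (C1 * (1 / η3)) * dE := by
      have : x t j = 2 / e2 * (e2 / 2 * x t j) := by field_simp
      rw [this, mul_assoc]
      exact mul_le_mul_of_nonneg_left h11 (by positivity)
    have h15 := hR i (t - τ i) j hy
    have h16 := hgr j (t - τ i) t (by linarith) (by linarith) (by linarith)
    have h17 : Rt y k x i (t - τ i) ≤ C0 * (C0 * (2 / e2 * (C1 * (1 / η3)))) * dE := by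
      calc _ ≤ C0 * x (t - τ i) j := h15
        _ ≤ C0 * (C0 * x t j) := mul_le_mul_of_nonneg_left h16 (by linarith)
        _ ≤ C0 * (C0 * (2 / e2 * (C1 * (1 / η3)) * dE)) := by gcongr
        _ = _ := by ring
    have p1 : 0 ≤ 1 / e1 := by positivity
    have p2 : 0 ≤ C0 * (C0 * (2 / e2 * (C1 * (1 / η3)))) := by positivity
    nlinarith [mul_nonneg p1 hEm, mul_nonneg p2 hD, mul_nonneg p1 hD]

/-- Gross progress bound. -/
lemma Ctx.gross_bd (h : Ctx y y' k τ τm M x) (hxb : ∀ j, 0 < xb j)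
    (hcb : ∀ η : Fin n → ℕ, ∑ i ∈ Finset.univ.filter (fun i => y i = η), k i * mono xb (y i)
      = ∑ i ∈ Finset.univ.filter (fun i => y' i = η), k i * mono xb (y i)) (η : ℝ) (hη : 0 < η) :
    ∃ C, 0 ≤ C ∧ ∀ i s t, τm ≤ s → s ≤ t →
      (∀ u ∈ Set.Icc s t, η ≤ |∑ j, ((y' i j : ℝ) - y i j) * Real.log (x u j / xb j)|) →
      |nn y k τ x i t - nn y k τ x i s| ≤ C *
        (EE y y' k τ xb x t - EE y y' k τ xb x (s - τm)) := by
  obtain ⟨C, hC, hr⟩ := h.rate_bd hxb hcb η hη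
  refine ⟨C * (1 + τm), mul_nonneg hC (by linarith [h.hτm0]), ?_⟩
  intro i s t hs hst hg
  have hEc : Continuous (EE y y' k τ xb x) :=
    continuous_iff_continuousAt.2 fun t => (h.EEder t).continuousAt
  have hEm := h.EEmono (y := y) (y' := y') (k := k) (τ := τ) hxb
  have hτ0 := h.hτm0
  set G : ℝ → ℝ := fun u => ∫ v in (u - τm)..u, EE y y' k τ xb x v with hG
  have hGd : ∀ u, HasDerivAt G (EE y y' k τ xb x u - EE y y' k τ xb x (u - τm)) u :=
    fun u => hasDerivAt_window hEc τm u
  have hm1 : MonotoneOn (fun u => C * (EE y y' k τ xb x u + G u) - nn y k τ x i u)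
      (Set.Icc s t) := by
    apply monotoneOn_of_hasDerivWithinAt_nonneg (convex_Icc s t)
      (f' := fun u => C * (DD y y' k τ xb x u + (EE y y' k τ xb x u - EE y y' k τ xb x (u - τm)))
        - Rt y k x i (u - τ i))
    · intro u _
      exact ((((h.EEder u).add (hGd u)).const_mul C).sub (h.nnder i u)).continuousAt.continuousWithinAt
    · intro u _
      exact ((((h.EEder u).add (hGd u)).const_mul C).sub (h.nnder i u)).hasDerivWithinAt
    · intro u hu
      rw [interior_Icc] at hu
      have := hr i u (by linarith [hu.1]) (hg u ⟨hu.1.le, hu.2.le⟩)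
      linarith
  have hm2 : Monotone (nn y k τ x i) :=
    monotone_of_hasDerivAt_nonneg (fun u => h.nnder i u) (fun u => (h.Rpos i _).le)
  rw [abs_of_nonneg (sub_nonneg.2 (hm2 hst))]
  have q1 := hm1 (Set.left_mem_Icc.2 hst) (Set.right_mem_Icc.2 hst) hst
  simp only at q1
  have g1 : G t ≤ τm * EE y y' k τ xb x t := by
    have := intervalIntegral.integral_mono_on (a := t - τm) (b := t) (by linarith)
      (hEc.intervalIntegrable _ _) (continuous_const.intervalIntegrable (μ := MeasureTheory.volume) _ _)
      (g := fun _ => EE y y' k τ xb x t) (fun v hv => hEm hv.2)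
    rw [intervalIntegral.integral_const, smul_eq_mul] at this
    simpa using this
  have g2 : τm * EE y y' k τ xb x (s - τm) ≤ G s := by
    have := intervalIntegral.integral_mono_on (a := s - τm) (b := s) (by linarith)
      (continuous_const.intervalIntegrable (μ := MeasureTheory.volume) _ _)
      (hEc.intervalIntegrable _ _)
      (f := fun _ => EE y y' k τ xb x (s - τm)) (fun v hv => hEm hv.1)
    rw [intervalIntegral.integral_const, smul_eq_mul] at this
    simpa using this
  have g3 := hEm (show s - τm ≤ s by linarith)
  have g4 : EE y y' k τ xb x t + G t - (EE y y' k τ xb x s + G s)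
      ≤ (1 + τm) * (EE y y' k τ xb x t - EE y y' k τ xb x (s - τm)) := by nlinarith
  have g5 := mul_le_mul_of_nonneg_left g4 hC
  nlinarith

end


lemma finset_pos_lb {α : Type*} (S : Finset α) (f : α → ℝ) (hf : ∀ a ∈ S, 0 < f a) :
    ∃ ω > 0, ∀ a ∈ S, ω ≤ f a := by
  classical
  induction S using Finset.induction_on with
  | empty => exact ⟨1, one_pos, by simp⟩
  | insert a S ha ih =>
    obtain ⟨ω, hω, h⟩ := ih fun b hb => hf b (Finset.mem_insert_of_mem hb)
    refine ⟨min ω (f a), lt_min hω (hf a (Finset.mem_insert_self _ _)), ?_⟩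
    intro b hb
    rcases Finset.mem_insert.1 hb with rfl | hb
    · exact min_le_right _ _
    · exact (min_le_left _ _).trans (h b hb)

lemma finset_ub {α : Type*} (S : Finset α) (f : α → ℝ) :
    ∃ C, 0 ≤ C ∧ ∀ a ∈ S, f a ≤ C := by
  refine ⟨∑ a ∈ S, |f a|, Finset.sum_nonneg fun a _ => abs_nonneg _, fun a ha => ?_⟩
  exact (le_abs_self _).trans (Finset.single_le_sum (f := fun a => |f a|)
    (fun a _ => abs_nonneg _) ha)

/-- A nondecreasing staircase which is flat near finitely many positive values. -/
lemma snap_pos (F : Finset ℝ) (hF : ∀ c ∈ F, 0 < c) :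
    ∃ (m η : ℝ) (s : ℝ → ℝ), 0 ≤ m ∧ 0 < η ∧ Continuous s ∧ (∀ c ∈ F, c ≤ m) ∧
      (m = 0 ∨ m ∈ F) ∧
      (∀ ξ, 0 ≤ s ξ) ∧ (∀ ξ, s ξ ≤ m) ∧ (∀ ξ, m - η ≤ ξ → s ξ = m) ∧
      (∀ c, c ∈ F ∨ c = 0 → ∀ ξ, (c < s ξ → c + η ≤ ξ) ∧ (s ξ < c → ξ ≤ c - η)) := by
  classical
  induction F using Finset.induction_on_max with
  | empty =>
    refine ⟨0, 1, fun _ => 0, le_rfl, one_pos, continuous_const, by simp, Or.inl rfl,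
      fun _ => le_rfl, fun _ => le_rfl, fun _ _ => rfl, ?_⟩
    intro c hc ξ
    rcases hc with hc | rfl
    · simp at hc
    · simp
  | insert a F ha ih =>
    obtain ⟨m, η, s, hm, hη, hs, hmF, hmm, hs0, hsm, hsm', hcr⟩ :=
      ih fun c hc => hF c (Finset.mem_insert_of_mem hc)
    have ha0 : 0 < a := hF a (Finset.mem_insert_self _ _)
    have ham : m < a := by
      rcases hmm with h | h
      · rw [h]; exact ha0
      · exact ha m h
    set η' := min η ((a - m) / 3) with hη'
    have hη'p : 0 < η' := lt_min hη (by linarith)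
    have hη'1 : η' ≤ η := min_le_left _ _
    have hη'2 : η' ≤ (a - m) / 3 := min_le_right _ _
    set θ : ℝ → ℝ := fun ξ => max 0 (min 1 ((ξ - (a - 2 * η')) / η')) with hθ
    have hθ0 : ∀ ξ, 0 ≤ θ ξ := fun ξ => le_max_left _ _
    have hθ1 : ∀ ξ, θ ξ ≤ 1 := fun ξ => max_le zero_le_one (min_le_left _ _)
    have hθz : ∀ ξ, ξ ≤ a - 2 * η' → θ ξ = 0 := fun ξ h => by
      apply max_eq_left
      refine (min_le_right _ _).trans (div_nonpos_of_nonpos_of_nonneg (by linarith) hη'p.le)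
    have hθo : ∀ ξ, a - η' ≤ ξ → θ ξ = 1 := fun ξ h => by
      have : 1 ≤ (ξ - (a - 2 * η')) / η' := by rw [le_div_iff₀ hη'p]; linarith
      simp only [hθ]
      rw [min_eq_left this]
      exact max_eq_right zero_le_one
    have hθc : Continuous θ := by
      simp only [hθ]
      fun_prop
    refine ⟨a, η', fun ξ => s ξ + (a - m) * θ ξ, ha0.le, hη'p, hs.add (continuous_const.mul hθc),
      ?_, Or.inr (Finset.mem_insert_self _ _), ?_, ?_, ?_, ?_⟩
    · intro c hc
      rcases Finset.mem_insert.1 hc with rfl | hc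
      · exact le_rfl
      · exact (ha c hc).le
    · intro ξ
      have := hs0 ξ; have := hθ0 ξ
      have := mul_nonneg (show 0 ≤ a - m by linarith) (hθ0 ξ)
      simp only; linarith
    · intro ξ
      have := hsm ξ
      have := mul_le_mul_of_nonneg_left (hθ1 ξ) (show 0 ≤ a - m by linarith)
      simp only; linarith
    · intro ξ h
      simp only
      rw [hθo ξ h, hsm' ξ (by linarith)]
      ring
    · have hold : ∀ c, c ≤ m → (∀ ξ, (c < s ξ → c + η ≤ ξ) ∧ (s ξ < c → ξ ≤ c - η)) →
        ∀ ξ, (c < s ξ + (a - m) * θ ξ → c + η' ≤ ξ) ∧ (s ξ + (a - m) * θ ξ < c → ξ ≤ c - η') := by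
        intro c hcm hc ξ
        have h1 := mul_nonneg (show 0 ≤ a - m by linarith) (hθ0 ξ)
        constructor
        · intro h
          rcases le_or_gt ξ (a - 2 * η') with h2 | h2
          · rw [hθz ξ h2, mul_zero, add_zero] at h
            have := (hc ξ).1 h
            linarith
          · linarith
        · intro h
          have := (hc ξ).2 (by linarith)
          linarith
      intro c hc
      rcases hc with hc | hc
      · rcases Finset.mem_insert.1 hc with rfl | hc
        · intro ξ
          constructor
          · intro h
            have := hsm ξ
            have := mul_le_mul_of_nonneg_left (hθ1 ξ) (show 0 ≤ c - m by linarith)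
            simp only at h; linarith
          · intro h
            by_contra hcon
            push Not at hcon
            simp only at h
            rw [hθo ξ hcon.le, hsm' ξ (by linarith)] at h
            linarith
        · exact hold c (hmF c hc) (hcr c (Or.inl hc))
      · exact hold c (by rw [hc]; exact hm) (hcr c (Or.inr hc))

lemma snap (F : Finset ℝ) :
    ∃ (m η : ℝ) (s : ℝ → ℝ), 0 ≤ m ∧ 0 < η ∧ Continuous s ∧
      (∀ ξ, 0 ≤ s ξ) ∧ (∀ ξ, s ξ ≤ m) ∧ (∀ ξ, ξ < η → s ξ = 0) ∧
      (∀ c ∈ F, ∀ ξ, -η ≤ ξ → (c < s ξ → c + η ≤ ξ) ∧ (s ξ < c → ξ ≤ c - η)) := by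
  classical
  obtain ⟨m, η, s, hm, hη, hs, -, -, hs0, hsm, -, hcr⟩ :=
    snap_pos (F.filter (fun c => 0 < c)) (fun c hc => (Finset.mem_filter.1 hc).2)
  obtain ⟨ω, hω, hlb⟩ := finset_pos_lb (F.filter (fun c => c < 0)) (fun c => -c)
    (fun c hc => by have := (Finset.mem_filter.1 hc).2; linarith)
  have h0 := hcr 0 (Or.inr rfl)
  refine ⟨m, min η (ω / 2), s, hm, lt_min hη (by linarith), hs, hs0, hsm, ?_, ?_⟩
  · intro ξ hξ
    by_contra hne
    have h1 : 0 < s ξ := lt_of_le_of_ne (hs0 ξ) (Ne.symm hne)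
    have h2 := (h0 ξ).1 h1
    have := min_le_left η (ω / 2)
    linarith
  · intro c hc ξ hξ
    have m1 := min_le_left η (ω / 2)
    have m2 := min_le_right η (ω / 2)
    rcases lt_trichotomy c 0 with h | h | h
    · have h3 := hlb c (Finset.mem_filter.2 ⟨hc, h⟩)
      refine ⟨fun _ => by linarith, fun h4 => ?_⟩
      linarith [hs0 ξ]
    · have h4 := hcr c (Or.inr h) ξ
      exact ⟨fun h5 => by linarith [h4.1 h5], fun h5 => by linarith [h4.2 h5]⟩
    · have h4 := hcr c (Or.inl (Finset.mem_filter.2 ⟨hc, h⟩)) ξ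
      exact ⟨fun h5 => by linarith [h4.1 h5], fun h5 => by linarith [h4.2 h5]⟩

/-- Exit lemma. -/
lemma barrier_exit {f f' : ℝ → ℝ} {a b ρ : ℝ} (hρ : 0 < ρ) (hab : a ≤ b) (hf : Continuous f)
    (hd : ∀ t ∈ Set.Ioo a b, HasDerivAt f (f' t) t)
    (hpos : ∀ t ∈ Set.Ioo a b, ρ / 2 ≤ f t → f t ≤ ρ → 0 ≤ f' t) (ha : ρ ≤ f a) : ρ ≤ f b := by
  by_contra hb
  push Not at hb
  set S := {t | t ∈ Set.Icc a b ∧ ρ ≤ f t} with hS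
  have hSc : IsClosed S := isClosed_Icc.inter (isClosed_le continuous_const hf)
  have hSne : S.Nonempty := ⟨a, Set.left_mem_Icc.2 hab, ha⟩
  have hSb : BddAbove S := ⟨b, fun t ht => ht.1.2⟩
  set t0 := sSup S with ht0
  have ht0S : t0 ∈ S := hSc.csSup_mem hSne hSb
  have hlt : ∀ t, t0 < t → t ≤ b → f t < ρ := by
    intro t h1 h2
    by_contra h3
    push Not at h3
    exact absurd (le_csSup hSb (show t ∈ S from ⟨⟨ht0S.1.1.trans h1.le, h2⟩, h3⟩)) (not_le.2 h1)
  have ht0b : t0 < b := lt_of_le_of_ne ht0S.1.2 (fun h => by rw [h] at ht0S; linarith [ht0S.2])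
  have hev : ∀ᶠ t in nhds t0, ρ / 2 < f t :=
    hf.continuousAt.eventually (lt_mem_nhds (by linarith [ht0S.2]))
  obtain ⟨δ, hδ, hball⟩ := Metric.eventually_nhds_iff.1 hev
  set t1 := min b (t0 + δ / 2) with ht1
  have ht01 : t0 < t1 := lt_min ht0b (by linarith)
  have ht1b : t1 ≤ b := min_le_left _ _
  have ht1d : t1 ≤ t0 + δ / 2 := min_le_right _ _
  have hm : MonotoneOn f (Set.Icc t0 t1) := by
    apply monotoneOn_of_hasDerivWithinAt_nonneg (convex_Icc t0 t1) (f' := f') hf.continuousOn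
    · intro u hu
      rw [interior_Icc] at hu
      exact (hd u ⟨lt_of_le_of_lt ht0S.1.1 hu.1, lt_of_lt_of_le hu.2 ht1b⟩).hasDerivWithinAt
    · intro u hu
      rw [interior_Icc] at hu
      refine hpos u ⟨lt_of_le_of_lt ht0S.1.1 hu.1, lt_of_lt_of_le hu.2 ht1b⟩ (hball ?_).le
        (hlt u hu.1 (hu.2.le.trans ht1b)).le
      rw [Real.dist_eq, abs_of_pos (by linarith [hu.1])]
      linarith [hu.2]
  have h1 := hm (Set.left_mem_Icc.2 ht01.le) (Set.right_mem_Icc.2 ht01.le) ht01.le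
  linarith [hlt t1 ht01 ht1b, ht0S.2]

/-- Domination of inward flux. -/
lemma flux_nonneg {n r : ℕ} {y y' : Fin r → Fin n → ℕ} {k : Fin r → ℝ} {R : Finset (Fin r)}
    {xb : Fin n → ℝ} (hk : ∀ i, 0 < k i) (hxb : ∀ j, 0 < xb j)
    (hcb : ∀ η : Fin n → ℕ, ∑ i ∈ R.filter (fun i => y i = η), k i * mono xb (y i)
      = ∑ i ∈ R.filter (fun i => y' i = η), k i * mono xb (y i))
    (Rep : (Fin n → ℝ) → Prop) (g : (Fin n → ℝ) →ₗ[ℝ] ℝ)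
    (hRadd : ∀ u v, Rep u → Rep v → Rep (u + v)) (hRneg : ∀ u, Rep u → Rep (-u)) 
    (hR : ∀ i ∈ R, Rep (fun j => (y' i j : ℝ) - y i j))
    (m rt : Fin r → ℝ) (ε κ : ℝ) (hε : 0 < ε) (hκ0 : 0 ≤ κ) (hm : ∀ i ∈ R, 0 < m i)
    (hrt : ∀ i ∈ R, ε * m i ≤ rt i ∧ rt i ≤ ε⁻¹ * m i)
    (hκ : ∀ i ∈ R, ∀ l ∈ R, κ * KK y k xb l * (R.card : ℝ) ≤ ε ^ 2 * KK y k xb i)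
    (hP : ∀ a ∈ R, ∀ b ∈ R, Rep (fun j => (y a j : ℝ) - y b j) →
      0 < g (fun j => (y a j : ℝ) - y b j) → m a ≤ κ * m b) :
    0 ≤ ∑ i ∈ R, rt i * g (fun j => (y' i j : ℝ) - y i j) := by
  classical
  have hK : ∀ i, 0 < KK y k xb i := fun i => mul_pos (hk i) (mono_pos' hxb _)
  set G : Fin r → ℝ := fun i => g (fun j => (y' i j : ℝ) - y i j) with hG
  set P := ∑ l ∈ R, rt l * max (G l) 0 with hPdef
  have hrt0 : ∀ i ∈ R, 0 ≤ rt i := fun i hi =>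
    (mul_nonneg hε.le (hm i hi).le).trans (hrt i hi).1
  have hP0 : 0 ≤ P := Finset.sum_nonneg fun l hl => mul_nonneg (hrt0 l hl) (le_max_right _ _)
  have key : ∀ i ∈ R, rt i * max (-G i) 0 * (R.card : ℝ) ≤ P := by
    intro i hi
    rcases le_or_gt 0 (G i) with hgi | hgi
    · rw [max_eq_right (by linarith)]; simpa using hP0
    rw [max_eq_left (by linarith)]
    set F : (Fin n → ℕ) → ℝ := fun η => if Rep (fun j => (η j : ℝ) - y i j) then
      min (g (fun j => (η j : ℝ) - y i j)) 0 else 0 with hF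
    have hsum := cb_sum hcb F
    have hT : ∑ l ∈ R, KK y k xb l * (F (y' l) - F (y l)) = 0 := by
      have : ∑ l ∈ R, KK y k xb l * (F (y' l) - F (y l))
          = ∑ l ∈ R, k l * mono xb (y l) * F (y' l) - ∑ l ∈ R, k l * mono xb (y l) * F (y l) := by
        rw [← Finset.sum_sub_distrib]
        exact Finset.sum_congr rfl fun l _ => by unfold KK; ring
      rw [this, hsum, sub_self]
    have hFi : F (y' i) - F (y i) = G i := by
      have h1 : F (y i) = 0 := by
        simp only [hF]
        split_ifs with h
        · have : (fun j => (y i j : ℝ) - y i j) = 0 := by ext j; simp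
          rw [this]; simp
        · rfl
      rw [h1, sub_zero]
      simp only [hF]
      rw [if_pos (hR i hi)]
      exact min_eq_left hgi.le
    rw [← Finset.add_sum_erase R _ hi, hFi] at hT
    have hmi := hm i hi
    -- pointwise bound
    have hpt : ∀ l ∈ R, m i * (F (y' l) - F (y l)) ≤ κ * m l * max (G l) 0 := by
      intro l hl
      have hml := hm l hl
      have hrhs : 0 ≤ κ * m l * max (G l) 0 :=
        mul_nonneg (mul_nonneg hκ0 hml.le) (le_max_right _ _)
      rcases le_or_gt (F (y' l) - F (y l)) 0 with hneg | hpos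
      · nlinarith
      have hF0 : F (y' l) ≤ 0 := by
        simp only [hF]; split_ifs
        · exact min_le_right _ _
        · exact le_rfl
      have hFy : F (y l) < 0 := by linarith
      have hrep : Rep (fun j => (y l j : ℝ) - y i j) := by
        by_contra h
        simp only [hF] at hFy
        rw [if_neg h] at hFy
        exact lt_irrefl _ hFy
      have hFy2 : F (y l) = min (g (fun j => (y l j : ℝ) - y i j)) 0 := by
        simp only [hF]; rw [if_pos hrep]
      have hgl : g (fun j => (y l j : ℝ) - y i j) < 0 := by
        rw [hFy2] at hFy
        rcases min_lt_iff.1 hFy with h | h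
        · exact h
        · exact absurd h (lt_irrefl _)
      rw [min_eq_left hgl.le] at hFy2
      have hrep' : Rep (fun j => (y' l j : ℝ) - y i j) := by
        have := hRadd _ _ (hR l hl) hrep
        have e : ((fun j => (y' l j : ℝ) - y l j) + fun j => (y l j : ℝ) - y i j)
          = fun j => (y' l j : ℝ) - y i j := by ext j; simp
        rwa [e] at this
      have hFy' : F (y' l) ≤ g (fun j => (y' l j : ℝ) - y i j) := by
        simp only [hF]; rw [if_pos hrep']; exact min_le_left _ _
      have hgadd : g (fun j => (y' l j : ℝ) - y i j) = G l + g (fun j => (y l j : ℝ) - y i j) := by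
        simp only [hG]
        rw [← map_add]
        congr 1
        ext j; simp
      have hle : F (y' l) - F (y l) ≤ max (G l) 0 := by
        refine le_trans ?_ (le_max_left _ _)
        linarith
      have hrepn : Rep (fun j => (y i j : ℝ) - y l j) := by
        have := hRneg _ hrep
        have e : (-fun j => (y l j : ℝ) - y i j) = fun j => (y i j : ℝ) - y l j := by ext j; simp
        rwa [e] at this
      have hgn : 0 < g (fun j => (y i j : ℝ) - y l j) := by
        have e : (fun j => (y i j : ℝ) - y l j) = (-fun j => (y l j : ℝ) - y i j) := by ext j; simp
        rw [e, map_neg]; linarith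
      have hmm := hP i hi l hl hrepn hgn
      exact mul_le_mul hmm hle hpos.le (mul_nonneg hκ0 hml.le)
    have hKi := hK i
    -- sum
    have h1 : m i * (KK y k xb i * (-G i)) ≤ ∑ l ∈ R, KK y k xb l * (κ * m l * max (G l) 0) := by
      have e1 : KK y k xb i * (-G i) = ∑ l ∈ R.erase i, KK y k xb l * (F (y' l) - F (y l)) := by
        linarith
      rw [e1, Finset.mul_sum]
      calc _ ≤ ∑ l ∈ R.erase i, KK y k xb l * (κ * m l * max (G l) 0) := by
            apply Finset.sum_le_sum
            intro l hl
            have := mul_le_mul_of_nonneg_left (hpt l (Finset.mem_of_mem_erase hl)) (hK l).le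
            linarith
        _ ≤ _ := by
            apply Finset.sum_le_sum_of_subset_of_nonneg (Finset.erase_subset _ _)
            intro l hl _
            exact mul_nonneg (hK l).le (mul_nonneg (mul_nonneg hκ0 (hm l hl).le) (le_max_right _ _))
    have h2 : (R.card : ℝ) * ∑ l ∈ R, KK y k xb l * (κ * m l * max (G l) 0)
        ≤ ε * KK y k xb i * P := by
      rw [hPdef, Finset.mul_sum, Finset.mul_sum]
      apply Finset.sum_le_sum
      intro l hl
      have b1 := hκ i hi l hl
      have b2 := (hrt l hl).1
      have b3 : 0 ≤ m l * max (G l) 0 := mul_nonneg (hm l hl).le (le_max_right _ _)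
      have b4 := mul_le_mul_of_nonneg_right b1 b3
      have b5 : 0 ≤ ε * KK y k xb i * max (G l) 0 :=
        mul_nonneg (mul_nonneg hε.le hKi.le) (le_max_right _ _)
      have b6 := mul_le_mul_of_nonneg_left b2 b5
      nlinarith
    have h3 : rt i * (-G i) ≤ ε⁻¹ * m i * (-G i) :=
      mul_le_mul_of_nonneg_right (hrt i hi).2 (by linarith)
    have hcard : (0:ℝ) ≤ R.card := Nat.cast_nonneg _
    have h4 := mul_le_mul_of_nonneg_right h3 hcard
    have h5 := mul_le_mul_of_nonneg_left h1 hcard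
    have h6 : KK y k xb i * (m i * (-G i) * (R.card : ℝ)) ≤ KK y k xb i * (ε * P) := by nlinarith
    have h7 := le_of_mul_le_mul_left h6 hKi
    have h8 := mul_le_mul_of_nonneg_left h7 (inv_pos.2 hε).le
    have h9 : ε⁻¹ * (ε * P) = P := by field_simp
    rw [h9] at h8
    nlinarith
  have hsplit : ∑ i ∈ R, rt i * G i = P - ∑ i ∈ R, rt i * max (-G i) 0 := by
    rw [hPdef, ← Finset.sum_sub_distrib]
    refine Finset.sum_congr rfl fun i _ => ?_
    rcases le_or_gt 0 (G i) with h | h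
    · rw [max_eq_left h, max_eq_right (by linarith)]; ring
    · rw [max_eq_right h.le, max_eq_left (by linarith)]; ring
  rw [hsplit]
  rcases R.eq_empty_or_nonempty with hRe | hRn
  · simp [hPdef, hRe]
  have hcard : (0:ℝ) < R.card := by exact_mod_cast hRn.card_pos
  have : ∑ i ∈ R, rt i * max (-G i) 0 ≤ ∑ i ∈ R, P / R.card :=
    Finset.sum_le_sum fun i hi => by rw [le_div_iff₀ hcard]; exact key i hi
  rw [Finset.sum_const, nsmul_eq_mul, mul_div_cancel₀ _ hcard.ne'] at this
  linarith


lemma half_bd {n : ℕ} (U : Finset (Fin n)) (A B : Fin n → ℝ) (hA : ∀ j ∈ U, 0 ≤ A j)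
    (hB : ∀ j ∈ U, 0 ≤ B j) (hAB : ∀ j ∈ U, 0 < A j + B j) (c0 c1 : ℝ) (hc0 : 0 < c0)
    (hc1 : 0 < c1) :
    ∃ C, 0 ≤ C ∧ ∀ ρ, 0 < ρ → ∀ u1 u2, 0 < u2 → u2 ≤ u1 → c0 * ρ ≤ u1 → u1 ≤ c1 * ρ →
      ∀ δ1 δ2 : ℝ, (-Real.log ρ) * ((∑ j ∈ U, A j) * δ1 + (∑ j ∈ U, B j) * δ2)
        + (∑ j ∈ U.filter (fun j => A j = 0), B j) * δ2 * Real.log (ρ / u2)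
        - C * (|δ1| + |δ2|) ≤ -∑ j ∈ U, (A j * δ1 + B j * δ2) * Real.log (A j * u1 + B j * u2) := by
  classical
  set c : Fin n → ℝ := fun j => |Real.log (A j * c0)| + |Real.log ((A j + B j) * c1)|
    + |Real.log (B j)| with hc
  refine ⟨∑ j ∈ U, (A j + B j) * c j, Finset.sum_nonneg fun j hj =>
    mul_nonneg (hAB j hj).le (by positivity), ?_⟩
  intro ρ hρ u1 u2 hu2 hu21 h0 h1 δ1 δ2
  have hu1 : 0 < u1 := hu2.trans_le hu21
  rw [Finset.sum_filter, Finset.sum_mul, Finset.sum_mul, Finset.sum_mul, Finset.sum_mul,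
    Finset.sum_mul, ← Finset.sum_add_distrib, Finset.mul_sum, ← Finset.sum_add_distrib,
    ← Finset.sum_sub_distrib, ← Finset.sum_neg_distrib]
  apply Finset.sum_le_sum
  intro j hj
  have hAj := hA j hj
  have hBj := hB j hj
  have hABj := hAB j hj
  have hδ : |A j * δ1 + B j * δ2| ≤ (A j + B j) * (|δ1| + |δ2|) := by
    refine (abs_add_le _ _).trans ?_
    rw [abs_mul, abs_mul, abs_of_nonneg hAj, abs_of_nonneg hBj]
    nlinarith [abs_nonneg δ1, abs_nonneg δ2]
  have fin : ∀ e, |e| ≤ c j → -((A j * δ1 + B j * δ2) * e) ≥ -((A j + B j) * c j * (|δ1| + |δ2|)) := by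
    intro e he
    have : |(A j * δ1 + B j * δ2) * e| ≤ (A j + B j) * (|δ1| + |δ2|) * c j := by
      rw [abs_mul]
      exact mul_le_mul hδ he (abs_nonneg _) (by positivity)
    have := (abs_le.1 this).2
    linarith
  have ab1 := abs_nonneg (Real.log (A j * c0))
  have ab2 := abs_nonneg (Real.log ((A j + B j) * c1))
  have ab3 := abs_nonneg (Real.log (B j))
  split_ifs with hz
  · have hBp : 0 < B j := by linarith
    have e1 : Real.log (A j * u1 + B j * u2) = Real.log (B j) + Real.log ρ - Real.log (ρ / u2) := by
      rw [hz, zero_mul, zero_add, Real.log_mul hBp.ne' hu2.ne', Real.log_div hρ.ne' hu2.ne']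
      ring
    have := fin (Real.log (B j)) (by simp only [hc]; linarith)
    rw [e1, hz] at *
    nlinarith
  · have hAp : 0 < A j := lt_of_le_of_ne hAj (Ne.symm hz)
    set e := Real.log (A j * u1 + B j * u2) - Real.log ρ with he
    have hYp : 0 < A j * u1 + B j * u2 := by positivity
    have l1 : Real.log (A j * c0) ≤ e := by
      have : Real.log (A j * c0 * ρ) ≤ Real.log (A j * u1 + B j * u2) := by
        apply Real.log_le_log (by positivity)
        nlinarith [mul_nonneg hBj hu2.le]
      rw [Real.log_mul (by positivity) hρ.ne'] at this
      linarith
    have l2 : e ≤ Real.log ((A j + B j) * c1) := by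
      have : Real.log (A j * u1 + B j * u2) ≤ Real.log ((A j + B j) * c1 * ρ) := by
        apply Real.log_le_log hYp
        nlinarith
      rw [Real.log_mul (by positivity) hρ.ne'] at this
      linarith
    have hee : |e| ≤ c j := by
      rw [abs_le]
      simp only [hc]
      constructor
      · linarith [neg_abs_le (Real.log (A j * c0))]
      · linarith [le_abs_self (Real.log ((A j + B j) * c1))]
    have := fin e hee
    have e2 : Real.log (A j * u1 + B j * u2) = e + Real.log ρ := by simp [he]
    rw [e2]
    nlinarith

lemma half_concl {n : ℕ} (U : Finset (Fin n)) (A B : Fin n → ℝ) (hA : ∀ j ∈ U, 0 ≤ A j)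
    (hB : ∀ j ∈ U, 0 ≤ B j) (hAB : ∀ j ∈ U, 0 < A j + B j) (c0 c1 : ℝ) (hc0 : 0 < c0)
    (hc1 : 0 < c1) (p1 p2 q1 q2 : ℝ) (hp1 : p1 = ∑ j ∈ U, A j) (hp2 : p2 = ∑ j ∈ U, B j)
    (hq2 : q2 = ∑ j ∈ U.filter (fun j => A j = 0), B j) (hq1 : 0 ≤ q1)
    (Δ : Finset (ℝ × ℝ)) (η : ℝ) (hη : 0 < η) (s : ℝ → ℝ)
    (hs0 : ∀ ξ, ξ < η → s ξ = 0)
    (hs : ∀ d ∈ Δ, ∀ ξ, -η ≤ ξ → 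
      ((-(p1 * d.1 + p2 * d.2) / d.2) < s ξ → (-(p1 * d.1 + p2 * d.2) / d.2) + η ≤ ξ) ∧
      (s ξ < (-(p1 * d.1 + p2 * d.2) / d.2) → ξ ≤ (-(p1 * d.1 + p2 * d.2) / d.2) - η)) (C0 : ℝ) :
    ∃ ρ0, 0 < ρ0 ∧ ρ0 < 1 ∧ ∀ ρ, 0 < ρ → ρ < ρ0 → ∀ u1 u2, 0 < u2 → u2 ≤ u1 →
      c0 * ρ ≤ u1 → u1 ≤ c1 * ρ →
      s (q1 * Real.log (ρ / u1) / (-Real.log ρ)) = 0 ∧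
      ∀ d ∈ Δ, 0 < p1 * d.1 + (p2 + s (q2 * Real.log (ρ / u2) / (-Real.log ρ))) * d.2 →
        C0 ≤ -∑ j ∈ U, (A j * d.1 + B j * d.2) * Real.log (A j * u1 + B j * u2) := by
  classical
  obtain ⟨C, hC, hbd⟩ := half_bd U A B hA hB hAB c0 c1 hc0 hc1
  have hq20 : 0 ≤ q2 := by
    rw [hq2]; exact Finset.sum_nonneg fun j hj => hB j (Finset.mem_filter.1 hj).1
  -- gap
  obtain ⟨ω, hω, hgap⟩ := finset_pos_lb (Δ.filter (fun d => d.2 ≠ 0 ∨ 0 < p1 * d.1))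
    (fun d => if d.2 = 0 then p1 * d.1 else η * |d.2|) (by
      intro d hd
      obtain ⟨-, h⟩ := Finset.mem_filter.1 hd
      split_ifs with hz
      · rcases h with h | h
        · exact absurd hz h
        · exact h
      · exact mul_pos hη (abs_pos.2 hz))
  obtain ⟨D, hD, hDb⟩ := finset_ub Δ (fun d => |d.1| + |d.2|)
  set L0 : ℝ := 1 + q1 * |Real.log c0| / η + q2 * |Real.log c1| / η + (|C0| + C * D) / ω with hL0
  have t1 : 0 ≤ q1 * |Real.log c0| / η := by positivity
  have t2 : 0 ≤ q2 * |Real.log c1| / η := by positivity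
  have t3 : 0 ≤ (|C0| + C * D) / ω := by positivity
  refine ⟨Real.exp (-L0), Real.exp_pos _, by rw [Real.exp_lt_one_iff]; linarith, ?_⟩
  intro ρ hρ hρ0 u1 u2 hu2 hu21 h0 h1
  have hu1 : 0 < u1 := hu2.trans_le hu21
  set L := -Real.log ρ with hL
  have hLL : L0 < L := by
    have := Real.log_lt_log hρ hρ0
    rw [Real.log_exp] at this
    linarith
  have hLp : 0 < L := by linarith
  constructor
  · apply hs0
    have h2 : Real.log (ρ / u1) ≤ |Real.log c0| := by
      have : Real.log (ρ / u1) ≤ Real.log (1 / c0) := by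
        apply Real.log_le_log (by positivity)
        rw [div_le_div_iff₀ hu1 hc0]; linarith
      rw [one_div, Real.log_inv] at this
      linarith [neg_abs_le (Real.log c0)]
    rw [div_lt_iff₀ hLp]
    have h3 := mul_le_mul_of_nonneg_left h2 hq1
    have h4 : q1 * |Real.log c0| / η < L := by linarith
    rw [div_lt_iff₀ hη] at h4
    linarith
  · intro d hd hg
    set ξ := q2 * Real.log (ρ / u2) / L with hξ
    have hξη : -η ≤ ξ := by
      have h2 : -|Real.log c1| ≤ Real.log (ρ / u2) := by
        have : Real.log (1 / c1) ≤ Real.log (ρ / u2) := by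
          apply Real.log_le_log (by positivity)
          rw [div_le_div_iff₀ hc1 hu2]; linarith
        rw [one_div, Real.log_inv] at this
        linarith [le_abs_self (Real.log c1)]
      rw [hξ, le_div_iff₀ hLp]
      have h3 := mul_le_mul_of_nonneg_left h2 hq20
      have h4 : q2 * |Real.log c1| / η < L := by linarith
      rw [div_lt_iff₀ hη] at h4
      linarith
    have hcrit := hs d hd ξ hξη
    have hexp : ω ≤ p1 * d.1 + (p2 + ξ) * d.2 := by
      rcases lt_trichotomy d.2 0 with h | h | h
      · have hgd := hgap d (Finset.mem_filter.2 ⟨hd, Or.inl h.ne⟩)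
        simp only [h.ne, if_false, abs_of_neg h] at hgd
        have : s ξ < -(p1 * d.1 + p2 * d.2) / d.2 := by
          rw [lt_div_iff_of_neg h]; linarith
        have h5 := hcrit.2 this
        have e : -(p1 * d.1 + p2 * d.2) / d.2 * d.2 = -(p1 * d.1 + p2 * d.2) := by
          exact div_mul_cancel₀ _ h.ne
        nlinarith
      · have hgd := hgap d (Finset.mem_filter.2 ⟨hd, Or.inr (by rw [h] at hg; linarith)⟩)
        simp only [h, if_true] at hgd
        rw [h]; linarith
      · have hgd := hgap d (Finset.mem_filter.2 ⟨hd, Or.inl h.ne'⟩)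
        simp only [h.ne', if_false, abs_of_pos h] at hgd
        have : -(p1 * d.1 + p2 * d.2) / d.2 < s ξ := by
          rw [div_lt_iff₀ h]; linarith
        have h5 := hcrit.1 this
        have e : -(p1 * d.1 + p2 * d.2) / d.2 * d.2 = -(p1 * d.1 + p2 * d.2) := by
          exact div_mul_cancel₀ _ h.ne'
        nlinarith
    have hmain := hbd ρ hρ u1 u2 hu2 hu21 h0 h1 d.1 d.2
    rw [← hp1, ← hp2, ← hq2, ← hL] at hmain
    have e1 : L * (p1 * d.1 + p2 * d.2) + q2 * d.2 * Real.log (ρ / u2)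
        = L * (p1 * d.1 + (p2 + ξ) * d.2) := by
      rw [hξ]; field_simp; ring
    rw [e1] at hmain
    have h6 := mul_le_mul_of_nonneg_left hexp hLp.le
    have h7 : (|C0| + C * D) / ω < L := by linarith
    rw [div_lt_iff₀ hω] at h7
    have h8 := mul_le_mul_of_nonneg_left (hDb d hd) hC
    have h9 := le_abs_self C0
    linarith


lemma barrier {n r : ℕ} {y y' : Fin r → Fin n → ℕ} {k : Fin r → ℝ} {R : Finset (Fin r)}
    {xb : Fin n → ℝ} (hk : ∀ i, 0 < k i) (hxb : ∀ j, 0 < xb j)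
    (hcb : ∀ η : Fin n → ℕ, ∑ i ∈ R.filter (fun i => y i = η), k i * mono xb (y i)
      = ∑ i ∈ R.filter (fun i => y' i = η), k i * mono xb (y i))
    (U : Finset (Fin n)) (A B : Fin n → ℝ) (hA : ∀ j ∈ U, 0 ≤ A j)
    (hB : ∀ j ∈ U, 0 ≤ B j) (hAB : ∀ j ∈ U, 0 < A j + B j) (j1 j2 : Fin n)
    (hA1 : ∃ j ∈ U, 0 < A j) (hB1 : ∃ j ∈ U, 0 < B j)
    (hrep : ∀ i ∈ R, ∀ j ∈ U, (y' i j : ℝ) - y i j = A j * ((y' i j1 : ℝ) - y i j1)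
      + B j * ((y' i j2 : ℝ) - y i j2)) (ε : ℝ) (hε : 0 < ε) :
    ∃ ρ0 C, 0 < ρ0 ∧ 1 ≤ C ∧ ∀ ρ, 0 < ρ → ρ < ρ0 → ∀ t1 T, t1 ≤ T →
      ∀ (Y : Fin n → ℝ → ℝ) (rt : Fin r → ℝ → ℝ), (∀ j, Continuous (Y j)) →
      (∀ t ∈ Set.Icc t1 T, 0 < Y j1 t ∧ 0 < Y j2 t) →
      (∀ t ∈ Set.Icc t1 T, ∀ j ∈ U, Y j t = A j * Y j1 t + B j * Y j2 t) →
      (∀ t ∈ Set.Ioo t1 T, HasDerivAt (Y j1) (∑ i ∈ R, rt i t * ((y' i j1 : ℝ) - y i j1)) t) →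
      (∀ t ∈ Set.Ioo t1 T, HasDerivAt (Y j2) (∑ i ∈ R, rt i t * ((y' i j2 : ℝ) - y i j2)) t) →
      (∀ t ∈ Set.Ioo t1 T, ∀ i ∈ R, ε * (∏ j ∈ U, Y j t ^ y i j) ≤ rt i t ∧
        rt i t ≤ ε⁻¹ * ∏ j ∈ U, Y j t ^ y i j) →
      C * ρ ≤ Y j1 t1 + Y j2 t1 → ρ ≤ C * (Y j1 T + Y j2 T) := by
  classical
  set p1 := ∑ j ∈ U, A j with hp1
  set p2 := ∑ j ∈ U, B j with hp2
  set q1 := ∑ j ∈ U.filter (fun j => B j = 0), A j with hq1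
  set q2 := ∑ j ∈ U.filter (fun j => A j = 0), B j with hq2
  have hp1p : 0 < p1 := by
    obtain ⟨j, hj, h⟩ := hA1
    exact Finset.sum_pos' hA ⟨j, hj, h⟩
  have hp2p : 0 < p2 := by
    obtain ⟨j, hj, h⟩ := hB1
    exact Finset.sum_pos' hB ⟨j, hj, h⟩
  have hq10 : 0 ≤ q1 := Finset.sum_nonneg fun j hj => hA j (Finset.mem_filter.1 hj).1
  have hq20 : 0 ≤ q2 := Finset.sum_nonneg fun j hj => hB j (Finset.mem_filter.1 hj).1
  have hK : ∀ i, 0 < KK y k xb i := fun i => mul_pos (hk i) (mono_pos' hxb _)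
  -- κ
  obtain ⟨Km, hKm, hKm'⟩ := finset_pos_lb R (fun i => KK y k xb i) (fun i _ => hK i)
  obtain ⟨Kx, hKx, hKx'⟩ := finset_ub R (fun i => KK y k xb i)
  set κ : ℝ := ε ^ 2 * Km / (Kx * R.card + 1) with hκ
  have hden : 0 < Kx * (R.card : ℝ) + 1 := by positivity
  have hκp : 0 < κ := by positivity
  have hκb : ∀ i ∈ R, ∀ l ∈ R, κ * KK y k xb l * (R.card : ℝ) ≤ ε ^ 2 * KK y k xb i := by
    intro i hi l hl
    have h1 := hKm' i hi
    have h2 := hKx' l hl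
    have e : κ * (Kx * (R.card : ℝ) + 1) = ε ^ 2 * Km := by
      rw [hκ]; field_simp
    have hc : (0:ℝ) ≤ R.card := Nat.cast_nonneg _
    have h3 : κ * KK y k xb l * (R.card : ℝ) ≤ κ * Kx * (R.card : ℝ) :=
      mul_le_mul_of_nonneg_right (mul_le_mul_of_nonneg_left h2 hκp.le) hc
    have h4 : ε ^ 2 * Km ≤ ε ^ 2 * KK y k xb i := mul_le_mul_of_nonneg_left h1 (by positivity)
    nlinarith
  set Δ : Finset (ℝ × ℝ) := (R ×ˢ R).image
    (fun ab => (((y ab.1 j1 : ℝ) - y ab.2 j1), ((y ab.1 j2 : ℝ) - y ab.2 j2))) with hΔ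
  set Δ' : Finset (ℝ × ℝ) := Δ.image Prod.swap with hΔ'
  obtain ⟨m, η, s, hm, hη, hsc, hs0, hsm, hsz, hcrit⟩ := snap
    (Δ.image (fun d => -(p1 * d.1 + p2 * d.2) / d.2) ∪
      Δ'.image (fun d => -(p2 * d.1 + p1 * d.2) / d.2))
  set Pm := min p1 p2 with hPm
  have hPmp : 0 < Pm := lt_min hp1p hp2p
  set Px := p1 + p2 + 2 * m with hPx
  have hPxp : 0 < Px := by positivity
  have hc0 : 0 < 1 / (2 * Px) := by positivity
  have hc1 : 0 < 1 / Pm := by positivity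
  obtain ⟨ρa, hρa, hρa1, hha⟩ := half_concl U A B hA hB hAB (1 / (2 * Px)) (1 / Pm) hc0 hc1
    p1 p2 q1 q2 rfl rfl rfl hq10 Δ η hη s hsz (fun d hd => hcrit _ (Finset.mem_union_left _
      (Finset.mem_image_of_mem (fun d : ℝ × ℝ => -(p1 * d.1 + p2 * d.2) / d.2) hd)))
    (-Real.log κ)
  obtain ⟨ρb, hρb, hρb1, hhb⟩ := half_concl U B A hB hA (fun j hj => by
      have := hAB j hj; linarith) (1 / (2 * Px)) (1 / Pm) hc0 hc1
    p2 p1 q2 q1 rfl rfl rfl hq20 Δ' η hη s hsz (fun d hd => hcrit _ (Finset.mem_union_right _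
      (Finset.mem_image_of_mem (fun d : ℝ × ℝ => -(p2 * d.1 + p1 * d.2) / d.2) hd)))
    (-Real.log κ)
  set C := max 1 (max (2 / Pm) Px) with hC
  have hC1 : 1 ≤ C := le_max_left _ _
  have hC2 : 2 / Pm ≤ C := (le_max_left _ _).trans (le_max_right _ _)
  have hC3 : Px ≤ C := (le_max_right _ _).trans (le_max_right _ _)
  refine ⟨min ρa ρb, C, lt_min hρa hρb, hC1, ?_⟩
  intro ρ hρ hρ0 t1 T htT Y rt hYc hYp hYr hd1 hd2 hrt hstart
  have hρ1 := hρ0.trans_le (min_le_left _ _)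
  have hρ2 := hρ0.trans_le (min_le_right _ _)
  obtain ⟨v0, hv0, hv⟩ : ∃ v0, 0 < v0 ∧ ∀ t ∈ Set.Icc t1 T, v0 ≤ Y j1 t ∧ v0 ≤ Y j2 t := by
    obtain ⟨t0, ht0, hmin⟩ := isCompact_Icc.exists_isMinOn (Set.nonempty_Icc.2 htT)
      (f := fun t => min (Y j1 t) (Y j2 t)) ((hYc j1).min (hYc j2)).continuousOn
    refine ⟨min (Y j1 t0) (Y j2 t0), lt_min (hYp t0 ht0).1 (hYp t0 ht0).2, fun t ht => ?_⟩
    have := hmin ht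
    simp only [Set.mem_setOf_eq] at this
    exact ⟨this.trans (min_le_left _ _), this.trans (min_le_right _ _)⟩
  set L := -Real.log ρ with hL
  set G : ℝ → ℝ → ℝ := fun q v => s (q * Real.log (ρ / max v v0) / L) with hG
  have hmaxp : ∀ v, 0 < max v v0 := fun v => hv0.trans_le (le_max_right _ _)
  have hGc : ∀ q, Continuous (G q) := by
    intro q
    apply hsc.comp
    apply Continuous.div_const
    apply Continuous.mul continuous_const
    apply Continuous.log
    · exact continuous_const.div (continuous_id.max continuous_const) fun v => (hmaxp v).ne'
    · intro v; exact (div_pos hρ (hmaxp v)).ne'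
  set H : ℝ → ℝ → ℝ := fun q u => ∫ v in (0:ℝ)..u, G q v with hH
  have hHd : ∀ q u, HasDerivAt (H q) (G q u) u := fun q u => hasDerivAt_int (hGc q) 0 u
  have hHc : ∀ q, Continuous (H q) := fun q =>
    continuous_iff_continuousAt.2 fun u => (hHd q u).continuousAt
  have hH0 : ∀ q u, 0 ≤ u → 0 ≤ H q u := fun q u hu =>
    intervalIntegral.integral_nonneg hu fun v _ => hs0 _
  have hHm : ∀ q u, 0 ≤ u → H q u ≤ m * u := by
    intro q u hu
    have : H q u ≤ ∫ v in (0:ℝ)..u, m := by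
      apply intervalIntegral.integral_mono_on hu ((hGc q).intervalIntegrable _ _)
        (continuous_const.intervalIntegrable _ _)
      intro v _
      exact hsm _
    simp only [intervalIntegral.integral_const, smul_eq_mul, sub_zero] at this
    linarith
  set ψ : ℝ → ℝ := fun t => p1 * Y j1 t + p2 * Y j2 t + H q1 (Y j1 t) + H q2 (Y j2 t) with hψ
  have hψlow : ∀ t ∈ Set.Icc t1 T, Pm * max (Y j1 t) (Y j2 t) ≤ ψ t := by
    intro t ht
    obtain ⟨a, b⟩ := hYp t ht
    have h1 := hH0 q1 _ a.le
    have h2 := hH0 q2 _ b.le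
    have h3 : Pm * Y j1 t ≤ p1 * Y j1 t := mul_le_mul_of_nonneg_right (min_le_left _ _) a.le
    have h4 : Pm * Y j2 t ≤ p2 * Y j2 t := mul_le_mul_of_nonneg_right (min_le_right _ _) b.le
    have h5 := mul_pos hp1p a
    have h6 := mul_pos hp2p b
    simp only [hψ]
    rcases max_choice (Y j1 t) (Y j2 t) with h | h <;> rw [h] <;> linarith
  have hψup : ∀ t ∈ Set.Icc t1 T, ψ t ≤ Px * max (Y j1 t) (Y j2 t) := by
    intro t ht
    obtain ⟨a, b⟩ := hYp t ht
    have h1 := hHm q1 _ a.le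
    have h2 := hHm q2 _ b.le
    have h3 := le_max_left (Y j1 t) (Y j2 t)
    have h4 := le_max_right (Y j1 t) (Y j2 t)
    simp only [hψ, hPx]
    nlinarith
  have hstart' : ρ ≤ ψ t1 := by
    have h1 := hψlow t1 (Set.left_mem_Icc.2 htT)
    have h2 : Y j1 t1 + Y j2 t1 ≤ 2 * max (Y j1 t1) (Y j2 t1) := by
      linarith [le_max_left (Y j1 t1) (Y j2 t1), le_max_right (Y j1 t1) (Y j2 t1)]
    have h3 : 2 / Pm * ρ ≤ 2 * max (Y j1 t1) (Y j2 t1) :=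
      (mul_le_mul_of_nonneg_right hC2 hρ.le).trans (hstart.trans h2)
    rw [div_mul_eq_mul_div, div_le_iff₀ hPmp] at h3
    linarith
  have hend : ρ ≤ ψ T := by
    refine barrier_exit (f := ψ) (f' := fun t =>
      p1 * (∑ i ∈ R, rt i t * ((y' i j1 : ℝ) - y i j1))
      + p2 * (∑ i ∈ R, rt i t * ((y' i j2 : ℝ) - y i j2))
      + G q1 (Y j1 t) * (∑ i ∈ R, rt i t * ((y' i j1 : ℝ) - y i j1))
      + G q2 (Y j2 t) * (∑ i ∈ R, rt i t * ((y' i j2 : ℝ) - y i j2))) hρ htT ?_ ?_ ?_ hstart'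
    · exact (((continuous_const.mul (hYc j1)).add (continuous_const.mul (hYc j2))).add
        ((hHc q1).comp (hYc j1))).add ((hHc q2).comp (hYc j2))
    · intro t ht
      have a := hd1 t ht
      have b := hd2 t ht
      exact (((a.const_mul p1).add (b.const_mul p2)).add ((hHd q1 _).comp t a)).add
        ((hHd q2 _).comp t b)
    · intro t ht hlo hhi
      have htI : t ∈ Set.Icc t1 T := ⟨ht.1.le, ht.2.le⟩
      obtain ⟨hu1, hu2⟩ := hYp t htI
      obtain ⟨hvu1, hvu2⟩ := hv t htI
      have hUp : ∀ j ∈ U, 0 < Y j t := by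
        intro j hj
        rw [hYr t htI j hj]
        have a := hA j hj; have b := hB j hj; have ab := hAB j hj
        rcases a.lt_or_eq with a' | a'
        · have := mul_pos a' hu1; have := mul_nonneg b hu2.le; linarith
        · have b' : 0 < B j := by linarith
          have := mul_nonneg a hu1.le; have := mul_pos b' hu2; linarith
      set g1 := p1 + G q1 (Y j1 t) with hg1
      set g2 := p2 + G q2 (Y j2 t) with hg2
      set g : (Fin n → ℝ) →ₗ[ℝ] ℝ := g1 • LinearMap.proj j1 + g2 • LinearMap.proj j2 with hg
      have hgv : ∀ v : Fin n → ℝ, g v = g1 * v j1 + g2 * v j2 := fun v => by simp [hg]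
      have hmx1 : 1 / (2 * Px) * ρ ≤ max (Y j1 t) (Y j2 t) := by
        have := hψup t htI
        rw [one_div_mul_eq_div, div_le_iff₀ (by positivity)]
        linarith
      have hmx2 : max (Y j1 t) (Y j2 t) ≤ 1 / Pm * ρ := by
        have := hψlow t htI
        rw [one_div_mul_eq_div, le_div_iff₀ hPmp]
        linarith
      have hG1 : G q1 (Y j1 t) = s (q1 * Real.log (ρ / Y j1 t) / L) := by
        simp only [hG]; rw [max_eq_left hvu1]
      have hG2 : G q2 (Y j2 t) = s (q2 * Real.log (ρ / Y j2 t) / L) := by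
        simp only [hG]; rw [max_eq_left hvu2]
      have hkey : ∀ a ∈ R, ∀ b ∈ R, 0 < g (fun j => (y a j : ℝ) - y b j) →
          -Real.log κ ≤ -∑ j ∈ U, (A j * ((y a j1 : ℝ) - y b j1) + B j * ((y a j2 : ℝ) - y b j2))
            * Real.log (A j * Y j1 t + B j * Y j2 t) := by
        intro a ha b hb hpos
        rw [hgv] at hpos
        have hdm : (((y a j1 : ℝ) - y b j1), ((y a j2 : ℝ) - y b j2)) ∈ Δ :=
          Finset.mem_image.2 ⟨(a, b), Finset.mem_product.2 ⟨ha, hb⟩, rfl⟩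
        rcases le_total (Y j2 t) (Y j1 t) with hle | hle
        · rw [max_eq_left hle] at hmx1 hmx2
          obtain ⟨z, hz⟩ := hha ρ hρ hρ1 _ _ hu2 hle hmx1 hmx2
          refine hz _ hdm ?_
          rw [hg1, hg2, hG1, hG2, z, add_zero] at hpos
          exact hpos
        · rw [max_eq_right hle] at hmx1 hmx2
          obtain ⟨z, hz⟩ := hhb ρ hρ hρ2 _ _ hu1 hle hmx1 hmx2
          have := hz _ (Finset.mem_image_of_mem Prod.swap hdm) (by
            rw [hg1, hg2, hG1, hG2, z, add_zero] at hpos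
            simp only [Prod.swap]
            rw [add_comm]
            exact hpos)
          simp only [Prod.swap] at this
          refine this.trans (le_of_eq ?_)
          congr 1
          refine Finset.sum_congr rfl fun j _ => ?_
          rw [add_comm, add_comm (B j * Y j2 t)]
      have hfl := flux_nonneg hk hxb hcb
        (fun δ => ∀ j ∈ U, δ j = A j * δ j1 + B j * δ j2) g
        (fun u v hu hv j hj => by
          have a := hu j hj; have b := hv j hj
          simp only [Pi.add_apply]; rw [a, b]; ring)
        (fun u hu j hj => by
          have a := hu j hj
          simp only [Pi.neg_apply]; rw [a]; ring)
        (fun i hi j hj => hrep i hi j hj)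
        (fun i => ∏ j ∈ U, Y j t ^ y i j) (fun i => rt i t) ε κ hε hκp.le
        (fun i _ => Finset.prod_pos fun j hj => pow_pos (hUp j hj) _)
        (fun i hi => hrt t ht i hi) hκb (by
          intro a ha b hb hrp hpos
          have hkk := hkey a ha b hb hpos
          have pa : 0 < ∏ j ∈ U, Y j t ^ y a j := Finset.prod_pos fun j hj => pow_pos (hUp j hj) _
          have pb : 0 < ∏ j ∈ U, Y j t ^ y b j := Finset.prod_pos fun j hj => pow_pos (hUp j hj) _
          have la : ∀ i, Real.log (∏ j ∈ U, Y j t ^ y i j) = ∑ j ∈ U, (y i j : ℝ) * Real.log (Y j t) := by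
            intro i
            rw [Real.log_prod (fun j hj => (pow_pos (hUp j hj) _).ne')]
            exact Finset.sum_congr rfl fun j _ => Real.log_pow _ _
          rw [← Real.log_le_log_iff pa (mul_pos hκp pb), Real.log_mul hκp.ne' pb.ne', la, la]
          have e : ∑ j ∈ U, (A j * ((y a j1 : ℝ) - y b j1) + B j * ((y a j2 : ℝ) - y b j2))
            * Real.log (A j * Y j1 t + B j * Y j2 t)
            = ∑ j ∈ U, (y a j : ℝ) * Real.log (Y j t) - ∑ j ∈ U, (y b j : ℝ) * Real.log (Y j t) := by
            rw [← Finset.sum_sub_distrib]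
            refine Finset.sum_congr rfl fun j hj => ?_
            have := hrp j hj
            simp only at this
            rw [← this, ← hYr t htI j hj]; ring
          rw [e] at hkk
          linarith)
      refine hfl.trans (le_of_eq ?_)
      simp only [hgv, hg1, hg2]
      simp only [Finset.mul_sum]
      rw [← Finset.sum_add_distrib, ← Finset.sum_add_distrib, ← Finset.sum_add_distrib]
      refine Finset.sum_congr rfl fun i _ => ?_
      ring
  have h1 := hψup T (Set.right_mem_Icc.2 htT)
  obtain ⟨a, b⟩ := hYp T (Set.right_mem_Icc.2 htT)
  have h2 : max (Y j1 T) (Y j2 T) ≤ Y j1 T + Y j2 T := max_le (by linarith) (by linarith)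
  calc ρ ≤ Px * max (Y j1 T) (Y j2 T) := hend.trans h1
    _ ≤ C * (Y j1 T + Y j2 T) := mul_le_mul hC3 h2 (a.le.trans (le_max_left _ _)) (by linarith)


lemma geo {n : ℕ} (V : Submodule ℝ (Fin n → ℝ)) (hV : Module.finrank ℝ V = 2)
    (U : Finset (Fin n)) (hU : U.Nonempty) (P : Fin n → ℝ) (hP : P ∈ V) (hPp : ∀ j ∈ U, 0 < P j) :
    ∃ j1 ∈ U, ∃ j2 ∈ U, ∃ A B : Fin n → ℝ, (∀ j ∈ U, 0 ≤ A j) ∧ (∀ j ∈ U, 0 ≤ B j) ∧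
      (∀ j ∈ U, 0 < A j + B j) ∧ (∃ j ∈ U, 0 < A j) ∧ (∃ j ∈ U, 0 < B j) ∧
      ∀ v ∈ V, ∀ j ∈ U, v j = A j * v j1 + B j * v j2 := by
  by_cases hall : ∀ v ∈ V, ∃ c : ℝ, ∀ j ∈ U, v j = c * P j
  · obtain ⟨j0, hj0⟩ := hU
    have h0 := hPp j0 hj0
    have hpos : ∀ j ∈ U, 0 < P j / (2 * P j0) := fun j hj => div_pos (hPp j hj) (by linarith)
    refine ⟨j0, hj0, j0, hj0, fun j => P j / (2 * P j0), fun j => P j / (2 * P j0),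
      fun j hj => (hpos j hj).le, fun j hj => (hpos j hj).le,
      fun j hj => add_pos (hpos j hj) (hpos j hj), ⟨j0, hj0, hpos j0 hj0⟩,
      ⟨j0, hj0, hpos j0 hj0⟩, ?_⟩
    intro v hv j hj
    obtain ⟨c, hc⟩ := hall v hv
    rw [hc j hj, hc j0 hj0]
    field_simp
    ring
  · push Not at hall
    obtain ⟨Q, hQ, hQn⟩ := hall
    obtain ⟨j1, hj1, hmax⟩ := Finset.exists_max_image U (fun j => Q j / P j) hU
    obtain ⟨j2, hj2, hmin⟩ := Finset.exists_min_image U (fun j => Q j / P j) hU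
    have hlt : Q j2 / P j2 < Q j1 / P j1 := by
      refine lt_of_le_of_ne (hmin j1 hj1) fun h => ?_
      obtain ⟨j, hj, hne⟩ := hQn (Q j1 / P j1)
      apply hne
      have : Q j / P j = Q j1 / P j1 := le_antisymm (hmax j hj) (h ▸ hmin j hj)
      rw [← this, div_mul_cancel₀ _ (hPp j hj).ne']
    set μ := Q j2 / P j2 with hμ
    set ν := Q j1 / P j1 with hν
    have h1 := hPp j1 hj1
    have h2 := hPp j2 hj2
    have hQ1 : Q j1 = ν * P j1 := by rw [hν, div_mul_cancel₀ _ h1.ne']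
    have hQ2 : Q j2 = μ * P j2 := by rw [hμ, div_mul_cancel₀ _ h2.ne']
    have hνμ : 0 < ν - μ := by linarith
    -- span
    have hli : LinearIndependent ℝ ![P, Q] := by
      rw [LinearIndependent.pair_iff]
      intro a b hab
      have e1 := congrFun hab j1
      have e2 := congrFun hab j2
      simp only [Pi.add_apply, Pi.smul_apply, smul_eq_mul, Pi.zero_apply] at e1 e2
      rw [hQ1] at e1
      rw [hQ2] at e2
      have e1' : a + b * ν = 0 := by
        have : (a + b * ν) * P j1 = 0 := by linarith
        exact (mul_eq_zero.1 this).resolve_right h1.ne'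
      have e2' : a + b * μ = 0 := by
        have : (a + b * μ) * P j2 = 0 := by linarith
        exact (mul_eq_zero.1 this).resolve_right h2.ne'
      have hb : b * (ν - μ) = 0 := by linarith
      have hb' := (mul_eq_zero.1 hb).resolve_right hνμ.ne'
      rw [hb'] at e1'
      exact ⟨by linarith, hb'⟩
    have hspan : Submodule.span ℝ (Set.range ![P, Q]) = V := by
      apply Submodule.eq_of_le_of_finrank_eq
      · rw [Submodule.span_le]
        rintro _ ⟨i, rfl⟩
        fin_cases i
        · exact hP
        · exact hQ
      · rw [finrank_span_eq_card hli, hV]; rfl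
    have hrep : ∀ v ∈ V, ∃ a b : ℝ, v = a • P + b • Q := by
      intro v hv
      rw [← hspan] at hv
      simp only [Matrix.range_cons, Matrix.range_empty, Set.union_empty] at hv
      rw [Set.singleton_union, Submodule.mem_span_pair] at hv
      obtain ⟨a, b, h⟩ := hv
      exact ⟨a, b, h.symm⟩
    refine ⟨j1, hj1, j2, hj2, fun j => P j * (Q j / P j - μ) / ((ν - μ) * P j1),
      fun j => P j * (ν - Q j / P j) / ((ν - μ) * P j2), ?_, ?_, ?_, ?_, ?_, ?_⟩
    · intro j hj
      exact div_nonneg (mul_nonneg (hPp j hj).le (by linarith [hmin j hj]))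
        (mul_pos hνμ h1).le
    · intro j hj
      exact div_nonneg (mul_nonneg (hPp j hj).le (by linarith [hmax j hj]))
        (mul_pos hνμ h2).le
    · intro j hj
      have a1 := hmin j hj
      have a2 := hmax j hj
      have b1 : 0 ≤ P j * (Q j / P j - μ) / ((ν - μ) * P j1) :=
        div_nonneg (mul_nonneg (hPp j hj).le (by linarith)) (mul_pos hνμ h1).le
      have b2 : 0 ≤ P j * (ν - Q j / P j) / ((ν - μ) * P j2) :=
        div_nonneg (mul_nonneg (hPp j hj).le (by linarith)) (mul_pos hνμ h2).le
      rcases a1.lt_or_eq with h | h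
      · have : 0 < P j * (Q j / P j - μ) / ((ν - μ) * P j1) :=
          div_pos (mul_pos (hPp j hj) (by linarith)) (mul_pos hνμ h1)
        linarith
      · have : 0 < P j * (ν - Q j / P j) / ((ν - μ) * P j2) :=
          div_pos (mul_pos (hPp j hj) (by linarith)) (mul_pos hνμ h2)
        linarith
    · exact ⟨j1, hj1, div_pos (mul_pos h1 (by linarith)) (mul_pos hνμ h1)⟩
    · exact ⟨j2, hj2, div_pos (mul_pos h2 (by linarith)) (mul_pos hνμ h2)⟩
    · intro v hv j hj
      obtain ⟨a, b, rfl⟩ := hrep v hv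
      simp only [Pi.add_apply, Pi.smul_apply, smul_eq_mul]
      have hPj := hPp j hj
      rw [hQ1, hQ2]
      have hQj : Q j = Q j / P j * P j := by rw [div_mul_cancel₀ _ hPj.ne']
      generalize Q j / P j = σ at *
      rw [hQj]
      have n1 := h1.ne'
      have n2 := h2.ne'
      have n3 := hνμ.ne'
      field_simp
      ring

lemma Ctx.YY_mem {n r : ℕ} {y y' : Fin r → Fin n → ℕ} {k τ : Fin r → ℝ} {τm M : ℝ}
    {x : ℝ → Fin n → ℝ} (H : Ctx y y' k τ τm M x) (R : Finset (Fin r)) (U : Finset (Fin n))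
    (hUR : ∀ j ∈ U, ∀ i, i ∉ R → y i j = 0 ∧ y' i j = 0)
    (tN : ℕ → ℝ) (htN : Tendsto tN atTop atTop)
    (hY0 : ∀ j ∈ U, Tendsto (fun N => YY y k τ x j (tN N)) atTop (nhds 0)) (t : ℝ) (ht : 0 < t) :
    ∃ P ∈ stoichOn y y' R, ∀ j ∈ U, P j = YY y k τ x j t := by
  classical
  set π : (Fin n → ℝ) →ₗ[ℝ] (Fin n → ℝ) :=
    LinearMap.pi fun j => if j ∈ U then LinearMap.proj j else 0 with hπ
  have hπv : ∀ v j, π v j = if j ∈ U then v j else 0 := by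
    intro v j
    simp only [hπ, LinearMap.pi_apply]
    split_ifs <;> simp
  set S := (stoichOn y y' R).map π with hS
  have hcl : IsClosed (S : Set (Fin n → ℝ)) := Submodule.closed_of_finiteDimensional S
  set w : ℕ → Fin n → ℝ := fun N => ∑ i ∈ R, (nn y k τ x i t - nn y k τ x i (tN N)) •
    (fun j => (y' i j : ℝ) - y i j) with hw
  have hwmem : ∀ N, π (w N) ∈ S := fun N => Submodule.mem_map_of_mem
    (Submodule.sum_mem _ fun i hi => Submodule.smul_mem _ _ (Submodule.subset_span ⟨i, hi, rfl⟩))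
  have hlim : Tendsto (fun N => π (w N)) atTop
      (nhds (fun j => if j ∈ U then YY y k τ x j t else 0)) := by
    rw [tendsto_pi_nhds]
    intro j
    by_cases hj : j ∈ U
    · simp only [hπv, hj, if_true]
      have h1 : Tendsto (fun N => YY y k τ x j t - YY y k τ x j (tN N)) atTop
          (nhds (YY y k τ x j t - 0)) := tendsto_const_nhds.sub (hY0 j hj)
      rw [sub_zero] at h1
      refine h1.congr' ?_
      filter_upwards [htN.eventually_ge_atTop t] with N hN
      have h2 := H.YYdiff j ht hN
      have h3 : ∑ i, ((y' i j : ℝ) - y i j) * (nn y k τ x i (tN N) - nn y k τ x i t)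
        = ∑ i ∈ R, ((y' i j : ℝ) - y i j) * (nn y k τ x i (tN N) - nn y k τ x i t) := by
        symm
        apply Finset.sum_subset (Finset.subset_univ _)
        intro i _ hi
        obtain ⟨a, b⟩ := hUR j hj i hi
        rw [a, b]; simp
      rw [h3] at h2
      simp only [hw, Finset.sum_apply, Pi.smul_apply, smul_eq_mul]
      have h4 : ∑ i ∈ R, (nn y k τ x i t - nn y k τ x i (tN N)) * ((y' i j : ℝ) - y i j)
        = - ∑ i ∈ R, ((y' i j : ℝ) - y i j) * (nn y k τ x i (tN N) - nn y k τ x i t) := by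
        rw [← Finset.sum_neg_distrib]
        exact Finset.sum_congr rfl fun i _ => by ring
      rw [h4]; linarith
    · simp only [hπv, hj, if_false]
      exact tendsto_const_nhds
  have hmem := hcl.mem_of_tendsto hlim (Eventually.of_forall hwmem)
  obtain ⟨P, hP, hPe⟩ := hmem
  refine ⟨P, hP, fun j hj => ?_⟩
  have := congrFun hPe j
  rw [hπv] at this
  simpa [hj] using this


lemma mono_scale {n : ℕ} {x z : Fin n → ℝ} {c : ℝ} (hx : ∀ j, 0 ≤ x j)
    (y : Fin n → ℕ) (h : ∀ j, y j ≠ 0 → x j ≤ c * z j) :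
    mono x y ≤ c ^ (∑ l, y l) * mono z y := by
  unfold mono
  rw [← Finset.prod_pow_eq_pow_sum, ← Finset.prod_mul_distrib]
  apply Finset.prod_le_prod (fun j _ => pow_nonneg (hx j) _)
  intro j _
  rw [← mul_pow]
  by_cases hj : y j = 0
  · simp [hj]
  · exact pow_le_pow_left₀ (hx j) (h j hj) _

section
variable {n r : ℕ} {y y' : Fin r → Fin n → ℕ} {k τ : Fin r → ℝ} {τm M : ℝ}
    {x : ℝ → Fin n → ℝ}

lemma Ctx.a_bd (H : Ctx y y' k τ τm M x) (R : Finset (Fin r)) (U : Finset (Fin n))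
    (hUR : ∀ j ∈ U, ∀ i, i ∉ R → y i j = 0 ∧ y' i j = 0)
    (hsemi : ∀ i ∈ R, (∃ j ∈ U, y' i j ≠ 0) → ∃ j ∈ U, y i j ≠ 0) (h0 : ℝ) :
    ∃ C, 1 ≤ C ∧ ∀ s t, τm + 1 ≤ s → s ≤ t → t ≤ s + h0 →
      ∑ j ∈ U, YY y k τ x j t ≤ C * ∑ j ∈ U, YY y k τ x j s := by
  obtain ⟨C, hC, -, hRx, hgr, -, -⟩ := H.basic τm H.hτm0
  set D : ℝ := ∑ j ∈ U, ∑ i, (y' i j : ℝ) * (C * C) with hD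
  have hD0 : 0 ≤ D := Finset.sum_nonneg fun j _ => Finset.sum_nonneg fun i _ => by positivity
  refine ⟨Real.exp (D * |h0|), Real.one_le_exp (by positivity), ?_⟩
  intro s t hs hst hth
  have hτ0 := H.hτm0
  have ha0 : ∀ u, 0 ≤ ∑ j ∈ U, YY y k τ x j u := fun u =>
    Finset.sum_nonneg fun j _ => (H.YYpos j u).le
  have h1 := gr_up (f := fun u => ∑ j ∈ U, YY y k τ x j u) (C := D)
    (f' := fun u => ∑ j ∈ U, ∑ i, Rt y k x i (u - τ i) * ((y' i j : ℝ) - y i j)) hst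
    (continuous_finsetSum _ fun j _ => H.YYcont j).continuousOn
    (fun u hu => HasDerivAt.fun_sum fun j _ => H.YYder (by linarith [hu.1]) j) (by
      intro u hu
      simp only [hD]
      rw [Finset.sum_mul]
      apply Finset.sum_le_sum
      intro j hj
      rw [Finset.sum_mul]
      apply Finset.sum_le_sum
      intro i _
      by_cases hi : y' i j = 0
      · rw [hi]
        have := mul_nonneg (H.Rpos i (u - τ i)).le (Nat.cast_nonneg (y i j) : (0:ℝ) ≤ y i j)
        simp only [Nat.cast_zero, zero_mul]
        linarith
      · have hiR : i ∈ R := by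
          by_contra h
          exact hi (hUR j hj i h).2
        obtain ⟨l, hl, hyl⟩ := hsemi i hiR ⟨j, hj, hi⟩
        have b1 := hRx i (u - τ i) l hyl
        have b2 := hgr l (u - τ i) u (by linarith [hu.1, H.hτm i]) (by linarith [H.hτ i])
          (by linarith [H.hτm i])
        have b3 := H.YYge l u
        have b4 : YY y k τ x l u ≤ ∑ j ∈ U, YY y k τ x j u :=
          Finset.single_le_sum (f := fun j => YY y k τ x j u) (fun j _ => (H.YYpos j u).le) hl
        have b5 : Rt y k x i (u - τ i) ≤ C * C * ∑ j ∈ U, YY y k τ x j u := by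
          calc _ ≤ C * (C * x u l) := b1.trans (mul_le_mul_of_nonneg_left b2 (by linarith))
            _ = C * C * x u l := by ring
            _ ≤ _ := mul_le_mul_of_nonneg_left (b3.trans b4) (by positivity)
        have b6 := mul_le_mul_of_nonneg_left b5 (Nat.cast_nonneg (y' i j) : (0:ℝ) ≤ y' i j)
        have := mul_nonneg (H.Rpos i (u - τ i)).le (Nat.cast_nonneg (y i j) : (0:ℝ) ≤ y i j)
        linarith)
  refine h1.trans (mul_le_mul_of_nonneg_right (Real.exp_le_exp.2 ?_) (ha0 s))
  exact mul_le_mul_of_nonneg_left (by linarith [le_abs_self h0]) hD0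

lemma Ctx.YYgrow (H : Ctx y y' k τ τm M x) (h0 : ℝ) (hh0 : 0 ≤ h0) : ∃ C, 1 ≤ C ∧
    ∀ j s t, τm + 1 ≤ s → s ≤ t → t ≤ s + h0 → YY y k τ x j s ≤ C * YY y k τ x j t := by
  obtain ⟨C, hC, -, -, hgr, hY, -⟩ := H.basic h0 hh0
  refine ⟨C * C, by nlinarith, fun j s t hs hst hth => ?_⟩
  have hτ0 := H.hτm0
  calc _ ≤ C * x s j := hY j s (by linarith)
    _ ≤ C * (C * x t j) := mul_le_mul_of_nonneg_left (hgr j s t (by linarith) hst hth) (by linarith)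
    _ = C * C * x t j := by ring
    _ ≤ _ := mul_le_mul_of_nonneg_left (H.YYge j t) (by positivity)

lemma Ctx.inflow_bd (H : Ctx y y' k τ τm M x) (R : Finset (Fin r)) (U : Finset (Fin n))
    (hUR : ∀ j ∈ U, ∀ i, i ∉ R → y i j = 0 ∧ y' i j = 0)
    (hsemi : ∀ i ∈ R, (∃ j ∈ U, y' i j ≠ 0) → ∃ j ∈ U, y i j ≠ 0)
    (A B : Fin n → ℝ) (hA : ∀ j ∈ U, 0 ≤ A j) (hB : ∀ j ∈ U, 0 ≤ B j) (j1 j2 : Fin n)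
    (hj2 : j2 ∈ U)
    (hrep : ∀ t, 0 < t → ∀ j ∈ U, YY y k τ x j t = A j * YY y k τ x j1 t + B j * YY y k τ x j2 t)
    (m : ℝ) (hm : 0 < m) :
    ∃ C, 1 ≤ C ∧ ∀ e T, τm + 1 ≤ e →
      (∀ t ∈ Set.Icc e T, ∀ i ∈ R, ∀ j, j ∉ U → y i j ≠ 0 → m ≤ x t j) →
      ∀ t, e + 1 + τm ≤ t → t ≤ T → ∀ i ∈ R, y' i j2 ≠ 0 →
        Rt y k x i (t - τ i) ≤ C * YY y k τ x j2 t := by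
  have hτ0 := H.hτm0
  obtain ⟨C, hC, -, hRx, hgr, hYx, hlow⟩ := H.basic (1 + 2 * τm) (by linarith)
  obtain ⟨Ca, hCa, hab⟩ := H.a_bd R U hUR hsemi (1 + 2 * τm)
  obtain ⟨Cy, hCy, hyb⟩ := H.YYgrow (1 + 2 * τm) (by linarith)
  obtain ⟨Bx, hBx, hBx'⟩ := finset_ub U B
  set S := (∑ j ∈ U, A j) + ∑ j ∈ U, B j with hS
  have hS1 : 0 ≤ ∑ j ∈ U, A j := Finset.sum_nonneg hA
  have hS2 : 0 ≤ ∑ j ∈ U, B j := Finset.sum_nonneg hB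
  have hS0 : 0 ≤ S := add_nonneg hS1 hS2
  obtain ⟨α, hα, hα'⟩ := finset_pos_lb (U.filter (fun j => A j ≠ 0)) A (fun j hj =>
    lt_of_le_of_ne (hA j (Finset.mem_filter.1 hj).1) (Ne.symm (Finset.mem_filter.1 hj).2))
  set N : ℕ := ∑ i, ∑ l, y i l with hN
  -- comparison constant
  set c1 : ℝ := 1 + M / m + Ca * (S / α * C) with hc1
  have hM := H.hM
  have hMm : 0 ≤ M / m := by positivity
  have hc1' : 0 ≤ Ca * (S / α * C) := by positivity
  have hc11 : 1 ≤ c1 := by linarith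
  have hcN : 1 ≤ c1 ^ N := one_le_pow₀ hc11
  set D : ℝ := 1 + C * C * Bx + C * C * (Ca * (S * Cy)) + c1 ^ N * Real.exp C with hD
  have d1 : 0 ≤ C * C * Bx := by positivity
  have d2 : 0 ≤ C * C * (Ca * (S * Cy)) := by positivity
  have d3 : 0 ≤ c1 ^ N * Real.exp C := by positivity
  refine ⟨D, by linarith, ?_⟩
  intro e T he hreg t ht htT i hi hyi
  have hYp : ∀ j u, 0 < YY y k τ x j u := fun j u => H.YYpos j u
  set a : ℝ → ℝ := fun u => ∑ j ∈ U, YY y k τ x j u with ha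
  have haj : ∀ j ∈ U, ∀ u, YY y k τ x j u ≤ a u := fun j hj u =>
    Finset.single_le_sum (f := fun j => YY y k τ x j u) (fun j _ => (hYp j u).le) hj
  have hau : ∀ u, 0 < u → a u = (∑ j ∈ U, A j) * YY y k τ x j1 u
      + (∑ j ∈ U, B j) * YY y k τ x j2 u := by
    intro u hu
    simp only [ha]
    rw [Finset.sum_mul, Finset.sum_mul, ← Finset.sum_add_distrib]
    exact Finset.sum_congr rfl fun j hj => hrep u hu j hj
  have hti := H.hτ i
  have hti' := H.hτm i
  have hRj : ∀ j, y i j ≠ 0 → Rt y k x i (t - τ i) ≤ C * C * YY y k τ x j t := by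
    intro j hj
    have b1 := hRx i (t - τ i) j hj
    have b2 := hgr j (t - τ i) t (by linarith) (by linarith) (by linarith)
    calc _ ≤ C * (C * x t j) := b1.trans (mul_le_mul_of_nonneg_left b2 (by linarith))
      _ = C * C * x t j := by ring
      _ ≤ _ := mul_le_mul_of_nonneg_left (H.YYge j t) (by positivity)
  have fin : ∀ d, d ≤ D → Rt y k x i (t - τ i) ≤ d * YY y k τ x j2 t →
      Rt y k x i (t - τ i) ≤ D * YY y k τ x j2 t := fun d hd h =>
    h.trans (mul_le_mul_of_nonneg_right hd (hYp j2 t).le)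
  by_cases hcase1 : ∃ j ∈ U, y i j ≠ 0 ∧ A j = 0
  · obtain ⟨j, hj, hyj, hAj⟩ := hcase1
    apply fin (C * C * Bx) (by linarith)
    have h1 := hRj j hyj
    rw [hrep t (by linarith) j hj, hAj, zero_mul, zero_add] at h1
    refine h1.trans ?_
    rw [mul_assoc (C * C)]
    exact mul_le_mul_of_nonneg_left (mul_le_mul_of_nonneg_right (hBx' j hj) (hYp j2 t).le)
      (by positivity)
  push Not at hcase1
  by_cases hcase2 : ∃ t' ∈ Set.Icc (t - 1 - τm) t, YY y k τ x j1 t' ≤ YY y k τ x j2 t'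
  · obtain ⟨t', ht', hle⟩ := hcase2
    apply fin (C * C * (Ca * (S * Cy))) (by linarith)
    obtain ⟨j, hj, hyj⟩ := hsemi i hi ⟨j2, hj2, hyi⟩
    have h1 := hRj j hyj
    have h2 := haj j hj t
    have h3 := hab t' t (by linarith [ht'.1]) ht'.2 (by linarith [ht'.1])
    have h4 : a t' ≤ S * YY y k τ x j2 t' := by
      rw [hau t' (by linarith [ht'.1]), hS, add_mul]
      have := mul_le_mul_of_nonneg_left hle hS1
      linarith
    have h5 := hyb j2 t' t (by linarith [ht'.1]) ht'.2 (by linarith [ht'.1])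
    calc _ ≤ C * C * YY y k τ x j t := h1
      _ ≤ C * C * (Ca * (S * (Cy * YY y k τ x j2 t))) := by
          apply mul_le_mul_of_nonneg_left _ (by positivity)
          refine h2.trans (h3.trans (mul_le_mul_of_nonneg_left ?_ (by linarith)))
          exact h4.trans (mul_le_mul_of_nonneg_left h5 hS0)
      _ = _ := by ring
  · push Not at hcase2
    apply fin (c1 ^ N * Real.exp C) (by linarith)
    -- comparison of rates
    have hcomp : ∀ s, t - 1 ≤ s → s ≤ t → Rt y k x i (t - τ i) ≤ c1 ^ N * Rt y k x i (s - τ i) := by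
      intro s hs1 hs2
      have h1 : mono (x (t - τ i)) (y i) ≤ c1 ^ (∑ l, y i l) * mono (x (s - τ i)) (y i) := by
        apply mono_scale (fun j => (H.pos _ j).le)
        intro j hj
        have hxp := H.pos (s - τ i) j
        by_cases hjU : j ∈ U
        · have hAj := hα' j (Finset.mem_filter.2 ⟨hjU, hcase1 j hjU hj⟩)
          have hsp : 0 < s - τ i := by linarith
          have e1 := hYx j (s - τ i) (by linarith)
          have e2 := hrep (s - τ i) hsp j hjU
          have e3 := hau (s - τ i) hsp
          have e4 := hcase2 (s - τ i) ⟨by linarith, by linarith⟩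
          have e5 := hab (s - τ i) (t - τ i) (by linarith) (by linarith) (by linarith)
          have e6 := haj j hjU (t - τ i)
          have e7 := H.YYge j (t - τ i)
          have e8 : a (s - τ i) ≤ S * YY y k τ x j1 (s - τ i) := by
            rw [e3, hS, add_mul]
            have := mul_le_mul_of_nonneg_left e4.le hS2
            linarith
          have e9 : α * YY y k τ x j1 (s - τ i) ≤ C * x (s - τ i) j := by
            refine le_trans ?_ e1
            rw [e2]
            have f1 := mul_le_mul_of_nonneg_right hAj (hYp j1 (s - τ i)).le
            have f2 := mul_nonneg (hB j hjU) (hYp j2 (s - τ i)).le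
            linarith
          have e10 : YY y k τ x j1 (s - τ i) ≤ C * x (s - τ i) j / α := by
            rw [le_div_iff₀ hα]; linarith
          calc x (t - τ i) j ≤ Ca * a (s - τ i) := e7.trans (e6.trans e5)
            _ ≤ Ca * (S * (C * x (s - τ i) j / α)) :=
              mul_le_mul_of_nonneg_left (e8.trans (mul_le_mul_of_nonneg_left e10 hS0)) (by linarith)
            _ = Ca * (S / α * C) * x (s - τ i) j := by ring
            _ ≤ c1 * x (s - τ i) j := mul_le_mul_of_nonneg_right (by linarith) hxp.le
        · have hr := hreg (s - τ i) ⟨by linarith, by linarith⟩ i hi j hjU hj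
          calc x (t - τ i) j ≤ M := H.le _ _
            _ = M / m * m := by field_simp
            _ ≤ M / m * x (s - τ i) j := mul_le_mul_of_nonneg_left hr hMm
            _ ≤ c1 * x (s - τ i) j := mul_le_mul_of_nonneg_right (by linarith) hxp.le
      have h2 : c1 ^ (∑ l, y i l) ≤ c1 ^ N := by
        apply pow_le_pow_right₀ hc11
        exact Finset.single_le_sum (f := fun i => ∑ l, y i l) (fun _ _ => Nat.zero_le _)
          (Finset.mem_univ i)
      have h3 : mono (x (t - τ i)) (y i) ≤ c1 ^ N * mono (x (s - τ i)) (y i) :=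
        h1.trans (mul_le_mul_of_nonneg_right h2 (mono_pos' (fun j => H.pos _ j) _).le)
      unfold Rt
      have := mul_le_mul_of_nonneg_left h3 (H.hk i).le
      linarith
    have hcp : 0 < c1 ^ N := by linarith
    have hg := gr_inflow (f := YY y k τ x j2) (C := C) (ρ := Rt y k x i (t - τ i) / c1 ^ N)
      (s := t - 1) (t := t) (f' := fun u => ∑ l, Rt y k x l (u - τ l) * ((y' l j2 : ℝ) - y l j2))
      (by linarith) (by linarith) (div_nonneg (H.Rpos _ _).le hcp.le)
      (H.YYcont j2).continuousOn (fun u hu => H.YYder (by linarith [hu.1]) j2) (by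
        intro u hu
        have g1 := (hlow j2 u (by linarith [hu.1])).resolve_right (by linarith [hu.1])
        have g2 := hcomp u hu.1.le hu.2.le
        have g3 : Rt y k x i (t - τ i) / c1 ^ N ≤ Rt y k x i (u - τ i) := by
          rw [div_le_iff₀ hcp]; linarith
        have g4 : Rt y k x i (u - τ i) ≤ ∑ l, Rt y k x l (u - τ l) * (y' l j2 : ℝ) := by
          have g5 : Rt y k x i (u - τ i) * (y' i j2 : ℝ) ≤ ∑ l, Rt y k x l (u - τ l) * (y' l j2 : ℝ) :=
            Finset.single_le_sum (f := fun l => Rt y k x l (u - τ l) * (y' l j2 : ℝ))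
              (fun l _ => mul_nonneg (H.Rpos _ _).le (Nat.cast_nonneg _)) (Finset.mem_univ i)
          have g6 : (1:ℝ) ≤ y' i j2 := by exact_mod_cast Nat.one_le_iff_ne_zero.2 hyi
          have g7 := mul_le_mul_of_nonneg_left g6 (H.Rpos i (u - τ i)).le
          linarith
        have g8 : ∑ l, Rt y k x l (u - τ l) * ((y' l j2 : ℝ) - y l j2)
          = ∑ l, Rt y k x l (u - τ l) * (y' l j2 : ℝ) + ∑ l, -(Rt y k x l (u - τ l) * (y l j2 : ℝ)) := by
          rw [← Finset.sum_add_distrib]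
          exact Finset.sum_congr rfl fun l _ => by ring
        rw [g8]
        linarith)
    have e0 : t - (t - 1) = 1 := by ring
    rw [e0, mul_one, mul_one] at hg
    have h5 : Rt y k x i (t - τ i) / c1 ^ N ≤ Real.exp C * YY y k τ x j2 t := by
      linarith [hYp j2 (t - 1)]
    rw [div_le_iff₀ hcp] at h5
    linarith
end


section
variable {n r : ℕ} {y y' : Fin r → Fin n → ℕ} {k τ : Fin r → ℝ} {τm M : ℝ}
    {x : ℝ → Fin n → ℝ}

lemma Ctx.u_up (H : Ctx y y' k τ τm M x) (R : Finset (Fin r)) (U : Finset (Fin n))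
    (hUR : ∀ j ∈ U, ∀ i, i ∉ R → y i j = 0 ∧ y' i j = 0)
    (hsemi : ∀ i ∈ R, (∃ j ∈ U, y' i j ≠ 0) → ∃ j ∈ U, y i j ≠ 0)
    (A B : Fin n → ℝ) (hA : ∀ j ∈ U, 0 ≤ A j) (hB : ∀ j ∈ U, 0 ≤ B j) (j1 j2 : Fin n)
    (hj2 : j2 ∈ U)
    (hrep : ∀ t, 0 < t → ∀ j ∈ U, YY y k τ x j t = A j * YY y k τ x j1 t + B j * YY y k τ x j2 t)
    (m : ℝ) (hm : 0 < m) :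
    ∃ C, 1 ≤ C ∧ ∀ e T, τm + 1 ≤ e →
      (∀ t ∈ Set.Icc e T, ∀ i ∈ R, ∀ j, j ∉ U → y i j ≠ 0 → m ≤ x t j) →
      ∀ s t, e + 1 + τm ≤ s → s ≤ t → t ≤ s + τm → t ≤ T →
        YY y k τ x j2 t ≤ C * YY y k τ x j2 s := by
  have hτ0 := H.hτm0
  obtain ⟨D, hD, hin⟩ := H.inflow_bd R U hUR hsemi A B hA hB j1 j2 hj2 hrep m hm
  set E : ℝ := ∑ i, (y' i j2 : ℝ) * D with hE
  have hE0 : 0 ≤ E := Finset.sum_nonneg fun i _ => by positivity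
  refine ⟨Real.exp (E * τm), Real.one_le_exp (by positivity), ?_⟩
  intro e T he hreg s t hs hst hth htT
  have h1 := gr_up (f := YY y k τ x j2) (C := E)
    (f' := fun u => ∑ i, Rt y k x i (u - τ i) * ((y' i j2 : ℝ) - y i j2)) hst
    (H.YYcont j2).continuousOn
    (fun u hu => H.YYder (by linarith [hu.1]) j2) (by
      intro u hu
      simp only [hE]
      rw [Finset.sum_mul]
      apply Finset.sum_le_sum
      intro i _
      have h0 := mul_nonneg (H.Rpos i (u - τ i)).le (Nat.cast_nonneg (y i j2) : (0:ℝ) ≤ y i j2)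
      by_cases hi : y' i j2 = 0
      · rw [hi]
        simp only [Nat.cast_zero, zero_mul]
        linarith
      · have hiR : i ∈ R := by
          by_contra h
          exact hi (hUR j2 hj2 i h).2
        have b5 := hin e T he hreg u (by linarith [hu.1]) (by linarith [hu.2]) i hiR hi
        have b6 := mul_le_mul_of_nonneg_left b5 (Nat.cast_nonneg (y' i j2) : (0:ℝ) ≤ y' i j2)
        linarith)
  refine h1.trans (mul_le_mul_of_nonneg_right (Real.exp_le_exp.2 ?_) (H.YYpos j2 s).le)
  exact mul_le_mul_of_nonneg_left (by linarith) hE0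

lemma Ctx.rates_comp (H : Ctx y y' k τ τm M x) (R : Finset (Fin r)) (U : Finset (Fin n))
    (hUR : ∀ j ∈ U, ∀ i, i ∉ R → y i j = 0 ∧ y' i j = 0)
    (hsemi : ∀ i ∈ R, (∃ j ∈ U, y' i j ≠ 0) → ∃ j ∈ U, y i j ≠ 0)
    (A B : Fin n → ℝ) (hA : ∀ j ∈ U, 0 ≤ A j) (hB : ∀ j ∈ U, 0 ≤ B j) (j1 j2 : Fin n)
    (hj1 : j1 ∈ U) (hj2 : j2 ∈ U)
    (hrep : ∀ t, 0 < t → ∀ j ∈ U, YY y k τ x j t = A j * YY y k τ x j1 t + B j * YY y k τ x j2 t)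
    (m : ℝ) (hm : 0 < m) :
    ∃ ε, 0 < ε ∧ ∀ e T, τm + 1 ≤ e →
      (∀ t ∈ Set.Icc e T, ∀ i ∈ R, ∀ j, j ∉ U → y i j ≠ 0 → m ≤ x t j) →
      ∀ t, e + 1 + 2 * τm ≤ t → t ≤ T → ∀ i ∈ R,
        ε * (∏ j ∈ U, YY y k τ x j t ^ y i j) ≤ Rt y k x i (t - τ i) ∧
        Rt y k x i (t - τ i) ≤ ε⁻¹ * (∏ j ∈ U, YY y k τ x j t ^ y i j) := by
  classical
  have hτ0 := H.hτm0
  obtain ⟨C, hC, -, -, hgr, hYx, -⟩ := H.basic τm hτ0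
  obtain ⟨C2, hC2, hu2⟩ := H.u_up R U hUR hsemi A B hA hB j1 j2 hj2 hrep m hm
  obtain ⟨C1, hC1, hu1⟩ := H.u_up R U hUR hsemi B A hB hA j2 j1 hj1
    (fun t ht j hj => by rw [hrep t ht j hj, add_comm]) m hm
  have hM := H.hM
  set c : ℝ := M + 1 / m + (C1 + C2) * C with hc
  have k1 : 0 ≤ 1 / m := by positivity
  have k2 : 0 ≤ (C1 + C2) * C := by positivity
  have hc1 : 1 ≤ c := by linarith
  have hcC : C ≤ c := by nlinarith
  set N : ℕ := ∑ i, ∑ l, y i l with hN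
  obtain ⟨km, hkm, hkm'⟩ := finset_pos_lb R k (fun i _ => H.hk i)
  obtain ⟨kx, hkx, hkx'⟩ := finset_ub R k
  set K : ℝ := 1 + kx + 1 / km with hK
  have hkm1 : 0 < 1 / km := by positivity
  have hKp : 0 < K := by positivity
  have hcN : 0 < c ^ N := by positivity
  refine ⟨(K * c ^ N)⁻¹, by positivity, ?_⟩
  intro e T he hreg t ht htT i hi
  have hti := H.hτ i
  have hti' := H.hτm i
  set z : Fin n → ℝ := fun j => if j ∈ U then YY y k τ x j t else 1 with hz
  have hz0 : ∀ j, 0 < z j := by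
    intro j; simp only [hz]; split_ifs
    · exact H.YYpos j t
    · exact one_pos
  have hmz : mono z (y i) = ∏ j ∈ U, YY y k τ x j t ^ y i j := by
    unfold mono
    rw [← Finset.prod_subset (Finset.subset_univ U)]
    · exact Finset.prod_congr rfl fun j hj => by simp [hz, hj]
    · intro j _ hj; simp [hz, hj]
  have hle1 : ∀ j, y i j ≠ 0 → x (t - τ i) j ≤ c * z j := by
    intro j hj
    by_cases hjU : j ∈ U
    · simp only [hz, hjU, if_true]
      calc _ ≤ C * x t j := hgr j _ _ (by linarith) (by linarith) (by linarith)
        _ ≤ C * YY y k τ x j t := mul_le_mul_of_nonneg_left (H.YYge j t) (by linarith)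
        _ ≤ _ := mul_le_mul_of_nonneg_right hcC (H.YYpos j t).le
    · simp only [hz, hjU, if_false]
      linarith [H.le (t - τ i) j]
  have hle2 : ∀ j, y i j ≠ 0 → z j ≤ c * x (t - τ i) j := by
    intro j hj
    have hxp := H.pos (t - τ i) j
    by_cases hjU : j ∈ U
    · simp only [hz, hjU, if_true]
      have a2 := hu2 e T he hreg (t - τ i) t (by linarith) (by linarith) (by linarith) htT
      have a1 := hu1 e T he hreg (t - τ i) t (by linarith) (by linarith) (by linarith) htT
      have y1 := H.YYpos j1 (t - τ i)
      have y2 := H.YYpos j2 (t - τ i)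
      have hAj := hA j hjU
      have hBj := hB j hjU
      have a3 : YY y k τ x j t ≤ (C1 + C2) * YY y k τ x j (t - τ i) := by
        rw [hrep t (by linarith) j hjU, hrep (t - τ i) (by linarith) j hjU]
        have b1 := mul_le_mul_of_nonneg_left a1 hAj
        have b2 := mul_le_mul_of_nonneg_left a2 hBj
        have b3 : 0 ≤ C2 * (A j * YY y k τ x j1 (t - τ i)) := by positivity
        have b4 : 0 ≤ C1 * (B j * YY y k τ x j2 (t - τ i)) := by positivity
        nlinarith
      calc _ ≤ (C1 + C2) * (C * x (t - τ i) j) := a3.trans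
            (mul_le_mul_of_nonneg_left (hYx j _ (by linarith)) (by linarith))
        _ = (C1 + C2) * C * x (t - τ i) j := by ring
        _ ≤ _ := mul_le_mul_of_nonneg_right (by linarith) hxp.le
    · simp only [hz, hjU, if_false]
      have hr := hreg (t - τ i) ⟨by linarith, by linarith⟩ i hi j hjU hj
      calc (1:ℝ) = 1 / m * m := by field_simp
        _ ≤ 1 / m * x (t - τ i) j := mul_le_mul_of_nonneg_left hr k1
        _ ≤ _ := mul_le_mul_of_nonneg_right (by linarith) hxp.le
  have hpow : c ^ (∑ l, y i l) ≤ c ^ N := by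
    apply pow_le_pow_right₀ hc1
    exact Finset.single_le_sum (f := fun i => ∑ l, y i l) (fun _ _ => Nat.zero_le _)
      (Finset.mem_univ i)
  have mx := mono_pos' (fun j => H.pos (t - τ i) j) (y i)
  have mz := mono_pos' hz0 (y i)
  have s1 : mono (x (t - τ i)) (y i) ≤ c ^ N * mono z (y i) :=
    (mono_scale (fun j => (H.pos _ j).le) (y i) hle1).trans
      (mul_le_mul_of_nonneg_right hpow mz.le)
  have s2 : mono z (y i) ≤ c ^ N * mono (x (t - τ i)) (y i) :=
    (mono_scale (fun j => (hz0 j).le) (y i) hle2).trans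
      (mul_le_mul_of_nonneg_right hpow mx.le)
  rw [← hmz, inv_inv]
  have hki := hkm' i hi
  have hki' := hkx' i hi
  unfold Rt
  constructor
  · rw [inv_mul_le_iff₀ (by positivity)]
    have f1 : 1 ≤ K * k i := by
      have : 1 / km * km ≤ K * k i := mul_le_mul (by linarith) hki hkm.le hKp.le
      rwa [one_div_mul_cancel hkm.ne'] at this
    calc mono z (y i) ≤ 1 * (c ^ N * mono (x (t - τ i)) (y i)) := by linarith
      _ ≤ (K * k i) * (c ^ N * mono (x (t - τ i)) (y i)) :=
        mul_le_mul_of_nonneg_right f1 (by positivity)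
      _ = _ := by ring
  · calc k i * mono (x (t - τ i)) (y i) ≤ K * (c ^ N * mono z (y i)) :=
        mul_le_mul (by linarith) s1 mx.le hKp.le
      _ = _ := by ring

/-- If the state stays in the interior outside `U`, then smallness on `U` at the end of a time
interval forces smallness on the whole interval. -/
lemma Ctx.sweep (H : Ctx y y' k τ τm M x) (R : Finset (Fin r)) (U : Finset (Fin n))
    (hU : U.Nonempty)
    (hUR : ∀ j ∈ U, ∀ i, i ∉ R → y i j = 0 ∧ y' i j = 0)
    (hsemi : ∀ i ∈ R, (∃ j ∈ U, y' i j ≠ 0) → ∃ j ∈ U, y i j ≠ 0)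
    (hcb : ComplexBalancedOn y y' k R)
    (h2 : Module.finrank ℝ (stoichOn y y' R) = 2)
    (tN : ℕ → ℝ) (htN : Tendsto tN atTop atTop)
    (hx0 : ∀ j ∈ U, Tendsto (fun N => x (tN N) j) atTop (nhds 0))
    (m : ℝ) (hm : 0 < m) :
    ∀ σ, 0 < σ → ∃ σ', 0 < σ' ∧ ∀ e T, τm + 1 ≤ e →
      (∀ t ∈ Set.Icc e T, ∀ i ∈ R, ∀ j, j ∉ U → y i j ≠ 0 → m ≤ x t j) →
      (∀ j ∈ U, x T j < σ') → ∀ t ∈ Set.Icc e T, ∀ j ∈ U, x t j < σ := by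
  intro σ hσ
  have hτ0 := H.hτm0
  obtain ⟨C, hC, -, -, hgr, hYx, -⟩ := H.basic (1 + 2 * τm) (by linarith)
  have hY0 : ∀ j ∈ U, Tendsto (fun N => YY y k τ x j (tN N)) atTop (nhds 0) := by
    intro j hj
    have h1 : Tendsto (fun N => C * x (tN N) j) atTop (nhds (C * 0)) := (hx0 j hj).const_mul C
    rw [mul_zero] at h1
    refine tendsto_of_tendsto_of_tendsto_of_le_of_le' tendsto_const_nhds h1 ?_ ?_
    · exact Eventually.of_forall fun N => (H.YYpos j _).le
    · filter_upwards [htN.eventually_ge_atTop τm] with N hN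
      exact hYx j _ hN
  have hmem := H.YY_mem R U hUR tN htN hY0
  obtain ⟨P, hP, hPe⟩ := hmem 1 one_pos
  obtain ⟨j1, hj1, j2, hj2, A, B, hA, hB, hAB, hA1, hB1, hrepV⟩ :=
    geo (stoichOn y y' R) h2 U hU P hP (fun j hj => by rw [hPe j hj]; exact H.YYpos j 1)
  have hrep : ∀ t, 0 < t → ∀ j ∈ U,
      YY y k τ x j t = A j * YY y k τ x j1 t + B j * YY y k τ x j2 t := by
    intro t ht j hj
    obtain ⟨Q, hQ, hQe⟩ := hmem t ht
    have := hrepV Q hQ j hj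
    rwa [hQe j hj, hQe j1 hj1, hQe j2 hj2] at this
  obtain ⟨ε, hε, hrates⟩ := H.rates_comp R U hUR hsemi A B hA hB j1 j2 hj1 hj2 hrep m hm
  obtain ⟨xb, hxb, hcb'⟩ := hcb
  obtain ⟨ρ0, D, hρ0, hD, hbar⟩ := barrier H.hk hxb hcb' U A B hA hB hAB j1 j2 hA1 hB1
    (fun i hi j hj => hrepV _ (Submodule.subset_span ⟨i, hi, rfl⟩) j hj) ε hε
  obtain ⟨Ax, hAx, hAx'⟩ := finset_ub U A
  obtain ⟨Bx, hBx, hBx'⟩ := finset_ub U B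
  set E : ℝ := C * ((Ax + Bx + 1) * D) with hE
  have hEp : 0 < E := by positivity
  set ρ : ℝ := min (ρ0 / 2) (σ / E) with hρ
  have hρp : 0 < ρ := lt_min (by linarith) (by positivity)
  have hρ1 : ρ < ρ0 := (min_le_left _ _).trans_lt (by linarith)
  have hρ2 : ρ * E ≤ σ := by
    have := min_le_right (ρ0 / 2) (σ / E)
    rwa [← hρ, le_div_iff₀ hEp] at this
  set σ' : ℝ := min (σ / C) (ρ / (2 * D * C)) with hσ'
  refine ⟨σ', lt_min (by positivity) (by positivity), ?_⟩
  intro e T he hreg hxT t ht j hj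
  rcases le_or_gt (t + 1 + 2 * τm) T with hcase | hcase
  · set t1 := t + 1 + 2 * τm with ht1
    have het : e ≤ t := ht.1
    have hlt : YY y k τ x j1 t1 + YY y k τ x j2 t1 < D * ρ := by
      by_contra hcon
      push Not at hcon
      have hb := hbar ρ hρp hρ1 t1 T hcase (fun j u => YY y k τ x j u)
        (fun i u => Rt y k x i (u - τ i)) (fun j => H.YYcont j)
        (fun u _ => ⟨H.YYpos j1 u, H.YYpos j2 u⟩)
        (fun u hu j hj => hrep u (by linarith [hu.1]) j hj)
        (fun u hu => by
          refine (H.YYder (by linarith [hu.1]) j1).congr_deriv ?_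
          symm
          apply Finset.sum_subset (Finset.subset_univ _)
          intro i _ hi
          obtain ⟨a, b⟩ := hUR j1 hj1 i hi
          rw [a, b]; simp)
        (fun u hu => by
          refine (H.YYder (by linarith [hu.1]) j2).congr_deriv ?_
          symm
          apply Finset.sum_subset (Finset.subset_univ _)
          intro i _ hi
          obtain ⟨a, b⟩ := hUR j2 hj2 i hi
          rw [a, b]; simp)
        (fun u hu i hi => hrates e T he hreg u (by linarith [hu.1]) hu.2.le i hi) hcon
      have hs : σ' ≤ ρ / (2 * D * C) := min_le_right _ _
      rw [le_div_iff₀ (by positivity)] at hs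
      have c1 := hYx j1 T (by linarith)
      have c2 := hYx j2 T (by linarith)
      have c3 := mul_lt_mul_of_pos_left (hxT j1 hj1) (show 0 < C by linarith)
      have c4 := mul_lt_mul_of_pos_left (hxT j2 hj2) (show 0 < C by linarith)
      have c5 : YY y k τ x j1 T + YY y k τ x j2 T < 2 * C * σ' := by linarith
      have c6 := mul_lt_mul_of_pos_left c5 (show 0 < D by linarith)
      have : ρ ≤ D * (YY y k τ x j1 T + YY y k τ x j2 T) := hb
      nlinarith
    have y1 := H.YYpos j1 t1
    have y2 := H.YYpos j2 t1
    have b1 : YY y k τ x j t1 ≤ (Ax + Bx) * (YY y k τ x j1 t1 + YY y k τ x j2 t1) := by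
      rw [hrep t1 (by linarith) j hj]
      have := mul_le_mul_of_nonneg_right (hAx' j hj) y1.le
      have := mul_le_mul_of_nonneg_right (hBx' j hj) y2.le
      nlinarith [mul_nonneg hAx y2.le, mul_nonneg hBx y1.le]
    have b2 : YY y k τ x j t1 < (Ax + Bx + 1) * (D * ρ) := by
      have : (Ax + Bx) * (YY y k τ x j1 t1 + YY y k τ x j2 t1) ≤ (Ax + Bx) * (D * ρ) :=
        mul_le_mul_of_nonneg_left hlt.le (by linarith)
      have : 0 < D * ρ := by positivity
      linarith
    have b3 := hgr j t t1 (by linarith) (by linarith) (by linarith)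
    have b4 := H.YYge j t1
    have b5 := mul_lt_mul_of_pos_left (b4.trans_lt b2) (show 0 < C by linarith)
    have b6 : C * ((Ax + Bx + 1) * (D * ρ)) = ρ * E := by rw [hE]; ring
    linarith
  · have b3 := hgr j t T (by linarith [ht.1]) ht.2 (by linarith)
    have hs : σ' ≤ σ / C := min_le_left _ _
    rw [le_div_iff₀ (by linarith)] at hs
    have c3 := mul_lt_mul_of_pos_left (hxT j hj) (show 0 < C by linarith)
    linarith
end


section
variable {n r : ℕ} {y y' : Fin r → Fin n → ℕ} {k τ : Fin r → ℝ} {τm M : ℝ}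
  {x : ℝ → Fin n → ℝ} {xb : Fin n → ℝ}

lemma Ctx.EE_lim (h : Ctx y y' k τ τm M x) (hxb : ∀ j, 0 < xb j)
    (hcb : ∀ η : Fin n → ℕ, ∑ i ∈ Finset.univ.filter (fun i => y i = η), k i * mono xb (y i)
      = ∑ i ∈ Finset.univ.filter (fun i => y' i = η), k i * mono xb (y i)) :
    ∃ L, Tendsto (EE y y' k τ xb x) atTop (nhds L) := by
  refine ⟨_, tendsto_atTop_ciSup (h.EEmono hxb) ⟨VV y k τ xb x 0 + EE y y' k τ xb x 0, ?_⟩⟩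
  rintro _ ⟨t, rfl⟩
  have h1 := h.VVanti hxb hcb (le_refl 0) (le_max_right t 0)
  have h2 := h.EEmono hxb (le_max_left t 0)
  have h3 := h.VVnonneg hxb (max t 0)
  linarith

lemma Ctx.VV_lim (h : Ctx y y' k τ τm M x) (hxb : ∀ j, 0 < xb j)
    (hcb : ∀ η : Fin n → ℕ, ∑ i ∈ Finset.univ.filter (fun i => y i = η), k i * mono xb (y i)
      = ∑ i ∈ Finset.univ.filter (fun i => y' i = η), k i * mono xb (y i)) :
    ∃ L, Tendsto (VV y k τ xb x) atTop (nhds L) := by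
  obtain ⟨L, hL⟩ := h.EE_lim hxb hcb
  have ha : Antitone (fun t => VV y k τ xb x (max t 0) + EE y y' k τ xb x (max t 0)) := by
    intro s t hst
    exact h.VVanti hxb hcb (le_max_right s 0) (max_le_max_right 0 hst)
  have hb : BddBelow (Set.range (fun t => VV y k τ xb x (max t 0) + EE y y' k τ xb x (max t 0))) := by
    refine ⟨EE y y' k τ xb x 0, ?_⟩
    rintro _ ⟨t, rfl⟩
    have h2 := h.EEmono hxb (le_max_right t 0)
    have h3 := h.VVnonneg hxb (max t 0)
    show _ ≤ VV y k τ xb x (max t 0) + EE y y' k τ xb x (max t 0)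
    linarith
  have h1 := tendsto_atTop_ciInf ha hb
  refine ⟨_, (h1.sub hL).congr' ?_⟩
  filter_upwards [eventually_ge_atTop 0] with t ht
  rw [max_eq_left ht]
  ring

lemma Ctx.flat (h : Ctx y y' k τ τm M x) (hxb : ∀ j, 0 < xb j)
    (hcb : ∀ η : Fin n → ℕ, ∑ i ∈ Finset.univ.filter (fun i => y i = η), k i * mono xb (y i)
      = ∑ i ∈ Finset.univ.filter (fun i => y' i = η), k i * mono xb (y i)) :
    ∀ ε > 0, ∃ t0, ∀ t ≥ t0, ∀ s ∈ Set.Icc (t - τm) t, ∀ j, |x s j - x t j| < ε := by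
  intro ε hε
  obtain ⟨C, hC, hs⟩ := h.slow hxb hcb
  obtain ⟨L, hL⟩ := h.EE_lim hxb hcb
  have hM := h.hM
  have hC0 : 0 < C := by linarith
  have hM0 : 0 < M := by linarith
  set η := min 1 (ε / (2 * C * M)) with hη
  have hη0 : 0 < η := lt_min one_pos (by positivity)
  have hη1 : η ≤ 1 := min_le_left _ _
  have hη2 : η * (2 * C * M) ≤ ε := by
    rw [← le_div_iff₀ (by positivity)]; exact min_le_right _ _
  have hT : Tendsto (fun t => EE y y' k τ xb x t - EE y y' k τ xb x (t - τm)) atTop (nhds 0) := by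
    have := hL.sub (hL.comp (tendsto_atTop_add_const_right _ (-τm) tendsto_id))
    simpa [sub_eq_add_neg] using this
  have hev := hT.eventually (gt_mem_nhds (show 0 < ε * η / (2 * C) by positivity))
  obtain ⟨t0, ht0⟩ := eventually_atTop.1 hev
  refine ⟨max t0 τm, fun t ht s hst j => ?_⟩
  have h1 := ht0 t (le_trans (le_max_left _ _) ht)
  have h2 : τm ≤ t := le_trans (le_max_right _ _) ht
  have h3 := hs η hη0 hη1 j s t (by linarith [hst.1]) hst.2 (by linarith [hst.1])
  have h4 := h.EEmono hxb hst.1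
  rw [abs_sub_comm]
  refine lt_of_le_of_lt h3 ?_
  have h5 : EE y y' k τ xb x t - EE y y' k τ xb x s < ε * η / (2 * C) := by linarith
  have h6 : 1 / η * (EE y y' k τ xb x t - EE y y' k τ xb x s) < 1 / η * (ε * η / (2 * C)) :=
    mul_lt_mul_of_pos_left h5 (by positivity)
  have h7 : 1 / η * (ε * η / (2 * C)) = ε / (2 * C) := by field_simp
  rw [h7] at h6
  have h8 : C * (η * x t j) ≤ ε / 2 := by
    have := mul_le_mul_of_nonneg_left (h.le t j) (by positivity : 0 ≤ C * η)
    linarith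
  have h9 : C * (ε / (2 * C)) = ε / 2 := by field_simp
  have h10 := mul_lt_mul_of_pos_left h6 hC0
  rw [mul_add]
  linarith

lemma Ctx.win_lim (h : Ctx y y' k τ τm M x) (hxb : ∀ j, 0 < xb j)
    (hcb : ∀ η : Fin n → ℕ, ∑ i ∈ Finset.univ.filter (fun i => y i = η), k i * mono xb (y i)
      = ∑ i ∈ Finset.univ.filter (fun i => y' i = η), k i * mono xb (y i))
    (F : (Fin n → ℝ) → ℝ) (hF : Continuous F) (T : ℕ → ℝ) (hT : Tendsto T atTop atTop)
    (c : Fin n → ℝ) (hc : Tendsto (fun m => x (T m)) atTop (nhds c)) (i : Fin r) :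
    Tendsto (fun m => ∫ s in (T m - τ i)..(T m), F (x s)) atTop (nhds (τ i * F c)) := by
  have hxc : Continuous x := continuous_pi h.cont
  rw [Metric.tendsto_atTop]
  intro ε hε
  have hτm0 := h.hτm0
  obtain ⟨δ, hδ, hFδ⟩ := Metric.continuous_iff.1 hF c (ε / (2 * (τm + 1))) (by positivity)
  obtain ⟨t0, ht0⟩ := h.flat hxb hcb (δ / 2) (by positivity)
  obtain ⟨N1, hN1⟩ := Metric.tendsto_atTop.1 hc (δ / 2) (by positivity)
  obtain ⟨N2, hN2⟩ := eventually_atTop.1 (hT.eventually (eventually_ge_atTop t0))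
  refine ⟨max N1 N2, fun m hm => ?_⟩
  have hi := h.hτ i
  have hi' := h.hτm i
  have e1 : ∫ s in (T m - τ i)..(T m), F c = τ i * F c := by simp
  rw [Real.dist_eq, ← e1, ← intervalIntegral.integral_sub
    ((show Continuous (fun s => F (x s)) from hF.comp hxc).intervalIntegrable _ _) (continuous_const.intervalIntegrable _ _)]
  have h1 : ‖∫ s in (T m - τ i)..(T m), (F (x s) - F c)‖ ≤ ε / (2 * (τm + 1)) * |T m - (T m - τ i)| := by
    apply intervalIntegral.norm_integral_le_of_norm_le_const
    intro s hs
    rw [Set.uIoc_of_le (by linarith)] at hs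
    have h3 : dist (x s) c < δ := by
      have h4 := hN1 m (le_trans (le_max_left _ _) hm)
      have h5 : dist (x s) (x (T m)) < δ / 2 := by
        rw [dist_pi_lt_iff (by positivity)]
        intro j
        exact ht0 (T m) (hN2 m (le_trans (le_max_right _ _) hm)) s ⟨by linarith [hs.1], hs.2⟩ j
      linarith [dist_triangle (x s) (x (T m)) c]
    have := hFδ (x s) h3
    rw [Real.dist_eq] at this
    exact this.le
  rw [Real.norm_eq_abs] at h1
  refine lt_of_le_of_lt h1 ?_
  rw [sub_sub_cancel, abs_of_nonneg hi]
  have : ε / (2 * (τm + 1)) * τ i ≤ ε / (2 * (τm + 1)) * (τm + 1) :=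
    mul_le_mul_of_nonneg_left (by linarith) (by positivity)
  have e2 : ε / (2 * (τm + 1)) * (τm + 1) = ε / 2 := by field_simp
  linarith

noncomputable def Vst (y : Fin r → Fin n → ℕ) (k τ : Fin r → ℝ) (xb c : Fin n → ℝ) : ℝ :=
  ∑ j, xb j * FF (c j / xb j)
    + ∑ i, KK y k xb i * (τ i * FF (mono (fun j => c j / xb j) (y i)))

noncomputable def Yst (y : Fin r → Fin n → ℕ) (k τ : Fin r → ℝ) (c : Fin n → ℝ) (j : Fin n) : ℝ :=
  c j + ∑ i, (y i j : ℝ) * (τ i * (k i * mono c (y i)))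

lemma cont_mono (z : Fin n → ℕ) : Continuous (fun c : Fin n → ℝ => mono c z) := by
  unfold mono
  fun_prop

lemma Ctx.VV_st (h : Ctx y y' k τ τm M x) (hxb : ∀ j, 0 < xb j)
    (hcb : ∀ η : Fin n → ℕ, ∑ i ∈ Finset.univ.filter (fun i => y i = η), k i * mono xb (y i)
      = ∑ i ∈ Finset.univ.filter (fun i => y' i = η), k i * mono xb (y i))
    (T : ℕ → ℝ) (hT : Tendsto T atTop atTop)
    (c : Fin n → ℝ) (hc : Tendsto (fun m => x (T m)) atTop (nhds c)) :
    Tendsto (fun m => VV y k τ xb x (T m)) atTop (nhds (Vst y k τ xb c)) := by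
  unfold VV Vst
  refine Tendsto.add (tendsto_finsetSum _ fun j _ => Tendsto.const_mul _ ?_)
    (tendsto_finsetSum _ fun i _ => Tendsto.const_mul _ ?_)
  · exact (FF_cont.tendsto _).comp ((tendsto_pi_nhds.1 hc j).div_const _)
  · have hF : Continuous (fun c : Fin n → ℝ => FF (mono (fun j => c j / xb j) (y i))) := by
      refine FF_cont.comp ((cont_mono (y i)).comp ?_)
      exact continuous_pi fun j => (continuous_apply j).div_const _
    exact h.win_lim hxb hcb _ hF T hT c hc i

lemma Ctx.YY_st (h : Ctx y y' k τ τm M x) (hxb : ∀ j, 0 < xb j)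
    (hcb : ∀ η : Fin n → ℕ, ∑ i ∈ Finset.univ.filter (fun i => y i = η), k i * mono xb (y i)
      = ∑ i ∈ Finset.univ.filter (fun i => y' i = η), k i * mono xb (y i))
    (T : ℕ → ℝ) (hT : Tendsto T atTop atTop)
    (c : Fin n → ℝ) (hc : Tendsto (fun m => x (T m)) atTop (nhds c)) (j : Fin n) :
    Tendsto (fun m => YY y k τ x j (T m)) atTop (nhds (Yst y k τ c j)) := by
  unfold YY Yst
  refine Tendsto.add (tendsto_pi_nhds.1 hc j)
    (tendsto_finsetSum _ fun i _ => Tendsto.const_mul _ ?_)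
  exact h.win_lim hxb hcb _ (continuous_const.mul (cont_mono (y i))) T hT c hc i

lemma Ctx.nn_small (h : Ctx y y' k τ τm M x) (hxb : ∀ j, 0 < xb j)
    (hcb : ∀ η : Fin n → ℕ, ∑ i ∈ Finset.univ.filter (fun i => y i = η), k i * mono xb (y i)
      = ∑ i ∈ Finset.univ.filter (fun i => y' i = η), k i * mono xb (y i))
    (e T : ℕ → ℝ) (he : Tendsto e atTop atTop) (heT : ∀ m, e m ≤ T m) (i : Fin r) (η : ℝ)
    (hη : 0 < η)
    (hg : ∀ᶠ m in atTop, ∀ u ∈ Set.Icc (e m) (T m),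
      η ≤ |∑ j, ((y' i j : ℝ) - y i j) * Real.log (x u j / xb j)|) :
    Tendsto (fun m => nn y k τ x i (T m) - nn y k τ x i (e m)) atTop (nhds 0) := by
  obtain ⟨C, hC, hb⟩ := h.gross_bd hxb hcb η hη
  obtain ⟨L, hL⟩ := h.EE_lim hxb hcb
  have hT : Tendsto T atTop atTop := tendsto_atTop_mono heT he
  have h1 : Tendsto (fun m => C * (EE y y' k τ xb x (T m) - EE y y' k τ xb x (e m - τm)))
      atTop (nhds 0) := by
    have := (hL.comp hT).sub (hL.comp (tendsto_atTop_add_const_right _ (-τm) he))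
    have := this.const_mul C
    simpa [sub_eq_add_neg] using this
  refine squeeze_zero_norm' ?_ h1
  filter_upwards [hg, he.eventually (eventually_ge_atTop τm)] with m hm hm2
  exact hb i (e m) (T m) hm2 (heT m) hm

lemma st_conv (hk : ∀ i, 0 < k i) (hτ : ∀ i, 0 ≤ τ i) (hxb : ∀ j, 0 < xb j)
    (W : Finset (Fin n)) (c c' lam : Fin n → ℝ)
    (hcW : ∀ j ∈ W, c j = 0) (hcW' : ∀ j ∈ W, c' j = 0)
    (hcO : ∀ j, j ∉ W → 0 < c j) (hc' : ∀ j, 0 ≤ c' j)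
    (hlW : ∀ j ∈ W, lam j = 0) (hlO : ∀ j, j ∉ W → lam j = Real.log (c j / xb j)) :
    ∑ j, lam j * (Yst y k τ c' j - Yst y k τ c j)
      + ∑ j, xb j * (Real.sqrt (c' j / xb j) - Real.sqrt (c j / xb j)) ^ 2
      ≤ Vst y k τ xb c' - Vst y k τ xb c := by
  have a1 : ∀ j, lam j * (c' j - c j) + xb j * (Real.sqrt (c' j / xb j) - Real.sqrt (c j / xb j)) ^ 2
      ≤ xb j * FF (c' j / xb j) - xb j * FF (c j / xb j) := by
    intro j
    have hx := hxb j
    by_cases hj : j ∈ W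
    · simp [hcW j hj, hcW' j hj]
    · rw [hlO j hj]
      have := FF_conv (div_pos (hcO j hj) hx) (div_nonneg (hc' j) hx.le)
      have h2 := mul_le_mul_of_nonneg_left this hx.le
      have e : xb j * (Real.log (c j / xb j) * (c' j / xb j - c j / xb j)) =
        Real.log (c j / xb j) * (c' j - c j) := by field_simp
      rw [mul_add, e] at h2
      linarith
  have a2 : ∀ i, ∑ j, lam j * ((y i j : ℝ) * (τ i * (k i * (mono c' (y i) - mono c (y i)))))
      ≤ KK y k xb i * (τ i * FF (mono (fun j => c' j / xb j) (y i)))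
        - KK y k xb i * (τ i * FF (mono (fun j => c j / xb j) (y i))) := by
    intro i
    have e0 : ∑ j, lam j * ((y i j : ℝ) * (τ i * (k i * (mono c' (y i) - mono c (y i)))))
        = (∑ j, (y i j : ℝ) * lam j) * (τ i * (k i * (mono c' (y i) - mono c (y i)))) := by
      rw [Finset.sum_mul]
      exact Finset.sum_congr rfl fun j _ => by ring
    rw [e0]
    have hmb : 0 < mono xb (y i) := mono_pos' hxb _
    by_cases hi : ∃ j ∈ W, y i j ≠ 0
    · obtain ⟨j, hj, hyj⟩ := hi
      have z : ∀ d : Fin n → ℝ, d j = 0 → mono d (y i) = 0 := fun d hd =>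
        Finset.prod_eq_zero (Finset.mem_univ j) (by rw [hd]; exact zero_pow hyj)
      rw [mono_div, mono_div, z c (hcW j hj), z c' (hcW' j hj)]
      simp
    · push Not at hi
      have hm : 0 < mono c (y i) := by
        refine Finset.prod_pos fun j _ => ?_
        by_cases hj : j ∈ W
        · rw [hi j hj]; simp
        · exact pow_pos (hcO j hj) _
      have hm' : 0 ≤ mono c' (y i) := mono_nonneg' hc' _
      have hl : Real.log (mono (fun j => c j / xb j) (y i)) = ∑ j, (y i j : ℝ) * lam j := by
        unfold mono
        rw [Real.log_prod]
        · refine Finset.sum_congr rfl fun j _ => ?_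
          rw [Real.log_pow]
          by_cases hj : j ∈ W
          · rw [hi j hj]; simp
          · rw [hlO j hj]
        · intro j _
          by_cases hj : j ∈ W
          · rw [hi j hj]; simp
          · exact (pow_pos (div_pos (hcO j hj) (hxb j)) _).ne'
      rw [← hl]
      have hz : 0 < mono (fun j => c j / xb j) (y i) := by rw [mono_div]; positivity
      have hw : 0 ≤ mono (fun j => c' j / xb j) (y i) := by rw [mono_div]; positivity
      have hcv := FF_conv hz hw
      have h1 : Real.log (mono (fun j => c j / xb j) (y i)) * (mono (fun j => c' j / xb j) (y i) -
        mono (fun j => c j / xb j) (y i)) ≤ FF (mono (fun j => c' j / xb j) (y i)) -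
        FF (mono (fun j => c j / xb j) (y i)) := by
        linarith [sq_nonneg (Real.sqrt (mono (fun j => c' j / xb j) (y i)) -
          Real.sqrt (mono (fun j => c j / xb j) (y i)))]
      have hK : 0 ≤ KK y k xb i * τ i :=
        mul_nonneg (mul_nonneg (hk i).le hmb.le) (hτ i)
      have h2 := mul_le_mul_of_nonneg_left h1 hK
      have e : KK y k xb i * τ i * (Real.log (mono (fun j => c j / xb j) (y i)) *
          (mono (fun j => c' j / xb j) (y i) - mono (fun j => c j / xb j) (y i)))
          = Real.log (mono (fun j => c j / xb j) (y i)) *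
            (τ i * (k i * (mono c' (y i) - mono c (y i)))) := by
        rw [mono_div c', mono_div c]
        unfold KK
        field_simp
      rw [e] at h2
      linarith
  have e1 : ∑ j, lam j * (Yst y k τ c' j - Yst y k τ c j) = ∑ j, lam j * (c' j - c j)
      + ∑ i, ∑ j, lam j * ((y i j : ℝ) * (τ i * (k i * (mono c' (y i) - mono c (y i))))) := by
    rw [Finset.sum_comm, ← Finset.sum_add_distrib]
    refine Finset.sum_congr rfl fun j _ => ?_
    unfold Yst
    rw [← Finset.mul_sum, ← mul_add]
    congr 1
    have : ∑ i, (y i j : ℝ) * (τ i * (k i * (mono c' (y i) - mono c (y i))))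
      = ∑ i, (y i j : ℝ) * (τ i * (k i * (mono c' (y i)))) - ∑ i, (y i j : ℝ) * (τ i * (k i * (mono c (y i)))) := by
      rw [← Finset.sum_sub_distrib]
      exact Finset.sum_congr rfl fun i _ => by ring
    rw [this]; ring
  have s1 := Finset.sum_le_sum (s := Finset.univ) fun j _ => a1 j
  have s2 := Finset.sum_le_sum (s := Finset.univ) fun i _ => a2 i
  rw [Finset.sum_add_distrib, Finset.sum_sub_distrib] at s1
  rw [Finset.sum_sub_distrib] at s2
  rw [e1]
  unfold Vst
  linarith

lemma st_eq (hk : ∀ i, 0 < k i) (hτ : ∀ i, 0 ≤ τ i) (hxb : ∀ j, 0 < xb j)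
    (W : Finset (Fin n)) (c c' lam : Fin n → ℝ)
    (hcW : ∀ j ∈ W, c j = 0) (hcW' : ∀ j ∈ W, c' j = 0)
    (hcO : ∀ j, j ∉ W → 0 < c j) (hc' : ∀ j, 0 ≤ c' j)
    (hlW : ∀ j ∈ W, lam j = 0) (hlO : ∀ j, j ∉ W → lam j = Real.log (c j / xb j))
    (hV : Vst y k τ xb c' = Vst y k τ xb c)
    (hY : ∑ j, lam j * (Yst y k τ c' j - Yst y k τ c j) = 0) : c' = c := by
  have h := st_conv (y := y) hk hτ hxb W c c' lam hcW hcW' hcO hc' hlW hlO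
  rw [hV, hY, sub_self, zero_add] at h
  have hnn : ∀ j ∈ Finset.univ, 0 ≤ xb j * (Real.sqrt (c' j / xb j) - Real.sqrt (c j / xb j)) ^ 2 :=
    fun j _ => mul_nonneg (hxb j).le (sq_nonneg _)
  have h0 := (Finset.sum_eq_zero_iff_of_nonneg hnn).1 (le_antisymm h (Finset.sum_nonneg hnn))
  funext j
  have hj := h0 j (Finset.mem_univ j)
  have hx := hxb j
  have h2 := (mul_eq_zero.1 hj).resolve_left hx.ne'
  have h3 := sub_eq_zero.1 (pow_eq_zero_iff (two_ne_zero) |>.1 h2)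
  have hcj : 0 ≤ c j := by
    by_cases hW : j ∈ W
    · rw [hcW j hW]
    · exact (hcO j hW).le
  have h4 := (Real.sqrt_inj (div_nonneg (hc' j) hx.le) (div_nonneg hcj hx.le)).1 h3
  field_simp at h4
  exact h4

end


lemma factor_U {n : ℕ} (V : Submodule ℝ (Fin n → ℝ)) (U : Finset (Fin n)) (lam : Fin n → ℝ)
    (h : ∀ v ∈ V, (∀ j ∈ U, v j = 0) → ∑ j, lam j * v j = 0) :
    ∃ μ : Fin n → ℝ, ∀ v ∈ V, ∑ j, lam j * v j = ∑ j ∈ U, μ j * v j := by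
  classical
  set Lm : U → (V →ₗ[ℝ] ℝ) := fun j => (LinearMap.proj (j : Fin n)).comp V.subtype with hL
  set K : V →ₗ[ℝ] ℝ := (∑ j, lam j • (LinearMap.proj j : (Fin n → ℝ) →ₗ[ℝ] ℝ)).comp V.subtype with hK
  have hKv : ∀ v : V, K v = ∑ j, lam j * (v : Fin n → ℝ) j := by
    intro v
    simp [hK]
  have hker : ⨅ i, LinearMap.ker (Lm i) ≤ LinearMap.ker K := by
    intro v hv
    rw [LinearMap.mem_ker, hKv]
    refine h v v.2 fun j hj => ?_
    have := (Submodule.mem_iInf _).1 hv ⟨j, hj⟩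
    rw [LinearMap.mem_ker] at this
    exact this
  obtain ⟨μ, hμ⟩ := (Submodule.mem_span_range_iff_exists_fun ℝ).1 (mem_span_of_iInf_ker_le_ker hker)
  refine ⟨fun j => if hj : j ∈ U then μ ⟨j, hj⟩ else 0, fun v hv => ?_⟩
  have h1 := hKv ⟨v, hv⟩
  rw [← hμ] at h1
  rw [← h1, LinearMap.sum_apply, ← Finset.sum_attach U]
  refine Finset.sum_congr rfl fun j _ => ?_
  simp [hL]

lemma prop_U {n : ℕ} (V : Submodule ℝ (Fin n → ℝ)) (hV : Module.finrank ℝ V = 2)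
    (U : Finset (Fin n)) (P N : Fin n → ℝ) (hP : P ∈ V) (hN : N ∈ V)
    (hPp : ∀ j ∈ U, 0 < P j) (hN0 : ∀ j ∈ U, N j = 0) (hNn : N ≠ 0) (v : Fin n → ℝ) (hv : v ∈ V) :
    ∃ α : ℝ, ∀ j ∈ U, v j = α * P j := by
  rcases U.eq_empty_or_nonempty with hU | ⟨j0, hj0⟩
  · subst hU
    exact ⟨0, by simp⟩
  have hli : LinearIndependent ℝ ![P, N] := by
    rw [LinearIndependent.pair_iff]
    intro a b hab
    have e1 := congrFun hab j0
    simp only [Pi.add_apply, Pi.smul_apply, smul_eq_mul, Pi.zero_apply, hN0 j0 hj0, mul_zero,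
      add_zero] at e1
    have ha := (mul_eq_zero.1 e1).resolve_right (hPp j0 hj0).ne'
    rw [ha, zero_smul, zero_add] at hab
    exact ⟨ha, (smul_eq_zero.1 hab).resolve_right hNn⟩
  have hspan : Submodule.span ℝ (Set.range ![P, N]) = V := by
    apply Submodule.eq_of_le_of_finrank_eq
    · rw [Submodule.span_le]
      rintro _ ⟨i, rfl⟩
      fin_cases i
      · exact hP
      · exact hN
    · rw [finrank_span_eq_card hli, hV]; simp
  rw [← hspan] at hv
  have hv' : v ∈ Submodule.span ℝ {P, N} := by
    simp only [Matrix.range_cons, Matrix.range_empty, Set.union_empty] at hv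
    rwa [Set.singleton_union] at hv
  obtain ⟨a, b, hab⟩ := Submodule.mem_span_pair.1 hv'
  refine ⟨a, fun j hj => ?_⟩
  rw [← hab]
  simp [hN0 j hj]

lemma big_log {n : ℕ} (xb : Fin n → ℝ) (hxb : ∀ j, 0 < xb j) (W U : Finset (Fin n))
    (hUW : U ⊆ W) (v P : Fin n → ℝ) (α : ℝ) (hα : α ≠ 0) (hPp : ∀ j ∈ U, 0 < P j)
    (hv : ∀ j ∈ U, v j = α * P j) (hvW : ∀ j ∈ W, j ∉ U → v j = 0) (j0 : Fin n) (hj0 : j0 ∈ U)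
    (B : ℝ) (hB : 0 ≤ B) :
    ∃ σ, 0 < σ ∧ ∀ z : Fin n → ℝ, (∀ j ∈ W, 0 < z j ∧ z j < σ) →
      (∀ j, j ∉ W → |Real.log (z j / xb j)| ≤ B) →
      1 ≤ |∑ j, v j * Real.log (z j / xb j)| := by
  classical
  obtain ⟨ω, hω, hωb⟩ := finset_pos_lb Finset.univ xb fun j _ => hxb j
  have hαa : 0 < |α| := abs_pos.2 hα
  have hP0 := hPp j0 hj0
  set K := (1 + ∑ j, |v j| * B) / (|α| * P j0) with hK
  refine ⟨min ω (xb j0 * Real.exp (-K)), lt_min hω (mul_pos (hxb j0) (Real.exp_pos _)), ?_⟩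
  intro z hz hzO
  have hneg : ∀ j ∈ U, P j * Real.log (z j / xb j) ≤ 0 := by
    intro j hj
    obtain ⟨h1, h2⟩ := hz j (hUW hj)
    refine mul_nonpos_of_nonneg_of_nonpos (hPp j hj).le (Real.log_nonpos
      (div_nonneg h1.le (hxb j).le) ?_)
    rw [div_le_one (hxb j)]
    exact (h2.le.trans (min_le_left _ _)).trans (hωb j (Finset.mem_univ j))
  have hlog0 : Real.log (z j0 / xb j0) ≤ -K := by
    obtain ⟨h1, h2⟩ := hz j0 (hUW hj0)
    rw [Real.log_le_iff_le_exp (div_pos h1 (hxb j0)), div_le_iff₀ (hxb j0), mul_comm]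
    exact h2.le.trans (min_le_right _ _)
  have hsU : ∑ j ∈ U, P j * Real.log (z j / xb j) ≤ - (P j0 * K) := by
    rw [← Finset.add_sum_erase U _ hj0]
    have := Finset.sum_nonpos (s := U.erase j0) fun j hj => hneg j (Finset.mem_of_mem_erase hj)
    nlinarith
  have hsplit : ∑ j, v j * Real.log (z j / xb j) = α * ∑ j ∈ U, P j * Real.log (z j / xb j)
      + ∑ j ∈ Wᶜ, v j * Real.log (z j / xb j) := by
    rw [← Finset.sum_add_sum_compl W]
    congr 1
    rw [Finset.mul_sum, ← Finset.sum_subset hUW]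
    · exact Finset.sum_congr rfl fun j hj => by rw [hv j hj]; ring
    · intro j hj hjU
      rw [hvW j hj hjU, zero_mul]
  have hO : |∑ j ∈ Wᶜ, v j * Real.log (z j / xb j)| ≤ ∑ j, |v j| * B := by
    refine (Finset.abs_sum_le_sum_abs _ _).trans ?_
    refine le_trans (Finset.sum_le_sum fun j hj => ?_)
      (Finset.sum_le_sum_of_subset_of_nonneg (Finset.subset_univ (Wᶜ))
        fun j _ _ => mul_nonneg (abs_nonneg _) hB)
    rw [abs_mul]
    exact mul_le_mul_of_nonneg_left (hzO j (Finset.mem_compl.1 hj)) (abs_nonneg _)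
  have hmain : 1 + ∑ j, |v j| * B ≤ |α * ∑ j ∈ U, P j * Real.log (z j / xb j)| := by
    rw [abs_mul]
    have h1 : P j0 * K ≤ |∑ j ∈ U, P j * Real.log (z j / xb j)| := by
      have := neg_le_abs (∑ j ∈ U, P j * Real.log (z j / xb j))
      linarith
    have h2 := mul_le_mul_of_nonneg_left h1 hαa.le
    have e : |α| * (P j0 * K) = 1 + ∑ j, |v j| * B := by
      rw [hK, ← mul_assoc, mul_comm, div_mul_cancel₀ _ (mul_pos hαa hP0).ne']
    linarith
  rw [hsplit]
  have := abs_sub_abs_le_abs_sub (α * ∑ j ∈ U, P j * Real.log (z j / xb j))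
    (-(∑ j ∈ Wᶜ, v j * Real.log (z j / xb j)))
  rw [abs_neg, sub_neg_eq_add] at this
  linarith

lemma box_ex {n r : ℕ} (xb c lam : Fin n → ℝ) (hxb : ∀ j, 0 < xb j) (W : Finset (Fin n))
    (v : Fin r → Fin n → ℝ) (hcO : ∀ j, j ∉ W → 0 < c j)
    (hlO : ∀ j, j ∉ W → lam j = Real.log (c j / xb j)) :
    ∃ ε, 0 < ε ∧ ∃ B, 0 ≤ B ∧ ∃ η, 0 < η ∧ ∃ m, 0 < m ∧ ∀ z : Fin n → ℝ,
      (∀ j, j ∉ W → |z j - c j| ≤ ε) →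
      (∀ j, j ∉ W → m ≤ z j) ∧ (∀ j, j ∉ W → |Real.log (z j / xb j)| ≤ B) ∧
      ∀ i, (∀ j ∈ W, v i j = 0) → ∑ j, lam j * v i j ≠ 0 →
        η ≤ |∑ j, v i j * Real.log (z j / xb j)| := by
  classical
  obtain ⟨ω, hω, hωb⟩ := finset_pos_lb (Wᶜ) c fun j hj => hcO j (Finset.mem_compl.1 hj)
  obtain ⟨B, hB, hBb⟩ := finset_ub (Wᶜ) fun j => |Real.log (c j / xb j)|
  obtain ⟨η, hη, hηb⟩ := finset_pos_lb (Finset.univ.filter fun i => ∑ j, lam j * v i j ≠ 0)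
    (fun i => |∑ j, lam j * v i j|) fun i hi => abs_pos.2 (Finset.mem_filter.1 hi).2
  have hlc : ∀ j, j ∉ W → ContinuousAt (fun z : Fin n → ℝ => Real.log (z j / xb j)) c := by
    intro j hj
    refine ContinuousAt.log ((continuous_apply j).continuousAt.div_const _) ?_
    exact (div_pos (hcO j hj) (hxb j)).ne'
  have ev1 : ∀ᶠ z in nhds c, ∀ j, j ∉ W → ω / 2 < z j := by
    rw [eventually_all]
    intro j
    by_cases hj : j ∈ W
    · exact Eventually.of_forall fun z h => absurd hj h
    · have := hωb j (Finset.mem_compl.2 hj)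
      filter_upwards [(continuous_apply j).continuousAt.eventually
        (lt_mem_nhds (show ω / 2 < c j by linarith))] with z hz _ using hz
  have ev2 : ∀ᶠ z in nhds c, ∀ j, j ∉ W → |Real.log (z j / xb j)| < B + 1 := by
    rw [eventually_all]
    intro j
    by_cases hj : j ∈ W
    · exact Eventually.of_forall fun z h => absurd hj h
    · have := hBb j (Finset.mem_compl.2 hj)
      filter_upwards [(hlc j hj).abs.eventually
        (gt_mem_nhds (show |Real.log (c j / xb j)| < B + 1 by linarith))] with z hz _ using hz
  have ev3 : ∀ᶠ z in nhds c, ∀ i, ∑ j ∈ Wᶜ, v i j * lam j ≠ 0 →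
      |∑ j ∈ Wᶜ, v i j * lam j| / 2 < |∑ j ∈ Wᶜ, v i j * Real.log (z j / xb j)| := by
    rw [eventually_all]
    intro i
    by_cases hi : ∑ j ∈ Wᶜ, v i j * lam j = 0
    · exact Eventually.of_forall fun z h => absurd hi h
    · have hc : ContinuousAt (fun z : Fin n → ℝ => |∑ j ∈ Wᶜ, v i j * Real.log (z j / xb j)|) c := by
        refine ContinuousAt.abs (tendsto_finsetSum _ fun j hj => ?_)
        exact (hlc j (Finset.mem_compl.1 hj)).const_mul _
      have e : ∑ j ∈ Wᶜ, v i j * Real.log (c j / xb j) = ∑ j ∈ Wᶜ, v i j * lam j :=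
        Finset.sum_congr rfl fun j hj => by rw [hlO j (Finset.mem_compl.1 hj)]
      have hlt : |∑ j ∈ Wᶜ, v i j * lam j| / 2 < |∑ j ∈ Wᶜ, v i j * Real.log (c j / xb j)| := by
        rw [e]
        have := abs_pos.2 hi
        linarith
      filter_upwards [hc.eventually (lt_mem_nhds hlt)] with z hz _ using hz
  obtain ⟨ε, hε, hb⟩ := Metric.eventually_nhds_iff.1 (ev1.and (ev2.and ev3))
  refine ⟨ε / 2, by positivity, B + 1, by positivity, η / 2, by positivity, ω / 2, by positivity, ?_⟩
  intro z hz
  set z' : Fin n → ℝ := fun j => if j ∈ W then c j else z j with hz'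
  have hzz : ∀ j, j ∉ W → z' j = z j := fun j hj => by simp [hz', hj]
  have hd : dist z' c < ε := by
    rw [dist_pi_lt_iff hε]
    intro j
    by_cases hj : j ∈ W
    · simp [hz', hj, hε]
    · rw [hzz j hj, Real.dist_eq]
      linarith [hz j hj]
  obtain ⟨b1, b2, b3⟩ := hb hd
  refine ⟨fun j hj => ?_, fun j hj => ?_, fun i hiW hi => ?_⟩
  · rw [← hzz j hj]; exact (b1 j hj).le
  · rw [← hzz j hj]; exact (b2 j hj).le
  · have e1 : ∑ j, lam j * v i j = ∑ j ∈ Wᶜ, v i j * lam j := by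
      rw [← Finset.sum_add_sum_compl W, Finset.sum_eq_zero, zero_add]
      · exact Finset.sum_congr rfl fun j _ => mul_comm _ _
      · intro j hj; rw [hiW j hj, mul_zero]
    have e2 : ∑ j, v i j * Real.log (z j / xb j) = ∑ j ∈ Wᶜ, v i j * Real.log (z' j / xb j) := by
      rw [← Finset.sum_add_sum_compl W, Finset.sum_eq_zero, zero_add]
      · exact Finset.sum_congr rfl fun j hj => by rw [hzz j (Finset.mem_compl.1 hj)]
      · intro j hj; rw [hiW j hj, zero_mul]
    have h1 := b3 i (by rw [← e1]; exact hi)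
    have h2 := hηb i (Finset.mem_filter.2 ⟨Finset.mem_univ i, hi⟩)
    rw [e2]
    rw [e1] at h2
    linarith

section
variable {n r : ℕ} {y y' : Fin r → Fin n → ℕ} {k τ : Fin r → ℝ} {τm M : ℝ}
  {x : ℝ → Fin n → ℝ} {xb : Fin n → ℝ}

lemma Ctx.core_q (h : Ctx y y' k τ τm M x) (hxb : ∀ j, 0 < xb j)
    (hcb : ∀ η : Fin n → ℕ, ∑ i ∈ Finset.univ.filter (fun i => y i = η), k i * mono xb (y i)
      = ∑ i ∈ Finset.univ.filter (fun i => y' i = η), k i * mono xb (y i))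
    (R : Finset (Fin r)) (W U : Finset (Fin n)) (hUW : U ⊆ W)
    (hUR : ∀ j ∈ U, ∀ i, i ∉ R → y i j = 0 ∧ y' i j = 0)
    (hWU : ∀ i ∈ R, ∀ j ∈ W, j ∉ U → y i j = 0 ∧ y' i j = 0)
    (h2 : Module.finrank ℝ (stoichOn y y' R) = 2)
    (P : Fin n → ℝ) (hP : P ∈ stoichOn y y' R) (hPp : ∀ j ∈ U, 0 < P j)
    (lam : Fin n → ℝ)
    (e T : ℕ → ℝ) (he : Tendsto e atTop atTop) (heT : ∀ m, e m ≤ T m)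
    (hdY : ∀ j ∈ U, Tendsto (fun m => YY y k τ x j (T m) - YY y k τ x j (e m)) atTop (nhds 0))
    (hWz : ∀ σ > 0, ∀ᶠ m in atTop, ∀ u ∈ Set.Icc (e m) (T m), ∀ j ∈ W, x u j < σ)
    (B η : ℝ) (hB : 0 ≤ B) (hη : 0 < η)
    (hbox : ∀ m, ∀ u ∈ Set.Icc (e m) (T m), ∀ j, j ∉ W → |Real.log (x u j / xb j)| ≤ B)
    (hg : ∀ m, ∀ u ∈ Set.Icc (e m) (T m), ∀ i, (∀ j ∈ W, (y' i j : ℝ) - y i j = 0) →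
      ∑ j, lam j * ((y' i j : ℝ) - y i j) ≠ 0 →
      η ≤ |∑ j, ((y' i j : ℝ) - y i j) * Real.log (x u j / xb j)|) :
    Tendsto (fun m => ∑ i ∈ R, (∑ j, lam j * ((y' i j : ℝ) - y i j)) *
      (nn y k τ x i (T m) - nn y k τ x i (e m))) atTop (nhds 0) := by
  have hvR : ∀ i ∈ R, (fun j => (y' i j : ℝ) - y i j) ∈ stoichOn y y' R := fun i hi =>
    Submodule.subset_span ⟨i, hi, rfl⟩
  by_cases hA : ∀ v ∈ stoichOn y y' R, (∀ j ∈ U, v j = 0) → ∑ j, lam j * v j = 0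
  · obtain ⟨μ, hμ⟩ := factor_U _ U lam hA
    have h1 : Tendsto (fun m => ∑ j ∈ U, μ j * (YY y k τ x j (T m) - YY y k τ x j (e m)))
        atTop (nhds (∑ j ∈ U, μ j * 0)) :=
      tendsto_finsetSum _ fun j hj => (hdY j hj).const_mul _
    simp only [mul_zero, Finset.sum_const_zero] at h1
    refine h1.congr' ?_
    filter_upwards [he.eventually (eventually_gt_atTop 0)] with m hm
    have e1 : ∀ j ∈ U, μ j * (YY y k τ x j (T m) - YY y k τ x j (e m)) =
        ∑ i ∈ R, μ j * (((y' i j : ℝ) - y i j) * (nn y k τ x i (T m) - nn y k τ x i (e m))) := by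
      intro j hj
      rw [h.YYdiff j hm (heT m), Finset.mul_sum]
      symm
      refine Finset.sum_subset (Finset.subset_univ R) fun i _ hi => ?_
      simp [hUR j hj i hi]
    rw [Finset.sum_congr rfl e1, Finset.sum_comm]
    refine Finset.sum_congr rfl fun i hi => ?_
    rw [hμ _ (hvR i hi), Finset.sum_mul]
    exact Finset.sum_congr rfl fun j _ => by ring
  · push Not at hA
    obtain ⟨N, hN, hN0, hNl⟩ := hA
    have hNn : N ≠ 0 := by
      rintro rfl
      simp at hNl
    have h0 : ∀ i ∈ R, Tendsto (fun m => (∑ j, lam j * ((y' i j : ℝ) - y i j)) *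
      (nn y k τ x i (T m) - nn y k τ x i (e m))) atTop (nhds 0) := by
      intro i hi
      by_cases hl : ∑ j, lam j * ((y' i j : ℝ) - y i j) = 0
      · simp [hl]
      have hs : Tendsto (fun m => nn y k τ x i (T m) - nn y k τ x i (e m)) atTop (nhds 0) := by
        obtain ⟨α, hα⟩ := prop_U _ h2 U P N hP hN hPp hN0 hNn _ (hvR i hi)
        have hWU' : ∀ j ∈ W, j ∉ U → (y' i j : ℝ) - y i j = 0 := by
          intro j hj hjU
          simp [hWU i hi j hj hjU]
        by_cases hz : ∀ j ∈ U, (y' i j : ℝ) - y i j = 0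
        · refine h.nn_small hxb hcb e T he heT i η hη (Eventually.of_forall fun m u hu => ?_)
          refine hg m u hu i (fun j hj => ?_) hl
          by_cases hjU : j ∈ U
          · exact hz j hjU
          · exact hWU' j hj hjU
        · push Not at hz
          obtain ⟨j0, hj0, hv0⟩ := hz
          have hα0 : α ≠ 0 := by
            rintro rfl
            exact hv0 (by rw [hα j0 hj0, zero_mul])
          obtain ⟨σ, hσ, hσb⟩ := big_log xb hxb W U hUW (fun j => (y' i j : ℝ) - y i j) P α hα0 hPp
            hα hWU' j0 hj0 B hB
          refine h.nn_small hxb hcb e T he heT i 1 one_pos ?_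
          filter_upwards [hWz σ hσ] with m hm u hu
          exact hσb (x u) (fun j hj => ⟨h.pos u j, hm u hu j hj⟩) (hbox m u hu)
      simpa using hs.const_mul (∑ j, lam j * ((y' i j : ℝ) - y i j))
    simpa using tendsto_finsetSum R h0

end


section
variable {n r l : ℕ} {y y' : Fin r → Fin n → ℕ} {k τ : Fin r → ℝ} {τm M : ℝ}
  {x : ℝ → Fin n → ℝ} {xb : Fin n → ℝ}

lemma Yst_zero (W : Finset (Fin n)) (c : Fin n → ℝ) (hcW : ∀ j ∈ W, c j = 0) (j : Fin n)
    (hj : j ∈ W) : Yst y k τ c j = 0 := by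
  unfold Yst
  rw [hcW j hj, zero_add]
  refine Finset.sum_eq_zero fun i _ => ?_
  by_cases hy : y i j = 0
  · simp [hy]
  · have : mono c (y i) = 0 :=
      Finset.prod_eq_zero (Finset.mem_univ j) (by rw [hcW j hj]; exact zero_pow hy)
    simp [this]

lemma Ctx.core (h : Ctx y y' k τ τm M x) (hxb : ∀ j, 0 < xb j)
    (hcb : ∀ η : Fin n → ℕ, ∑ i ∈ Finset.univ.filter (fun i => y i = η), k i * mono xb (y i)
      = ∑ i ∈ Finset.univ.filter (fun i => y' i = η), k i * mono xb (y i))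
    (grp : Fin r → Fin l) (W : Finset (Fin n)) (U : Fin l → Finset (Fin n)) (hUW : ∀ q, U q ⊆ W)
    (hUR : ∀ q, ∀ j ∈ U q, ∀ i, i ∉ Rgrp grp q → y i j = 0 ∧ y' i j = 0)
    (hWU : ∀ q, ∀ i ∈ Rgrp grp q, ∀ j ∈ W, j ∉ U q → y i j = 0 ∧ y' i j = 0)
    (h2 : ∀ q, Module.finrank ℝ (stoichOn y y' (Rgrp grp q)) = 2)
    (c c' lam : Fin n → ℝ)
    (hcW : ∀ j ∈ W, c j = 0) (hcW' : ∀ j ∈ W, c' j = 0)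
    (hcO : ∀ j, j ∉ W → 0 < c j) (hc' : ∀ j, 0 ≤ c' j)
    (hlW : ∀ j ∈ W, lam j = 0) (hlO : ∀ j, j ∉ W → lam j = Real.log (c j / xb j))
    (e T : ℕ → ℝ) (he : Tendsto e atTop atTop) (heT : ∀ m, e m ≤ T m)
    (hTc : Tendsto (fun m => x (T m)) atTop (nhds c))
    (hec : Tendsto (fun m => x (e m)) atTop (nhds c'))
    (hWz : ∀ σ > 0, ∀ᶠ m in atTop, ∀ u ∈ Set.Icc (e m) (T m), ∀ j ∈ W, x u j < σ)
    (B η : ℝ) (hB : 0 ≤ B) (hη : 0 < η)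
    (hbox : ∀ m, ∀ u ∈ Set.Icc (e m) (T m), ∀ j, j ∉ W → |Real.log (x u j / xb j)| ≤ B)
    (hg : ∀ m, ∀ u ∈ Set.Icc (e m) (T m), ∀ i, (∀ j ∈ W, (y' i j : ℝ) - y i j = 0) →
      ∑ j, lam j * ((y' i j : ℝ) - y i j) ≠ 0 →
      η ≤ |∑ j, ((y' i j : ℝ) - y i j) * Real.log (x u j / xb j)|) : c' = c := by
  have hT : Tendsto T atTop atTop := tendsto_atTop_mono heT he
  have hYT : ∀ j, Tendsto (fun m => YY y k τ x j (T m)) atTop (nhds (Yst y k τ c j)) :=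
    fun j => h.YY_st hxb hcb T hT c hTc j
  have hYe : ∀ j, Tendsto (fun m => YY y k τ x j (e m)) atTop (nhds (Yst y k τ c' j)) :=
    fun j => h.YY_st hxb hcb e he c' hec j
  obtain ⟨L, hL⟩ := h.VV_lim hxb hcb
  have hV : Vst y k τ xb c' = Vst y k τ xb c :=
    (tendsto_nhds_unique (h.VV_st hxb hcb e he c' hec) (hL.comp he)).trans
      (tendsto_nhds_unique (h.VV_st hxb hcb T hT c hTc) (hL.comp hT)).symm
  have hq : ∀ q, Tendsto (fun m => ∑ i ∈ Rgrp grp q, (∑ j, lam j * ((y' i j : ℝ) - y i j)) *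
      (nn y k τ x i (T m) - nn y k τ x i (e m))) atTop (nhds 0) := by
    intro q
    obtain ⟨P, hP, hPe⟩ := h.YY_mem (Rgrp grp q) (U q) (hUR q) T hT
      (fun j hj => by
        have := hYT j
        rwa [Yst_zero W c hcW j (hUW q hj)] at this) 1 one_pos
    refine h.core_q hxb hcb (Rgrp grp q) W (U q) (hUW q) (hUR q) (hWU q) (h2 q) P hP
      (fun j hj => by rw [hPe j hj]; exact h.YYpos j 1) lam e T he heT ?_ hWz B η hB hη hbox hg
    intro j hj
    have := (hYT j).sub (hYe j)
    rwa [Yst_zero W c hcW j (hUW q hj), Yst_zero W c' hcW' j (hUW q hj), sub_zero] at this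
  have hall : Tendsto (fun m => ∑ i, (∑ j, lam j * ((y' i j : ℝ) - y i j)) *
      (nn y k τ x i (T m) - nn y k τ x i (e m))) atTop (nhds 0) := by
    have := tendsto_finsetSum (Finset.univ : Finset (Fin l)) fun q _ => hq q
    simp only [Finset.sum_const_zero] at this
    refine this.congr fun m => ?_
    unfold Rgrp
    exact Finset.sum_fiberwise _ _ _
  have hlim : Tendsto (fun m => ∑ j, lam j * (YY y k τ x j (e m) - YY y k τ x j (T m))) atTop
      (nhds (∑ j, lam j * (Yst y k τ c' j - Yst y k τ c j))) :=
    tendsto_finsetSum _ fun j _ => ((hYe j).sub (hYT j)).const_mul _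
  have hlim0 : Tendsto (fun m => ∑ j, lam j * (YY y k τ x j (e m) - YY y k τ x j (T m))) atTop
      (nhds 0) := by
    have hn := hall.neg
    rw [neg_zero] at hn
    refine hn.congr' ?_
    filter_upwards [he.eventually (eventually_gt_atTop 0)] with m hm
    have e1 : ∀ j, lam j * (YY y k τ x j (e m) - YY y k τ x j (T m)) =
        - ∑ i, lam j * (((y' i j : ℝ) - y i j) * (nn y k τ x i (T m) - nn y k τ x i (e m))) := by
      intro j
      rw [← Finset.mul_sum, ← h.YYdiff j hm (heT m)]
      ring
    simp_rw [e1]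
    rw [Finset.sum_neg_distrib, Finset.sum_comm]
    congr 1
    refine Finset.sum_congr rfl fun i _ => ?_
    rw [Finset.sum_mul]
    exact Finset.sum_congr rfl fun j _ => by ring
  exact st_eq (y := y) h.hk h.hτ hxb W c c' lam hcW hcW' hcO hc' hlW hlO hV
    (tendsto_nhds_unique hlim hlim0)

lemma Ctx.sweepW (H : Ctx y y' k τ τm M x)
    (grp : Fin r → Fin l) (W : Finset (Fin n)) (U : Fin l → Finset (Fin n)) (hUW : ∀ q, U q ⊆ W)
    (hWUex : ∀ j ∈ W, ∃ q, j ∈ U q)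
    (hUR : ∀ q, ∀ j ∈ U q, ∀ i, i ∉ Rgrp grp q → y i j = 0 ∧ y' i j = 0)
    (hWU : ∀ q, ∀ i ∈ Rgrp grp q, ∀ j ∈ W, j ∉ U q → y i j = 0 ∧ y' i j = 0)
    (hsemi : ∀ q, ∀ i ∈ Rgrp grp q, (∃ j ∈ U q, y' i j ≠ 0) → ∃ j ∈ U q, y i j ≠ 0)
    (hcb : ∀ q, ComplexBalancedOn y y' k (Rgrp grp q))
    (h2 : ∀ q, Module.finrank ℝ (stoichOn y y' (Rgrp grp q)) = 2)
    (tN : ℕ → ℝ) (htN : Tendsto tN atTop atTop)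
    (hx0 : ∀ j ∈ W, Tendsto (fun N => x (tN N) j) atTop (nhds 0))
    (m : ℝ) (hm : 0 < m) :
    ∀ σ, 0 < σ → ∃ σ', 0 < σ' ∧ ∀ e T, τm + 1 ≤ e →
      (∀ t ∈ Set.Icc e T, ∀ j, j ∉ W → m ≤ x t j) →
      (∀ j ∈ W, x T j < σ') → ∀ t ∈ Set.Icc e T, ∀ j ∈ W, x t j < σ := by
  intro σ hσ
  have hq : ∀ q, ∃ σ', 0 < σ' ∧ ∀ e T, τm + 1 ≤ e →
      (∀ t ∈ Set.Icc e T, ∀ j, j ∉ W → m ≤ x t j) →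
      (∀ j ∈ U q, x T j < σ') → ∀ t ∈ Set.Icc e T, ∀ j ∈ U q, x t j < σ := by
    intro q
    rcases (U q).eq_empty_or_nonempty with hU | hU
    · exact ⟨1, one_pos, fun e T _ _ _ t _ j hj => by simp [hU] at hj⟩
    obtain ⟨σ', h1, h3⟩ := H.sweep (Rgrp grp q) (U q) hU (hUR q) (hsemi q) (hcb q) (h2 q) tN htN
      (fun j hj => hx0 j (hUW q hj)) m hm σ hσ
    refine ⟨σ', h1, fun e T he hr hT => h3 e T he (fun t ht i hi j hj hy => ?_) hT⟩
    by_cases hjW : j ∈ W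
    · exact absurd (hWU q i hi j hjW hj).1 hy
    · exact hr t ht j hjW
  choose s hs0 hs using hq
  obtain ⟨ω, hω, hωb⟩ := finset_pos_lb Finset.univ s fun q _ => hs0 q
  refine ⟨ω, hω, fun e T he hr hT t ht j hj => ?_⟩
  obtain ⟨q, hjq⟩ := hWUex j hj
  exact hs q e T he hr (fun j' hj' => (hT j' (hUW q hj')).trans_le (hωb q (Finset.mem_univ q))) t ht j hjq

lemma Ctx.main_contra (H : Ctx y y' k τ τm M x) (hxb : ∀ j, 0 < xb j)
    (hcbx : ∀ η : Fin n → ℕ, ∑ i ∈ Finset.univ.filter (fun i => y i = η), k i * mono xb (y i)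
      = ∑ i ∈ Finset.univ.filter (fun i => y' i = η), k i * mono xb (y i))
    (grp : Fin r → Fin l) (W : Finset (Fin n)) (hWne : W.Nonempty)
    (U : Fin l → Finset (Fin n)) (hUW : ∀ q, U q ⊆ W)
    (hWUex : ∀ j ∈ W, ∃ q, j ∈ U q)
    (hUR : ∀ q, ∀ j ∈ U q, ∀ i, i ∉ Rgrp grp q → y i j = 0 ∧ y' i j = 0)
    (hWU : ∀ q, ∀ i ∈ Rgrp grp q, ∀ j ∈ W, j ∉ U q → y i j = 0 ∧ y' i j = 0)
    (hsemi : ∀ q, ∀ i ∈ Rgrp grp q, (∃ j ∈ U q, y' i j ≠ 0) → ∃ j ∈ U q, y i j ≠ 0)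
    (hcb : ∀ q, ComplexBalancedOn y y' k (Rgrp grp q))
    (h2 : ∀ q, Module.finrank ℝ (stoichOn y y' (Rgrp grp q)) = 2)
    (tN : ℕ → ℝ) (htN : Tendsto tN atTop atTop)
    (c : Fin n → ℝ) (hc : Tendsto (fun N => x (tN N)) atTop (nhds c))
    (hcW : ∀ j ∈ W, c j = 0) (hcO : ∀ j, j ∉ W → 0 < c j) : False := by
  classical
  set lam : Fin n → ℝ := fun j => if j ∈ W then 0 else Real.log (c j / xb j) with hlam
  have hlW : ∀ j ∈ W, lam j = 0 := fun j hj => by simp [hlam, hj]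
  have hlO : ∀ j, j ∉ W → lam j = Real.log (c j / xb j) := fun j hj => by simp [hlam, hj]
  obtain ⟨ε, hε, B, hB, η, hη, m0, hm0, hbox⟩ := box_ex xb c lam hxb W
    (fun i j => (y' i j : ℝ) - y i j) hcO hlO
  have hxcont : Continuous x := continuous_pi H.cont
  have hx0 : ∀ j ∈ W, Tendsto (fun N => x (tN N) j) atTop (nhds 0) := by
    intro j hj
    have := tendsto_pi_nhds.1 hc j
    rwa [hcW j hj] at this
  have hsw := H.sweepW grp W U hUW hWUex hUR hWU hsemi hcb h2 tN htN hx0 m0 hm0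
  set Bad : Set (Fin n → ℝ) := ⋃ j ∈ Wᶜ, {z : Fin n → ℝ | ε ≤ |z j - c j|} with hBad
  have hBadc : IsClosed Bad := by
    refine isClosed_biUnion_finset fun j _ => ?_
    exact isClosed_le continuous_const (((continuous_apply j).sub continuous_const).abs)
  have hBadm : ∀ z, z ∈ Bad ↔ ∃ j, j ∉ W ∧ ε ≤ |z j - c j| := by
    intro z
    simp [hBad]
  have hBadn : ∀ z, z ∉ Bad → ∀ j, j ∉ W → |z j - c j| ≤ ε := by
    intro z hz j hj
    by_contra hlt
    exact hz ((hBadm z).2 ⟨j, hj, (not_le.1 hlt).le⟩)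
  have hcB : c ∉ Bad := by
    rw [hBadm]
    rintro ⟨j, _, h⟩
    simp at h
    linarith
  have hgood : ∀ᶠ N in atTop, x (tN N) ∉ Bad := hc.eventually (hBadc.isOpen_compl.mem_nhds hcB)
  obtain ⟨N1, hN1⟩ := eventually_atTop.1 hgood
  by_cases hcl : ∃ ts : ℝ, ∃ N0 : ℕ, ∀ N ≥ N0, ∀ t ∈ Set.Icc ts (tN N), x t ∉ Bad
  · obtain ⟨ts, N0, hcl⟩ := hcl
    obtain ⟨j0, hj0⟩ := hWne
    set t1 := max ts (τm + 1) with ht1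
    obtain ⟨σ', hσ', hs⟩ := hsw (x t1 j0) (H.pos t1 j0)
    have hev : ∀ᶠ N in atTop, ∀ j ∈ W, x (tN N) j < σ' := by
      rw [eventually_all_finset]
      intro j hj
      exact (hx0 j hj).eventually (gt_mem_nhds hσ')
    obtain ⟨N, ⟨hNa, hNb⟩, hNc⟩ := ((hev.and (htN.eventually (eventually_ge_atTop t1))).and
      (eventually_ge_atTop N0)).exists
    have := hs t1 (tN N) (le_max_right _ _) (fun t ht j hj =>
      (hbox (x t) (hBadn _ (hcl N hNc t ⟨le_trans (le_max_left _ _) ht.1, ht.2⟩))).1 j hj) hNa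
      t1 ⟨le_refl _, hNb⟩ j0 hj0
    exact lt_irrefl _ this
  · push Not at hcl
    have hpick : ∀ m : ℕ, ∃ N : ℕ, m ≤ N ∧ ∃ e : ℝ, (m : ℝ) ≤ e ∧ e ≤ tN N ∧ x e ∈ Bad ∧
        ∀ t ∈ Set.Icc e (tN N), ∀ j, j ∉ W → |x t j - c j| ≤ ε := by
      intro m
      obtain ⟨N, hN, t, ht, htB⟩ := hcl (m : ℝ) (max m N1)
      have hcomp : IsCompact (Set.Icc t (tN N) ∩ x ⁻¹' Bad) :=
        isCompact_Icc.inter_right (hBadc.preimage hxcont)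
      obtain ⟨e, ⟨⟨he1, he2⟩, heB⟩, hmax⟩ := hcomp.exists_isGreatest ⟨t, ⟨le_refl t, ht.2⟩, htB⟩
      have hafter : ∀ u, e < u → u ≤ tN N → x u ∉ Bad := by
        intro u hu huT hub
        exact absurd (hmax ⟨⟨he1.trans hu.le, huT⟩, hub⟩) (not_le.2 hu)
      have heN : e < tN N := by
        refine lt_of_le_of_ne he2 fun heq => ?_
        rw [heq] at heB
        exact hN1 N (le_trans (le_max_right _ _) hN) heB
      refine ⟨N, le_trans (le_max_left _ _) hN, e, ht.1.trans he1, he2, heB, ?_⟩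
      intro u hu j hj
      rcases hu.1.eq_or_lt with heu | heu
      · subst heu
        have hcj : Continuous (fun u => |x u j - c j|) := ((H.cont j).sub continuous_const).abs
        refine le_of_tendsto (hcj.continuousAt.tendsto.mono_left
          (nhdsWithin_le_nhds (s := Set.Ioi e))) ?_
        filter_upwards [Ioo_mem_nhdsGT heN] with u hu
        exact hBadn _ (hafter u hu.1 hu.2.le) j hj
      · exact hBadn _ (hafter u heu hu.2) j hj
    choose Nm hNm e he heT heB hreg using hpick
    have hNt : Tendsto Nm atTop atTop := tendsto_atTop_mono hNm tendsto_id
    have het : Tendsto e atTop atTop := tendsto_atTop_mono he tendsto_natCast_atTop_atTop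
    have hTc : Tendsto (fun m => x (tN (Nm m))) atTop (nhds c) := hc.comp hNt
    have hWz : ∀ σ > 0, ∀ᶠ m in atTop, ∀ u ∈ Set.Icc (e m) (tN (Nm m)), ∀ j ∈ W, x u j < σ := by
      intro σ hσ
      obtain ⟨σ', hσ', hs⟩ := hsw σ hσ
      have hev : ∀ᶠ m in atTop, ∀ j ∈ W, x (tN (Nm m)) j < σ' := by
        rw [eventually_all_finset]
        intro j hj
        exact ((hx0 j hj).comp hNt).eventually (gt_mem_nhds hσ')
      filter_upwards [hev, het.eventually (eventually_ge_atTop (τm + 1))] with m h1 h3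
      exact hs (e m) (tN (Nm m)) h3 (fun t ht j hj => (hbox (x t) (hreg m t ht)).1 j hj) h1
    have hcpt : IsCompact (Set.Icc (0 : Fin n → ℝ) (fun _ => M)) := isCompact_Icc
    obtain ⟨c', hc'm, φ, hφ, hφl⟩ := hcpt.tendsto_subseq (x := fun m => x (e m))
      fun m => ⟨fun j => (H.pos _ j).le, fun j => H.le _ j⟩
    have hφt := hφ.tendsto_atTop
    have hφl' : Tendsto (fun m => x (e (φ m))) atTop (nhds c') := hφl
    have hc'W : ∀ j ∈ W, c' j = 0 := by
      intro j hj
      have h1 := tendsto_pi_nhds.1 hφl' j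
      refine le_antisymm (le_of_forall_pos_le_add fun σ hσ => ?_) (hc'm.1 j)
      rw [zero_add]
      refine le_of_tendsto h1 ?_
      filter_upwards [hφt.eventually (hWz σ hσ)] with m hm
      exact (hm _ ⟨le_refl _, heT _⟩ j hj).le
    have hc'B : c' ∈ Bad := hBadc.mem_of_tendsto hφl' (Eventually.of_forall fun m => heB _)
    have heq := H.core hxb hcbx grp W U hUW hUR hWU h2 c c' lam hcW hc'W hcO (fun j => hc'm.1 j)
      hlW hlO (fun m => e (φ m)) (fun m => tN (Nm (φ m))) (het.comp hφt) (fun m => heT _)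
      (hTc.comp hφt) hφl' (fun σ hσ => hφt.eventually (hWz σ hσ)) B η hB hη
      (fun m u hu => (hbox (x u) (hreg _ u hu)).2.1)
      (fun m u hu => (hbox (x u) (hreg _ u hu)).2.2)
    exact hcB (heq ▸ hc'B)

end


theorem stmt3 {n r l : ℕ} (y y' : Fin r → Fin n → ℕ)
    (k τ : Fin r → ℝ) (τm : ℝ)
    (hk : ∀ i, 0 < k i) (hτ : ∀ i, 0 ≤ τ i) (hτm : ∀ i, τ i ≤ τm) (hτm0 : 0 ≤ τm)
    (hCB : ComplexBalancedOn y y' k Finset.univ)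
    (Sp : Fin l → Set (Fin n)) (grp : Fin r → Fin l)
    (hcomb : IsCombination y y' Sp grp)
    (hsubCB : ∀ p, ComplexBalancedOn y y' k (Rgrp grp p))
    (h2d : ∀ p, Module.finrank ℝ (stoichOn y y' (Rgrp grp p)) = 2)
    (W : Set (Fin n)) (hW : Semilocking y y' Finset.univ W)
    (hWSc : interSpecies Sp ∩ W = ∅)
    (hcaseI : ∃ p, Semilocking y y' (Rgrp grp p) (W ∩ Sp p) ∧
      FacetType (stoichOn y y' (Rgrp grp p)) (W ∩ Sp p))
    (x : ℝ → Fin n → ℝ) (hx : IsSolution y y' k τ τm x)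
    (hxpos : PosInit τm x) (hxbdd : BoundedSol τm x)
    (θ : ℝ → Fin n → ℝ) (hθ : OmegaLimitPt τm x θ) :
    ¬ OnBoundary τm W θ := by
  classical
  intro hb
  obtain ⟨M, H⟩ := pos_of_solution y y' k τ τm hk hτ hτm hτm0 x hx hxpos hxbdd
  obtain ⟨xb, hxb, hcbx⟩ := hCB
  obtain ⟨_, hθ0, tN, htN, hlim⟩ := hθ
  have h0 : (0:ℝ) ∈ Set.Icc (-τm) 0 := ⟨by linarith, le_refl _⟩
  have hdisj : ∀ j ∈ W, ∀ p q, j ∈ Sp p → j ∈ Sp q → p = q := by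
    intro j hj p q hp hq
    by_contra hne
    have : j ∈ interSpecies Sp ∩ W := ⟨⟨p, q, hne, hp, hq⟩, hj⟩
    rw [hWSc] at this
    exact this
  have hmemR : ∀ i q, i ∈ Rgrp grp q ↔ grp i = q := by
    intro i q
    simp [Rgrp]
  refine H.main_contra hxb hcbx grp (Finset.univ.filter fun j => j ∈ W) ?_
    (fun q => Finset.univ.filter fun j => j ∈ W ∧ j ∈ Sp q) ?_ ?_ ?_ ?_ ?_ hsubCB h2d tN htN (θ 0) ?_ ?_ ?_
  · obtain ⟨j, hj⟩ := hW.1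
    exact ⟨j, by simpa using hj⟩
  · intro q j hj
    simp only [Finset.mem_filter, Finset.mem_univ, true_and] at hj ⊢
    exact hj.1
  · intro j hj
    simp only [Finset.mem_filter, Finset.mem_univ, true_and] at hj ⊢
    obtain ⟨p, hp⟩ := hcomb.1 j
    exact ⟨p, hj, hp⟩
  · intro q j hj i hi
    simp only [Finset.mem_filter, Finset.mem_univ, true_and] at hj
    rw [hmemR] at hi
    by_contra hne
    have hor : y i j ≠ 0 ∨ y' i j ≠ 0 := by tauto
    exact hi (hdisj j hj.1 _ _ (hcomb.2 i j hor) hj.2)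
  · intro q i hi j hj hjU
    simp only [Finset.mem_filter, Finset.mem_univ, true_and] at hj hjU
    rw [hmemR] at hi
    by_contra hne
    have hor : y i j ≠ 0 ∨ y' i j ≠ 0 := by tauto
    exact hjU ⟨hj, hi ▸ hcomb.2 i j hor⟩
  · rintro q i hi ⟨j, hj, hyj⟩
    simp only [Finset.mem_filter, Finset.mem_univ, true_and] at hj
    rw [hmemR] at hi
    obtain ⟨j', hj', hy⟩ := hW.2 i (Finset.mem_univ i) ⟨j, hj.1, hyj⟩
    refine ⟨j', ?_, hy⟩
    simp only [Finset.mem_filter, Finset.mem_univ, true_and]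
    exact ⟨hj', hi ▸ hcomb.2 i j' (Or.inl hy)⟩
  · rw [Metric.tendsto_atTop]
    intro ε hε
    obtain ⟨N0, hN0⟩ := hlim ε hε
    obtain ⟨N1, hN1⟩ := eventually_atTop.1 (htN.eventually (eventually_ge_atTop (-τm)))
    refine ⟨max N0 N1, fun N hN => ?_⟩
    have h1 := hN0 N (le_trans (le_max_left _ _) hN) 0 h0
    rw [add_zero] at h1
    rw [max_eq_left (hN1 N (le_trans (le_max_right _ _) hN)), dist_eq_norm]
    exact h1
  · intro j hj
    simp only [Finset.mem_filter, Finset.mem_univ, true_and] at hj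
    exact hb.1 0 h0 j hj
  · intro j hj
    simp only [Finset.mem_filter, Finset.mem_univ, true_and] at hj
    exact lt_of_le_of_ne (hθ0 0 h0 j) (hb.2 0 h0 j hj).symm
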